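/- arXiv:2109.01022 — 3 statements merged into one kernel-verified Lean document; each statement's English description precedes it below -/
import Mathlib

section
/- Let N ≥ 2 be a natural number and let angles 0 = θ₁ < θ₂ < … < θ_N < π be given; set θ_{N+1} = π, and let n ∈ {1,…,N} satisfy θ_n < π/2 ≤ θ_{n+1}. Then ⋂_{k=1}^{N} 𝓝 R_{θ_k}ᵀ = 𝓝 ∩ 𝓝 R_{θ_n}ᵀ ∩ 𝓝 R_{θ_{n+1}}ᵀ. -/
open Matrix Real Set MeasureTheory

noncomputable section

/-- The space of real 2×2 matrices. -/
abbrev M2 : Type := Matrix (Fin 2) (Fin 2) ℝ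

/-- Euclidean norm on ℝ². -/
def enorm2 (v : Fin 2 → ℝ) : ℝ := Real.sqrt ((v 0) ^ 2 + (v 1) ^ 2)

/-- Rotation matrix by angle θ. -/
def rot (θ : ℝ) : M2 := !![Real.cos θ, -Real.sin θ; Real.sin θ, Real.cos θ]

/-- The set of rotations SO(2). -/
def SO2 : Set M2 := {R : M2 | ∃ θ : ℝ, R = rot θ}

def e1 : Fin 2 → ℝ := ![1, 0]
def e2 : Fin 2 → ℝ := ![0, 1]

/-- Perpendicular vector w⊥ = (−w₂, w₁). -/
def perp (w : Fin 2 → ℝ) : Fin 2 → ℝ := ![-(w 1), w 0]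

/-- 𝓜_s = {F : det F = 1 and ‖F s‖ = 1}. -/
def calM (s : Fin 2 → ℝ) : Set M2 := {F : M2 | F.det = 1 ∧ enorm2 (F.mulVec s) = 1}

/-- 𝓝_s = {F : det F = 1 and ‖F s‖ ≤ 1}. -/
def calN (s : Fin 2 → ℝ) : Set M2 := {F : M2 | F.det = 1 ∧ enorm2 (F.mulVec s) ≤ 1}

/-- Squared length of the image of the unit vector of angle `a`. -/
def gg (F : M2) (a : ℝ) : ℝ :=
  (F 0 0 * cos a + F 0 1 * sin a) ^ 2 + (F 1 0 * cos a + F 1 1 * sin a) ^ 2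

lemma mem_rot (F : M2) (a : ℝ) :
    F * rot a ∈ calN e1 ↔ F.det = 1 ∧ gg F a ≤ 1 := by
  have hd : (F * rot a).det = F.det := by
    rw [Matrix.det_mul]
    have : (rot a).det = 1 := by
      simp only [rot, Matrix.det_fin_two_of]
      nlinarith [sin_sq_add_cos_sq a]
    rw [this, mul_one]
  have he : enorm2 ((F * rot a).mulVec e1) = Real.sqrt (gg F a) := by
    simp [enorm2, e1, gg, rot, Matrix.mulVec, dotProduct, Matrix.mul_apply, Fin.sum_univ_two]
  simp only [calN, Set.mem_ofPred_eq, hd, he, Real.sqrt_le_one]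

lemma rot_zero' : rot 0 = 1 := by
  ext i j
  fin_cases i <;> fin_cases j <;> simp [rot]

lemma gg_pi (F : M2) : gg F π = gg F 0 := by
  simp [gg]

lemma gg_between (F : M2) (hF : F.det = 1) (a b c : ℝ) (hab : a ≤ b) (hbc : b ≤ c)
    (hac : c - a ≤ π / 2) (h1 : gg F a ≤ 1) (h2 : gg F c ≤ 1) : gg F b ≤ 1 := by
  have hpi := Real.pi_pos
  rcases eq_or_lt_of_le (hab.trans hbc) with h | h
  · have : b = a := by linarith
    rwa [this]
  rw [Matrix.det_fin_two] at hF
  have hS : 0 < sin (c - a) := sin_pos_of_pos_of_lt_pi (by linarith) (by linarith)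
  have hA : 0 ≤ sin (c - b) := sin_nonneg_of_nonneg_of_le_pi (by linarith) (by linarith)
  have hB : 0 ≤ sin (b - a) := sin_nonneg_of_nonneg_of_le_pi (by linarith) (by linarith)
  have hC : 0 ≤ cos (c - a) := cos_nonneg_of_mem_Icc ⟨by linarith, by linarith⟩
  have ec : sin (c - a) * cos b = sin (c - b) * cos a + sin (b - a) * cos c := by
    simp only [sin_sub]; ring
  have es : sin (c - a) * sin b = sin (c - b) * sin a + sin (b - a) * sin c := by
    simp only [sin_sub]; ring
  have e0 : cos a * sin c - cos c * sin a = sin (c - a) := by rw [sin_sub]; ring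
  have e1 : cos (c - a) = cos c * cos a + sin c * sin a := cos_sub c a
  have eq1 := sin_sq_add_cos_sq (c - a)
  have eqa := sin_sq_add_cos_sq a
  have eqb := sin_sq_add_cos_sq b
  have eqc := sin_sq_add_cos_sq c
  unfold gg at *
  generalize sin (c - a) = S at *
  generalize sin (c - b) = A at *
  generalize sin (b - a) = B at *
  generalize cos (c - a) = C at *
  have eN : S ^ 2 = A ^ 2 + B ^ 2 + 2 * (A * B) * C := by
    have : S ^ 2 = (S * sin b) ^ 2 + (S * cos b) ^ 2 := by linear_combination (-S ^ 2) * eqb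
    rw [this, ec, es, e1]
    linear_combination A ^ 2 * eqa + B ^ 2 * eqc
  have hx : S * (F 0 0 * cos b + F 0 1 * sin b) =
      A * (F 0 0 * cos a + F 0 1 * sin a) + B * (F 0 0 * cos c + F 0 1 * sin c) := by
    linear_combination F 0 0 * ec + F 0 1 * es
  have hy : S * (F 1 0 * cos b + F 1 1 * sin b) =
      A * (F 1 0 * cos a + F 1 1 * sin a) + B * (F 1 0 * cos c + F 1 1 * sin c) := by
    linear_combination F 1 0 * ec + F 1 1 * es
  have hdet : (F 0 0 * cos a + F 0 1 * sin a) * (F 1 0 * cos c + F 1 1 * sin c) -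
      (F 0 0 * cos c + F 0 1 * sin c) * (F 1 0 * cos a + F 1 1 * sin a) = S := by
    linear_combination (cos a * sin c - cos c * sin a) * hF + e0
  generalize F 0 0 * cos a + F 0 1 * sin a = x1 at *
  generalize F 1 0 * cos a + F 1 1 * sin a = y1 at *
  generalize F 0 0 * cos c + F 0 1 * sin c = x2 at *
  generalize F 1 0 * cos c + F 1 1 * sin c = y2 at *
  generalize F 0 0 * cos b + F 0 1 * sin b = x at *
  generalize F 1 0 * cos b + F 1 1 * sin b = y at *
  have hprod : (x1 ^ 2 + y1 ^ 2) * (x2 ^ 2 + y2 ^ 2) ≤ 1 :=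
    mul_le_one₀ h1 (by positivity) h2
  have hid : (x1 ^ 2 + y1 ^ 2) * (x2 ^ 2 + y2 ^ 2) = (x1 * x2 + y1 * y2) ^ 2 + S ^ 2 := by
    rw [← hdet]; ring
  have hip : x1 * x2 + y1 * y2 ≤ C := abs_le_of_sq_le_sq' (by linarith) hC |>.2
  have hfin : S ^ 2 * (x ^ 2 + y ^ 2) ≤ S ^ 2 * 1 := by
    have : S ^ 2 * (x ^ 2 + y ^ 2) = A ^ 2 * (x1 ^ 2 + y1 ^ 2) + B ^ 2 * (x2 ^ 2 + y2 ^ 2)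
        + 2 * (A * B) * (x1 * x2 + y1 * y2) := by
      have : S ^ 2 * (x ^ 2 + y ^ 2) = (S * x) ^ 2 + (S * y) ^ 2 := by ring
      rw [this, hx, hy]; ring
    rw [this, mul_one, eN]
    have k1 := mul_le_mul_of_nonneg_left h1 (sq_nonneg A)
    have k2 := mul_le_mul_of_nonneg_left h2 (sq_nonneg B)
    have k3 := mul_le_mul_of_nonneg_left hip (mul_nonneg zero_le_two (mul_nonneg hA hB))
    linarith
  exact le_of_mul_le_mul_left hfin (by positivity)

/-- Characterization of the Taylor bound for the relaxed problem:
the intersection ⋂_{k=1}^N 𝓝 R_{θ_k}ᵀ equals 𝓝 ∩ 𝓝 R_{θ_n}ᵀ ∩ 𝓝 R_{θ_{n+1}}ᵀ. -/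
theorem stmt0 (N : ℕ) (hN : 2 ≤ N) (θ : ℕ → ℝ)
    (hθ1 : θ 1 = 0)
    (hmono : ∀ k, 1 ≤ k → k < N → θ k < θ (k + 1))
    (hθN : θ N < Real.pi)
    (hθN1 : θ (N + 1) = Real.pi)
    (n : ℕ) (hn1 : 1 ≤ n) (hnN : n ≤ N)
    (hlow : θ n < Real.pi / 2) (hhigh : Real.pi / 2 ≤ θ (n + 1)) :
    (⋂ k ∈ Finset.Icc 1 N, {F : M2 | F * rot (θ k) ∈ calN e1}) =
      calN e1 ∩ {F : M2 | F * rot (θ n) ∈ calN e1} ∩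
        {F : M2 | F * rot (θ (n + 1)) ∈ calN e1} := by
  have hm : ∀ j k, 1 ≤ j → j ≤ k → k ≤ N → θ j ≤ θ k := by
    intro j k hj hjk
    induction k, hjk using Nat.le_induction with
    | base => intro _; exact le_rfl
    | succ m hm ih =>
      intro hmN
      exact (ih (by omega)).trans (hmono m (by omega) (by omega)).le
  have h0 : ∀ F : M2, F ∈ calN e1 ↔ F.det = 1 ∧ gg F 0 ≤ 1 := by
    intro F
    rw [← mem_rot, rot_zero', mul_one]
  ext F
  simp only [Set.mem_iInter, Finset.mem_Icc, Set.mem_inter_iff, Set.mem_ofPred_eq, mem_rot]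
  simp only [h0]
  constructor
  · intro h
    have ha := h 1 ⟨le_rfl, by omega⟩
    rw [hθ1] at ha
    refine ⟨⟨ha, h n ⟨hn1, hnN⟩⟩, ?_⟩
    rcases hnN.lt_or_eq with hlt | heq
    · exact h (n + 1) ⟨by omega, by omega⟩
    · rw [heq, hθN1, gg_pi]
      exact ha
  · rintro ⟨⟨⟨hd, ha⟩, -, hb⟩, -, hc⟩ k ⟨hk1, hkN⟩
    refine ⟨hd, ?_⟩
    rcases le_or_gt k n with hk | hk
    · have h1 := hm 1 k le_rfl hk1 hkN
      rw [hθ1] at h1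
      exact gg_between F hd 0 (θ k) (θ n) h1 (hm k n hk1 hk hnN) (by linarith) ha hb
    · have h1 := hm k N hk1 hkN le_rfl
      exact gg_between F hd (θ (n + 1)) (θ k) π (hm (n + 1) k (by omega) hk hkN)
        (by linarith) (by linarith) hc (by rwa [gg_pi])
end
end

section
/- For every natural number k ≥ 1, let 𝓣_k = {(θ₁,…,θ_k) ∈ (0,π)^k : 𝓝 ∩ ⋂_{i=1}^{k} 𝓝 R_{θ_i}ᵀ = SO(2)}, regarded as a subset of ℝ^k. Then the k-dimensional Lebesgue measure of 𝓣_k equals π^k · (1 − (k+1)/2^k). -/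
open Matrix Real Set MeasureTheory

noncomputable section

/-- There is an open half circle containing all doubled angles and `0`. -/
def BadDir {k : ℕ} (θ : Fin k → ℝ) : Prop :=
  ∃ u v : ℝ, u < 0 ∧ ∀ i, u * Real.cos (2 * θ i) + v * Real.sin (2 * θ i) < 0

theorem enorm2_le_one (v : Fin 2 → ℝ) : enorm2 v ≤ 1 ↔ v 0 ^ 2 + v 1 ^ 2 ≤ 1 := by
  unfold enorm2
  rw [Real.sqrt_le_iff, one_pow]
  exact ⟨fun h => h.2, fun h => ⟨zero_le_one, h⟩⟩

theorem mem_calN (a b c d : ℝ) : !![a, b; c, d] ∈ calN e1 ↔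
    a * d - b * c = 1 ∧ a ^ 2 + c ^ 2 ≤ 1 := by
  simp [calN, enorm2_le_one, e1, Matrix.det_fin_two, Matrix.mulVec, dotProduct, Fin.sum_univ_two]

theorem mul_rot (a b c d t : ℝ) : !![a, b; c, d] * rot t =
    !![a * Real.cos t + b * Real.sin t, -a * Real.sin t + b * Real.cos t;
       c * Real.cos t + d * Real.sin t, -c * Real.sin t + d * Real.cos t] := by
  ext i j
  fin_cases i <;> fin_cases j <;> simp [rot, Matrix.mul_apply, Fin.sum_univ_two]

theorem mem_calN_rot (a b c d t : ℝ) : !![a, b; c, d] * rot t ∈ calN e1 ↔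
    a * d - b * c = 1 ∧ (a * Real.cos t + b * Real.sin t) ^ 2
      + (c * Real.cos t + d * Real.sin t) ^ 2 ≤ 1 := by
  rw [mul_rot, mem_calN]
  have h := Real.sin_sq_add_cos_sq t
  have : (a * Real.cos t + b * Real.sin t) * (-c * Real.sin t + d * Real.cos t)
    - (-a * Real.sin t + b * Real.cos t) * (c * Real.cos t + d * Real.sin t) = a * d - b * c := by
    linear_combination (a * d - b * c) * h
  rw [this]

theorem mem_SO2 (a b c d : ℝ) : !![a, b; c, d] ∈ SO2 ↔ a = d ∧ b = -c ∧ a ^ 2 + c ^ 2 = 1 := by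
  constructor
  · rintro ⟨t, ht⟩
    have h00 := congrFun (congrFun ht 0) 0
    have h01 := congrFun (congrFun ht 0) 1
    have h10 := congrFun (congrFun ht 1) 0
    have h11 := congrFun (congrFun ht 1) 1
    simp [rot] at h00 h01 h10 h11
    subst h00 h01 h10 h11
    exact ⟨rfl, rfl, Real.cos_sq_add_sin_sq t⟩
  · rintro ⟨rfl, rfl, h⟩
    have hz : ‖(⟨a, c⟩ : ℂ)‖ = 1 := by
      rw [Complex.norm_def, Complex.normSq_mk, Real.sqrt_eq_one]; linarith
    have hz0 : (⟨a, c⟩ : ℂ) ≠ 0 := by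
      intro h0; rw [h0] at hz; simp at hz
    refine ⟨Complex.arg ⟨a, c⟩, ?_⟩
    have h1 := Complex.cos_arg hz0
    have h2 := Complex.sin_arg (⟨a, c⟩ : ℂ)
    rw [hz] at h1 h2
    simp at h1 h2
    simp [rot, h1, h2]

theorem quad_ident (a b c d t : ℝ) : (a * Real.cos t + b * Real.sin t) ^ 2
      + (c * Real.cos t + d * Real.sin t) ^ 2 = (a ^ 2 + b ^ 2 + c ^ 2 + d ^ 2) / 2
      + (a ^ 2 + c ^ 2 - b ^ 2 - d ^ 2) / 2 * Real.cos (2 * t)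
      + (a * b + c * d) * Real.sin (2 * t) := by
  rw [Real.cos_two_mul, Real.sin_two_mul]
  have h := Real.sin_sq_add_cos_sq t
  linear_combination (b ^ 2 + d ^ 2) * h

theorem eq_SO2_iff {k : ℕ} (θ : Fin k → ℝ) :
    (calN e1 ∩ ⋂ i, {F : M2 | F * rot (θ i) ∈ calN e1}) = SO2 ↔ ¬ BadDir θ := by
  constructor
  · rintro h ⟨u, v, hu, huv⟩
    -- uniform gap
    obtain ⟨ε, hε, h0, hi⟩ : ∃ ε > 0, ε * (u ^ 2 + v ^ 2) ≤ -u ∧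
        ∀ i, ε * (u ^ 2 + v ^ 2) ≤ -(u * Real.cos (2 * θ i) + v * Real.sin (2 * θ i)) := by
      have hn : 0 < u ^ 2 + v ^ 2 := by nlinarith [sq_nonneg v]
      have key : ∀ f : Option (Fin k) → ℝ, (∀ i, 0 < f i) → ∃ ε > 0, ∀ i, ε ≤ f i := by
        intro f hf
        obtain ⟨i, hi⟩ := Finite.exists_min f
        exact ⟨f i, hf i, hi⟩
      obtain ⟨ε, hε, h⟩ := key (fun o => o.elim (-u / (u ^ 2 + v ^ 2)) (fun i =>
        -(u * Real.cos (2 * θ i) + v * Real.sin (2 * θ i)) / (u ^ 2 + v ^ 2))) (by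
          rintro (_ | i)
          · exact div_pos (by linarith) hn
          · exact div_pos (by linarith [huv i]) hn)
      refine ⟨ε, hε, ?_, fun i => ?_⟩
      · exact (le_div_iff₀ hn).1 (h none)
      · exact (le_div_iff₀ hn).1 (h (some i))
    set U := ε * u with hU
    set V := ε * v with hV
    set x := Real.sqrt (1 + U ^ 2 + V ^ 2) with hx
    have hx2 : x ^ 2 = 1 + U ^ 2 + V ^ 2 := Real.sq_sqrt (by positivity)
    have hx1 : 1 ≤ x := by
      rw [hx, Real.one_le_sqrt]; nlinarith [sq_nonneg U, sq_nonneg V]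
    have main : ∀ w : ℝ, ε * (u ^ 2 + v ^ 2) ≤ -w → 2 * (U ^ 2 + V ^ 2) + 2 * x * (ε * w) ≤ 0 := by
      intro w hw
      have e : U ^ 2 + V ^ 2 = ε * (ε * (u ^ 2 + v ^ 2)) := by rw [hU, hV]; ring
      have h1 : 0 ≤ ε * (u ^ 2 + v ^ 2) := by positivity
      have h2 : ε * (u ^ 2 + v ^ 2) ≤ x * -w := by nlinarith
      rw [e]
      nlinarith [mul_le_mul_of_nonneg_left h2 hε.le]
    have hdet : (x + U) * (x - U) - V * V = 1 := by linear_combination hx2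
    have hmem : !![x + U, V; V, x - U] ∈
        (calN e1 ∩ ⋂ i, {F : M2 | F * rot (θ i) ∈ calN e1}) := by
      refine ⟨(mem_calN _ _ _ _).2 ⟨hdet, ?_⟩, ?_⟩
      · have := main u h0
        rw [← hU] at this
        nlinarith
      · simp only [mem_iInter, mem_ofPred_eq]
        intro i
        refine (mem_calN_rot _ _ _ _ _).2 ⟨hdet, ?_⟩
        rw [quad_ident]
        have := main _ (hi i)
        have e : ε * (u * Real.cos (2 * θ i) + v * Real.sin (2 * θ i)) =
          U * Real.cos (2 * θ i) + V * Real.sin (2 * θ i) := by rw [hU, hV]; ring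
        rw [e] at this
        nlinarith
    rw [h, mem_SO2] at hmem
    have : U < 0 := mul_neg_of_pos_of_neg hε hu
    linarith [hmem.1]
  · intro hb
    apply Subset.antisymm
    · rintro F ⟨hF, hFi⟩
      obtain ⟨a, b, c, d, rfl⟩ : ∃ a b c d, F = !![a, b; c, d] := ⟨_, _, _, _, Matrix.eta_fin_two F⟩
      simp only [mem_iInter, mem_ofPred_eq, mem_calN_rot, quad_ident] at hFi
      rw [mem_calN] at hF
      obtain ⟨hdet, hac⟩ := hF
      by_contra hns
      apply hb
      have hpos : 0 < (a - d) ^ 2 + (b + c) ^ 2 := by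
        rcases eq_or_ne (a - d) 0 with h1 | h1
        · rcases eq_or_ne (b + c) 0 with h2 | h2
          · exfalso
            apply hns
            rw [mem_SO2]
            have h1' : a = d := by linarith
            have h2' : b = -c := by linarith
            refine ⟨h1', h2', ?_⟩
            subst h1' h2'
            linarith
          · positivity
        · positivity
      refine ⟨(a ^ 2 + c ^ 2 - b ^ 2 - d ^ 2) / 2, a * b + c * d, by nlinarith, fun i => ?_⟩
      have := (hFi i).2
      nlinarith
    · rintro F ⟨t, rfl⟩
      have h := Real.sin_sq_add_cos_sq t
      refine ⟨(mem_calN _ _ _ _).2 ⟨by linarith, by linarith⟩, ?_⟩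
      simp only [mem_iInter, mem_ofPred_eq]
      intro i
      refine (mem_calN_rot _ _ _ _ _).2 ⟨by linarith, ?_⟩
      have h' := Real.sin_sq_add_cos_sq (θ i)
      apply le_of_eq
      linear_combination h + (Real.sin t ^ 2 + Real.cos t ^ 2) * h' - h + h

/-- Pieces. -/
def Epiece {k : ℕ} (j : Fin k) : Set (Fin k → ℝ) :=
  {θ | (π / 2 < θ j ∧ θ j < π) ∧
    ∀ i, (θ j ≤ θ i ∧ θ i < π) ∨ (0 < θ i ∧ θ i < θ j - π / 2)}

def Ezero (k : ℕ) : Set (Fin k → ℝ) := {θ | ∀ i, θ i ∈ Ioo 0 (π / 2)}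

def Bset (k : ℕ) : Set (Fin k → ℝ) := {θ | (∀ i, θ i ∈ Ioo 0 π) ∧ BadDir θ}

/-- If all doubled angles (mod 2π) and 0 lie in [c, c+π), then bad. -/
theorem badDir_of {k : ℕ} (θ : Fin k → ℝ) (s : ℝ) (o : Option (Fin k) → ℝ)
    (h0 : ∀ i, 0 ≤ o i) (h1 : ∀ i, o i < π)
    (hc0 : Real.cos (s + o none) = 1 ∧ Real.sin (s + o none) = 0)
    (hc : ∀ i, Real.cos (s + o (some i)) = Real.cos (2 * θ i) ∧
      Real.sin (s + o (some i)) = Real.sin (2 * θ i)) : BadDir θ := by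
  obtain ⟨m, hm⟩ := Finite.exists_max o
  set c := s + o m / 2 with hcdef
  have key : ∀ i, 0 < Real.cos (s + o i) * Real.cos c + Real.sin (s + o i) * Real.sin c := by
    intro i
    rw [← Real.cos_sub]
    apply Real.cos_pos_of_mem_Ioo
    have := h0 i; have := hm i; have := h1 m
    constructor <;> rw [hcdef] <;> linarith
  refine ⟨-Real.cos c, -Real.sin c, ?_, fun i => ?_⟩
  · have := key none
    rw [hc0.1, hc0.2] at this; linarith
  · have := key (some i)
    rw [(hc i).1, (hc i).2] at this; linarith

theorem Bset_eq (k : ℕ) : Bset k = Ezero k ∪ ⋃ j, Epiece j := by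
  have hπ := Real.pi_pos
  apply Subset.antisymm
  · rintro θ ⟨hθ, u, v, hu, huv⟩
    have hne : ∀ i, θ i ≠ π / 2 := by
      intro i hi
      have := huv i
      rw [hi, show 2 * (π / 2) = π by ring] at this
      simp at this
      linarith
    by_cases hall : ∀ i, θ i < π / 2
    · left
      exact fun i => ⟨(hθ i).1, hall i⟩
    · right
      push Not at hall
      obtain ⟨j0, hj0⟩ := hall
      obtain ⟨j, hj, hmin⟩ := (Finset.univ.filter (fun i => π / 2 ≤ θ i)).exists_min_image θ
        ⟨j0, by simpa using hj0⟩
      simp only [Finset.mem_filter, Finset.mem_univ, true_and] at hj hmin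
      have hj' : π / 2 < θ j := lt_of_le_of_ne hj (hne j).symm
      refine mem_iUnion.2 ⟨j, ⟨hj', (hθ j).2⟩, fun i => ?_⟩
      rcases le_or_gt (π / 2) (θ i) with h | h
      · exact Or.inl ⟨hmin i h, (hθ i).2⟩
      · refine Or.inr ⟨(hθ i).1, ?_⟩
        by_contra hcon
        push Not at hcon
        have hi1 := (hθ i).1
        have hj1 := (hθ j).2
        have s1 : 0 < Real.sin (2 * θ i) := Real.sin_pos_of_pos_of_lt_pi (by linarith) (by linarith)
        have s2 : 0 < -Real.sin (2 * θ j) := by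
          rw [← Real.sin_sub_pi]
          exact Real.sin_pos_of_pos_of_lt_pi (by linarith) (by linarith)
        have s3 : 0 ≤ Real.sin (2 * θ j - 2 * θ i) :=
          Real.sin_nonneg_of_nonneg_of_le_pi (by linarith) (by linarith)
        rw [Real.sin_sub] at s3
        have a1 := huv i
        have a2 := huv j
        nlinarith [mul_pos s2 (neg_pos.2 a1), mul_pos s1 (neg_pos.2 a2),
          mul_nonneg s3 (neg_pos.2 hu).le]
  · rintro θ (h | h)
    · refine ⟨fun i => ⟨(h i).1, by linarith [(h i).2]⟩, ?_⟩
      refine badDir_of θ 0 (fun o => o.elim 0 (fun i => 2 * θ i)) ?_ ?_ ?_ ?_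
      · rintro (_ | i)
        · exact le_rfl
        · have := (h i).1; show 0 ≤ 2 * θ i; linarith
      · rintro (_ | i)
        · exact hπ
        · have := (h i).2; show 2 * θ i < π; linarith
      · simp
      · intro i; simp
    · obtain ⟨j, ⟨hj1, hj2⟩, hj⟩ := mem_iUnion.1 h
      constructor
      · intro i
        rcases hj i with h | h
        · exact ⟨by linarith, h.2⟩
        · exact ⟨h.1, by linarith⟩
      refine badDir_of θ (2 * θ j) (fun o => o.elim (2 * π - 2 * θ j)
        (fun i => if θ j ≤ θ i then 2 * θ i - 2 * θ j else 2 * θ i + 2 * π - 2 * θ j)) ?_ ?_ ?_ ?_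
      · rintro (_ | i)
        · show 0 ≤ 2 * π - 2 * θ j; linarith
        · show 0 ≤ ite _ _ _
          split_ifs with h
          · linarith
          · rcases hj i with h' | h'
            · exact absurd h'.1 h
            · linarith
      · rintro (_ | i)
        · show 2 * π - 2 * θ j < π; linarith
        · show ite _ _ _ < π
          split_ifs with h
          · rcases hj i with h' | h' <;> linarith
          · rcases hj i with h' | h'
            · exact absurd h'.1 h
            · linarith
      · simp
      · intro i
        show Real.cos (2 * θ j + ite _ _ _) = _ ∧ Real.sin (2 * θ j + ite _ _ _) = _
        split_ifs with h
        · rw [add_sub_cancel]; exact ⟨rfl, rfl⟩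
        · rw [add_sub_cancel, Real.cos_add_two_pi, Real.sin_add_two_pi]; exact ⟨rfl, rfl⟩

theorem meas_Ezero (k : ℕ) : MeasurableSet (Ezero k) := by
  have : Ezero k = Set.pi univ (fun _ => Ioo 0 (π / 2)) := by ext; simp [Ezero]
  rw [this]
  exact MeasurableSet.univ_pi fun _ => measurableSet_Ioo

theorem vol_Ezero (k : ℕ) : volume (Ezero k) = ENNReal.ofReal (π / 2) ^ k := by
  have : Ezero k = Set.pi univ (fun _ => Ioo 0 (π / 2)) := by ext; simp [Ezero]
  rw [this, volume_pi_pi]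
  simp

theorem meas_Epiece {k : ℕ} (j : Fin k) : MeasurableSet (Epiece j) := by
  unfold Epiece
  measurability

/-- Allowed positions of the other points. -/
def Sset (t : ℝ) : Set ℝ := {y | (t ≤ y ∧ y < π) ∨ (0 < y ∧ y < t - π / 2)}

theorem vol_Sset {t : ℝ} (h1 : π / 2 < t) (h2 : t < π) :
    volume (Sset t) = ENNReal.ofReal (π / 2) := by
  have : Sset t = Ico t π ∪ Ioo 0 (t - π / 2) := rfl
  have hπ := Real.pi_pos
  rw [this, measure_union _ measurableSet_Ioo, Real.volume_Ico, Real.volume_Ioo,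
    ← ENNReal.ofReal_add (by linarith) (by linarith)]
  · congr 1; ring
  · rw [Set.disjoint_left]
    rintro x ⟨hx, _⟩ ⟨_, hx'⟩
    linarith

theorem vol_Epiece {n : ℕ} (j : Fin (n + 1)) :
    volume (Epiece j) = ENNReal.ofReal (π / 2) ^ (n + 1) := by
  set P : Set (ℝ × (Fin n → ℝ)) :=
    {p | (π / 2 < p.1 ∧ p.1 < π) ∧ ∀ i, (p.1 ≤ p.2 i ∧ p.2 i < π) ∨
      (0 < p.2 i ∧ p.2 i < p.1 - π / 2)} with hP
  have hPm : MeasurableSet P := by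
    rw [hP]; measurability
  have hmp := volume_preserving_piFinSuccAbove (fun _ : Fin (n + 1) => ℝ) j
  have hE : Epiece j = (MeasurableEquiv.piFinSuccAbove (fun _ : Fin (n + 1) => ℝ) j) ⁻¹' P := by
    ext θ
    simp only [Epiece, hP, mem_ofPred_eq, mem_preimage, MeasurableEquiv.piFinSuccAbove_apply,
      Fin.forall_iff_succAbove j, Fin.insertNthEquiv_symm_apply, Fin.removeNth_apply]
    constructor
    · rintro ⟨h, _, h'⟩; exact ⟨h, h'⟩
    · rintro ⟨h, h'⟩; exact ⟨h, Or.inl ⟨le_rfl, h.2⟩, h'⟩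
  rw [hE, hmp.measure_preimage hPm.nullMeasurableSet, Measure.volume_eq_prod,
    Measure.prod_apply hPm]
  have hsec : ∀ t : ℝ, volume (Prod.mk t ⁻¹' P) =
      (Ioo (π / 2) π).indicator (fun _ => ENNReal.ofReal (π / 2) ^ n) t := by
    intro t
    by_cases ht : t ∈ Ioo (π / 2) π
    · rw [indicator_of_mem ht]
      have : Prod.mk t ⁻¹' P = Set.pi univ (fun _ : Fin n => Sset t) := by
        ext y
        simp only [hP, mem_preimage, mem_ofPred_eq, mem_pi, mem_univ, true_imp_iff, Sset]
        exact ⟨fun h => h.2, fun h => ⟨ht, h⟩⟩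
      rw [this, volume_pi_pi]
      simp [vol_Sset ht.1 ht.2]
    · rw [indicator_of_notMem ht]
      have : Prod.mk t ⁻¹' P = ∅ := by
        ext y
        simp only [hP, mem_preimage, mem_ofPred_eq, mem_empty_iff_false, iff_false]
        exact fun h => ht h.1
      rw [this, measure_empty]
  simp_rw [hsec]
  rw [lintegral_indicator measurableSet_Ioo, setLIntegral_const, Real.volume_Ioo, pow_succ]
  congr 2; ring

theorem vol_diag {k : ℕ} {i j : Fin k} (h : i ≠ j) :
    volume {θ : Fin k → ℝ | θ i = θ j} = 0 := by
  let L : (Fin k → ℝ) →ₗ[ℝ] ℝ :=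
    LinearMap.proj (R := ℝ) (φ := fun _ : Fin k => ℝ) i -
      LinearMap.proj (R := ℝ) (φ := fun _ : Fin k => ℝ) j
  have e : {θ : Fin k → ℝ | θ i = θ j} = (LinearMap.ker L : Set (Fin k → ℝ)) := by
    ext θ; simp [L, sub_eq_zero]
  rw [e]
  apply Measure.addHaar_submodule
  intro htop
  have : (Pi.single i 1 : Fin k → ℝ) ∈ LinearMap.ker L := by rw [htop]; trivial
  simp [L, h.symm] at this

theorem vol_Bset (n : ℕ) : volume (Bset (n + 1)) =
    ENNReal.ofReal (((n + 1 : ℕ) + 1) * (π / 2) ^ (n + 1)) := by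
  rw [Bset_eq, measure_union _ (MeasurableSet.iUnion fun j => meas_Epiece j), vol_Ezero,
    measure_iUnion₀ _ (fun j => (meas_Epiece j).nullMeasurableSet)]
  · simp_rw [vol_Epiece]
    rw [tsum_fintype]
    simp only [Finset.sum_const, Finset.card_univ, Fintype.card_fin, nsmul_eq_mul]
    rw [ENNReal.ofReal_mul (by positivity), ENNReal.ofReal_pow (by positivity),
      ENNReal.ofReal_add (by positivity) (by positivity), ENNReal.ofReal_natCast,
      ENNReal.ofReal_one]
    ring
  · intro i j hij
    refine measure_mono_null ?_ (vol_diag hij)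
    rintro θ ⟨h1, h2⟩
    obtain ⟨⟨a1, a2⟩, a3⟩ := h1
    obtain ⟨⟨b1, b2⟩, b3⟩ := h2
    rcases a3 j with h | h <;> rcases b3 i with h' | h' <;> first | exact le_antisymm h.1 h'.1 | (exfalso; linarith)
  · rw [Set.disjoint_left]
    rintro θ h0 h
    obtain ⟨j, ⟨hj1, _⟩, _⟩ := mem_iUnion.1 h
    linarith [(h0 j).2]

/-- The Lebesgue measure of 𝓣_k = {(θ₁,…,θ_k) ∈ (0,π)^k : 𝓝 ∩ ⋂ᵢ 𝓝 R_{θᵢ}ᵀ = SO(2)}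
equals π^k (1 − (k+1)/2^k). -/
theorem stmt12 (k : ℕ) (hk : 1 ≤ k) :
    volume {θ : Fin k → ℝ | (∀ i, θ i ∈ Set.Ioo 0 Real.pi) ∧
        (calN e1 ∩ ⋂ i, {F : M2 | F * rot (θ i) ∈ calN e1}) = SO2} =
      ENNReal.ofReal (Real.pi ^ k * (1 - (k + 1) / 2 ^ k)) := by
  obtain ⟨n, rfl⟩ : ∃ n, k = n + 1 := ⟨k - 1, by omega⟩
  have e : {θ : Fin (n + 1) → ℝ | (∀ i, θ i ∈ Set.Ioo 0 Real.pi) ∧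
        (calN e1 ∩ ⋂ i, {F : M2 | F * rot (θ i) ∈ calN e1}) = SO2} =
      Set.pi univ (fun _ => Ioo 0 π) \ Bset (n + 1) := by
    ext θ
    simp only [eq_SO2_iff, mem_ofPred_eq, mem_sdiff, mem_pi, mem_univ, true_imp_iff, Bset, not_and]
    exact ⟨fun h => ⟨h.1, fun _ => h.2⟩, fun h => ⟨h.1, h.2 h.1⟩⟩
  have hm : MeasurableSet (Bset (n + 1)) := by
    rw [Bset_eq]
    exact (meas_Ezero _).union (MeasurableSet.iUnion fun j => meas_Epiece j)
  rw [e, measure_sdiff _ hm.nullMeasurableSet (by rw [vol_Bset]; exact ENNReal.ofReal_ne_top),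
    vol_Bset, volume_pi_pi]
  · simp only [Real.volume_Ioo, Finset.prod_const, Finset.card_univ, Fintype.card_fin, sub_zero]
    rw [← ENNReal.ofReal_pow Real.pi_pos.le, ← ENNReal.ofReal_sub _ (by positivity)]
    congr 1
    rw [div_pow]
    ring
  · intro θ h i _
    exact h.1 i
end
end

section
/- Let s, s′ ∈ ℝ² be unit vectors with s′ ≠ s and s′ ≠ −s, and let F ∈ ℝ^{2×2}. Then F ∈ 𝓝_s ∩ 𝓝_{s′} if and only if there exists a Lipschitz map u from the closed unit ball of ℝ² to ℝ² such that u(x) = F x for every x with ‖x‖ = 1, and such that u is differentiable at almost every point of the open unit ball with its derivative (as a 2×2 matrix) belonging to 𝓜_s at almost every x with x₂ > 0 and to 𝓜_{s′} at almost every x with x₂ < 0. -/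
open Matrix Real Set MeasureTheory

noncomputable section

/-- The derivative of a map ℝ² → ℝ² at a point, as a 2×2 matrix. -/
def gradMatrix (u : (Fin 2 → ℝ) → Fin 2 → ℝ) (x : Fin 2 → ℝ) : M2 :=
  LinearMap.toMatrix' ((fderiv ℝ u x).toLinearMap)

open Filter Topology in
/-- Weak convergence for compactly supported `C¹` test functions. -/
lemma weak_conv_smooth {K : NNReal} (v : ℕ → (Fin 2 → ℝ) → ℝ) (v0 : (Fin 2 → ℝ) → ℝ)
    (hv : ∀ n, LipschitzWith K (v n)) (hv0 : LipschitzWith K v0)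
    (hlim : TendstoUniformly v v0 atTop) (g : (Fin 2 → ℝ) → ℝ) (hg : ContDiff ℝ 1 g)
    (hgc : HasCompactSupport g) (w : Fin 2 → ℝ) :
    Tendsto (fun n => ∫ x, lineDeriv ℝ (v n) x w * g x) atTop
      (𝓝 (∫ x, lineDeriv ℝ v0 x w * g x)) := by
  obtain ⟨D, hD⟩ := hg.lipschitzWith_of_hasCompactSupport hgc (by norm_num)
  have e : ∀ f : (Fin 2 → ℝ) → ℝ, LipschitzWith K f →
      ∫ x, lineDeriv ℝ f x w * g x = ∫ x, lineDeriv ℝ g x (-w) * f x :=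
    fun f hf => hf.integral_lineDeriv_mul_eq hD hgc w
  simp only [e _ (hv _), e _ hv0]
  have hd : ∀ x, lineDeriv ℝ g x (-w) = fderiv ℝ g x (-w) := fun x =>
    ((hg.differentiable (by norm_num)) x).lineDeriv_eq_fderiv
  simp only [hd]
  have hcont : Continuous fun x => fderiv ℝ g x (-w) :=
    (hg.continuous_fderiv (by norm_num)).clm_apply continuous_const
  have hcs : HasCompactSupport fun x => fderiv ℝ g x (-w) := hgc.fderiv_apply (𝕜 := ℝ) (-w)
  apply tendsto_integral_filter_of_dominated_convergence
    (fun x => ‖fderiv ℝ g x (-w)‖ * (|v0 x| + 1))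
  · exact Eventually.of_forall fun n =>
      (hcont.mul (hv n).continuous).aestronglyMeasurable
  · have := (Metric.tendstoUniformly_iff.1 hlim) 1 one_pos
    filter_upwards [this] with n hn
    filter_upwards with x
    rw [norm_mul]
    gcongr
    have h := hn x
    rw [dist_comm, Real.dist_eq] at h
    rw [Real.norm_eq_abs]
    have := abs_sub_abs_le_abs_sub (v n x) (v0 x)
    linarith
  · apply Continuous.integrable_of_hasCompactSupport
    · have := hv0.continuous
      fun_prop
    · exact hcs.norm.mul_right
  · filter_upwards with x
    exact tendsto_const_nhds.mul (hlim.tendsto_at x)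

/-- Compactly supported `C¹` functions are dense in `L¹`. -/
lemma exists_smooth_approx (g : (Fin 2 → ℝ) → ℝ) (hg : Integrable g) {ε : ℝ} (hε : 0 < ε) :
    ∃ h : (Fin 2 → ℝ) → ℝ, ContDiff ℝ 1 h ∧ HasCompactSupport h ∧ ∫ x, ‖g x - h x‖ ≤ ε := by
  obtain ⟨f, hfc, hf1, hf2, hf3⟩ :=
    hg.exists_hasCompactSupport_integral_sub_le (half_pos hε)
  set T := Metric.cthickening 1 (tsupport f) with hT
  have hTc : IsCompact T := hfc.isCompact.cthickening
  set M : ℝ := volume.real T with hM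
  have hM0 : 0 ≤ M := measureReal_nonneg
  set η : ℝ := ε / 2 / (M + 1) with hη
  have hη0 : 0 < η := by positivity
  have huc : UniformContinuous f := hf2.uniformContinuous_of_tendsto_cocompact
    (hfc.is_zero_at_infty)
  rcases Metric.uniformContinuous_iff.mp huc η hη0 with ⟨δ, hδ, hfδ⟩
  obtain ⟨h, hh1, hh2⟩ := hf2.exists_contDiff_dist_le_of_forall_mem_ball_dist_le
    (lt_min hδ one_pos)
  have hout : ∀ a, a ∉ T → f a = 0 ∧ h a = 0 := by
    intro a ha
    have hz : ∀ x ∈ Metric.ball a (min δ 1), f x = 0 := by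
      intro x hx
      by_contra hne
      apply ha
      have hx1 : x ∈ tsupport f := subset_tsupport f hne
      apply Metric.mem_cthickening_of_dist_le a x _ _ hx1
      have := Metric.mem_ball.1 hx
      rw [dist_comm]
      exact (this.trans_le (min_le_right _ _)).le
    have ha0 : f a = 0 := hz a (Metric.mem_ball_self (lt_min hδ one_pos))
    have := hh2 a 0 (fun x hx => by rw [hz x hx, ha0]; simp)
    rw [ha0] at this
    exact ⟨ha0, by simpa using this⟩
  have hclose : ∀ a, ‖f a - h a‖ ≤ η := by
    intro a
    have := hh2 a η (fun x hx => (hfδ ((Metric.mem_ball.1 hx).trans_le (min_le_left _ _))).le)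
    rwa [dist_comm, dist_eq_norm] at this
  have hhc : HasCompactSupport h := HasCompactSupport.intro hTc fun x hx => (hout x hx).2
  have hhi : Integrable h := hh1.continuous.integrable_of_hasCompactSupport hhc
  refine ⟨h, hh1.of_le (by exact_mod_cast le_top), hhc, ?_⟩
  have h1 : ∫ x, ‖f x - h x‖ ≤ η * M := by
    have : ∀ x, ‖f x - h x‖ ≤ T.indicator (fun _ => η) x := by
      intro x
      by_cases hx : x ∈ T
      · simpa [hx] using hclose x
      · simp [hx, (hout x hx).1, (hout x hx).2]
    calc ∫ x, ‖f x - h x‖ ≤ ∫ x, T.indicator (fun _ => η) x := by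
          apply integral_mono (hf3.sub hhi).norm
          · exact (integrableOn_const (hTc.measure_lt_top.ne)).integrable_indicator hTc.measurableSet
          · exact this
      _ = η * M := by
          rw [integral_indicator hTc.measurableSet]
          simp [hM, mul_comm]
  have h2 : ∫ x, ‖g x - h x‖ ≤ (∫ x, ‖g x - f x‖) + ∫ x, ‖f x - h x‖ := by
    have e1' : Integrable fun x => ‖g x - f x‖ := (hg.sub hf3).norm
    have e2' : Integrable fun x => ‖f x - h x‖ := (hf3.sub hhi).norm
    rw [← integral_add e1' e2']
    apply integral_mono (hg.sub hhi).norm ((hg.sub hf3).norm.add (hf3.sub hhi).norm)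
    intro x
    exact norm_sub_le_norm_sub_add_norm_sub _ _ _
  have h3 : η * M ≤ ε / 2 := by
    rw [hη, div_mul_eq_mul_div, div_le_iff₀ (by positivity)]
    nlinarith
  linarith

open Filter Topology in
/-- Weak convergence of derivatives of uniformly Lipschitz, uniformly convergent functions. -/
lemma weak_conv {K : NNReal} (v : ℕ → (Fin 2 → ℝ) → ℝ) (v0 : (Fin 2 → ℝ) → ℝ)
    (hv : ∀ n, LipschitzWith K (v n)) (hv0 : LipschitzWith K v0)
    (hlim : TendstoUniformly v v0 atTop) (g : (Fin 2 → ℝ) → ℝ) (hg : Integrable g)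
    (w : Fin 2 → ℝ) :
    Tendsto (fun n => ∫ x, lineDeriv ℝ (v n) x w * g x) atTop
      (𝓝 (∫ x, lineDeriv ℝ v0 x w * g x)) := by
  set B : ℝ := K * ‖w‖ with hB
  have hB0 : 0 ≤ B := by positivity
  have hintg : ∀ f : (Fin 2 → ℝ) → ℝ, LipschitzWith K f → ∀ k : (Fin 2 → ℝ) → ℝ, Integrable k →
      Integrable fun x => lineDeriv ℝ f x w * k x := by
    intro f hf k hk
    exact hk.bdd_mul (aestronglyMeasurable_lineDeriv hf.continuous _)
      (Eventually.of_forall fun x => norm_lineDeriv_le_of_lipschitz ℝ hf)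
  have key : ∀ f : (Fin 2 → ℝ) → ℝ, LipschitzWith K f → ∀ h : (Fin 2 → ℝ) → ℝ, Integrable h →
      |(∫ x, lineDeriv ℝ f x w * g x) - ∫ x, lineDeriv ℝ f x w * h x| ≤
        B * ∫ x, ‖g x - h x‖ := by
    intro f hf h hh
    rw [← integral_sub (hintg f hf g hg) (hintg f hf h hh), ← Real.norm_eq_abs,
      ← integral_const_mul]
    apply norm_integral_le_of_norm_le ((hg.sub hh).norm.const_mul _)
    filter_upwards with x
    rw [← mul_sub, norm_mul]
    exact mul_le_mul_of_nonneg_right (norm_lineDeriv_le_of_lipschitz ℝ hf) (norm_nonneg _)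
  rw [Metric.tendsto_atTop]
  intro ε hε
  obtain ⟨h, hh1, hh2, hh3⟩ := exists_smooth_approx g hg (ε := ε / (4 * (B + 1))) (by positivity)
  have hhi : Integrable h := hh1.continuous.integrable_of_hasCompactSupport hh2
  obtain ⟨N, hN⟩ := (Metric.tendsto_atTop.1 (weak_conv_smooth v v0 hv hv0 hlim h hh1 hh2 w))
    (ε / 4) (by positivity)
  refine ⟨N, fun n hn => ?_⟩
  have a1 := key _ (hv n) h hhi
  have a2 := key _ hv0 h hhi
  have a3 := hN n hn
  rw [Real.dist_eq] at a3 ⊢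
  have a4 : B * ∫ x, ‖g x - h x‖ ≤ ε / 4 := by
    calc B * ∫ x, ‖g x - h x‖ ≤ B * (ε / (4 * (B + 1))) := by gcongr
      _ ≤ ε / 4 := by
        rw [mul_div_assoc', div_le_div_iff₀ (by positivity) (by positivity)]
        nlinarith
  rw [abs_le] at a1 a2
  rw [abs_lt] at a3 ⊢
  constructor <;> linarith [a1.1, a1.2, a2.1, a2.2, a3.1, a3.2]

/-- The anisotropic box. -/
def boxx (z : Fin 2 → ℝ) (r L : ℝ) : Set (Fin 2 → ℝ) :=
  {x | |x 0 - z 0| ≤ r ∧ |x 1 - z 1| ≤ L * r}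

lemma deriv_smoothTransition_zero_of_neg {y : ℝ} (hy : y < 0) :
    deriv Real.smoothTransition y = 0 := by
  have : Real.smoothTransition =ᶠ[nhds y] fun _ => (0 : ℝ) := by
    filter_upwards [Iio_mem_nhds hy] with w hw
    exact Real.smoothTransition.zero_of_nonpos (le_of_lt hw)
  rw [this.deriv_eq]; simp

lemma deriv_smoothTransition_zero_of_one_lt {y : ℝ} (hy : 1 < y) :
    deriv Real.smoothTransition y = 0 := by
  have : Real.smoothTransition =ᶠ[nhds y] fun _ => (1 : ℝ) := by
    filter_upwards [Ioi_mem_nhds hy] with w hw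
    exact Real.smoothTransition.one_of_one_le (le_of_lt hw)
  rw [this.deriv_eq]; simp

lemma smoothTransition_deriv_bound :
    ∃ M : ℝ, 0 ≤ M ∧ ∀ y, |deriv Real.smoothTransition y| ≤ M := by
  have hc : Continuous (deriv Real.smoothTransition) :=
    (Real.smoothTransition.contDiff (n := 1)).continuous_deriv (by norm_num)
  obtain ⟨M, hM⟩ := (isCompact_Icc (a := (0 : ℝ)) (b := 1)).exists_bound_of_continuousOn
    hc.continuousOn
  refine ⟨max M 0, le_max_right _ _, fun y => ?_⟩
  by_cases h0 : y < 0
  · simp [deriv_smoothTransition_zero_of_neg h0]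
  by_cases h1 : 1 < y
  · simp [deriv_smoothTransition_zero_of_one_lt h1]
  · exact (hM y ⟨by linarith, by linarith⟩).trans (le_max_left _ _)

/-- The twist angle. -/
def twAngle (z : Fin 2 → ℝ) (r L t : ℝ) (x : Fin 2 → ℝ) : ℝ :=
  t * Real.smoothTransition (3 - 3 * ((x 0 - z 0) ^ 2 + ((x 1 - z 1) / L) ^ 2) / r ^ 2)

/-- The twist map. -/
def twist (z : Fin 2 → ℝ) (r L t : ℝ) (x : Fin 2 → ℝ) : Fin 2 → ℝ :=
  ![z 0 + (x 0 - z 0) * Real.cos (twAngle z r L t x)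
      - (x 1 - z 1) / L * Real.sin (twAngle z r L t x),
    z 1 + L * (x 0 - z 0) * Real.sin (twAngle z r L t x)
      + (x 1 - z 1) * Real.cos (twAngle z r L t x)]

lemma twAngle_contDiff (z : Fin 2 → ℝ) (r L t : ℝ) : ContDiff ℝ 1 (twAngle z r L t) := by
  unfold twAngle
  apply contDiff_const.mul
  apply (Real.smoothTransition.contDiff (n := 1)).comp
  fun_prop

lemma twist_contDiff (z : Fin 2 → ℝ) (r L t : ℝ) : ContDiff ℝ 1 (twist z r L t) := by
  have := twAngle_contDiff z r L t
  unfold twist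
  rw [contDiff_pi]
  intro i
  fin_cases i
  · simp; fun_prop
  · simp; fun_prop

/-- The derivative of the transition function at the relevant point. -/
def twB (z : Fin 2 → ℝ) (r L : ℝ) (x : Fin 2 → ℝ) : ℝ :=
  deriv Real.smoothTransition (3 - 3 * ((x 0 - z 0) ^ 2 + ((x 1 - z 1) / L) ^ 2) / r ^ 2)

lemma twAngle_hasFDerivAt (z : Fin 2 → ℝ) (r L t : ℝ) (x : Fin 2 → ℝ) :
    HasFDerivAt (twAngle z r L t)
      ((t * twB z r L x * (-6 * (x 0 - z 0) / r ^ 2)) • ContinuousLinearMap.proj (R := ℝ) (φ := fun _ : Fin 2 => ℝ) 0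
       + (t * twB z r L x * (-6 * (x 1 - z 1) / L ^ 2 / r ^ 2)) • ContinuousLinearMap.proj (R := ℝ) (φ := fun _ : Fin 2 => ℝ) 1) x := by
  have h0 : HasFDerivAt (fun y : Fin 2 → ℝ => y 0) (ContinuousLinearMap.proj (R := ℝ) (φ := fun _ : Fin 2 => ℝ) 0) x :=
    (ContinuousLinearMap.proj (R := ℝ) (φ := fun _ : Fin 2 => ℝ) 0).hasFDerivAt
  have h1 : HasFDerivAt (fun y : Fin 2 → ℝ => y 1) (ContinuousLinearMap.proj (R := ℝ) (φ := fun _ : Fin 2 => ℝ) 1) x :=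
    (ContinuousLinearMap.proj (R := ℝ) (φ := fun _ : Fin 2 => ℝ) 1).hasFDerivAt
  have hq := ((((h0.sub_const (z 0)).pow 2).add (((h1.sub_const (z 1)).mul_const L⁻¹).pow 2)).const_mul (3 / r ^ 2)).const_sub 3
  have hb : HasDerivAt Real.smoothTransition (twB z r L x)
      (3 - 3 / r ^ 2 * ((x 0 - z 0) ^ 2 + ((x 1 - z 1) * L⁻¹) ^ 2)) := by
    have h := ((Real.smoothTransition.contDiff (n := 1)).differentiable (by norm_num)
      (3 - 3 / r ^ 2 * ((x 0 - z 0) ^ 2 + ((x 1 - z 1) * L⁻¹) ^ 2))).hasDerivAt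
    have e : twB z r L x = deriv Real.smoothTransition
        (3 - 3 / r ^ 2 * ((x 0 - z 0) ^ 2 + ((x 1 - z 1) * L⁻¹) ^ 2)) := by
      unfold twB; congr 1; ring
    rw [e]; exact h
  have := (hb.comp_hasFDerivAt x hq).const_mul t
  refine (this.congr_fderiv ?_).congr_of_eventuallyEq ?_
  · ext v
    simp
    ring
  · filter_upwards with y
    simp only [twAngle, Function.comp, Pi.add_apply]
    congr 2
    ring

lemma twist_fderiv (z : Fin 2 → ℝ) (r L t : ℝ) (hL : L ≠ 0) (x : Fin 2 → ℝ) :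
    let X := x 0 - z 0
    let Y := x 1 - z 1
    let c := Real.cos (twAngle z r L t x)
    let s := Real.sin (twAngle z r L t x)
    let b := t * twB z r L x * (-6 / r ^ 2)
    fderiv ℝ (twist z r L t) x e1 0 = c - (X * s + Y / L * c) * (b * X) ∧
    fderiv ℝ (twist z r L t) x e1 1 = L * s + (L * X * c - Y * s) * (b * X) ∧
    fderiv ℝ (twist z r L t) x e2 0 = - s / L - (X * s + Y / L * c) * (b * Y / L ^ 2) ∧
    fderiv ℝ (twist z r L t) x e2 1 = c + (L * X * c - Y * s) * (b * Y / L ^ 2) := by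
  intro X Y c s b
  have h0 : HasFDerivAt (fun y : Fin 2 → ℝ => y 0) (ContinuousLinearMap.proj (R := ℝ) (φ := fun _ : Fin 2 => ℝ) 0) x :=
    (ContinuousLinearMap.proj (R := ℝ) (φ := fun _ : Fin 2 => ℝ) 0).hasFDerivAt
  have h1 : HasFDerivAt (fun y : Fin 2 → ℝ => y 1) (ContinuousLinearMap.proj (R := ℝ) (φ := fun _ : Fin 2 => ℝ) 1) x :=
    (ContinuousLinearMap.proj (R := ℝ) (φ := fun _ : Fin 2 => ℝ) 1).hasFDerivAt
  have hθ := twAngle_hasFDerivAt z r L t x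
  have hX := h0.sub_const (z 0)
  have hY := h1.sub_const (z 1)
  have hd := (twist_contDiff z r L t).differentiable (by norm_num) x
  have hc : ∀ i, HasFDerivAt (fun y => twist z r L t y i)
      ((ContinuousLinearMap.proj (R := ℝ) (φ := fun _ : Fin 2 => ℝ) i).comp (fderiv ℝ (twist z r L t) x)) x :=
    fun i => (hasFDerivAt_pi'.1 hd.hasFDerivAt) i
  have hA : HasFDerivAt (fun y => twist z r L t y 0) _ x :=
    (((hX.mul hθ.cos).const_add (z 0)).sub ((hY.mul_const L⁻¹).mul hθ.sin)).congr_of_eventuallyEq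
      (Filter.Eventually.of_forall fun y => by simp [twist, div_eq_mul_inv])
  have hB : HasFDerivAt (fun y => twist z r L t y 1) _ x :=
    ((((hX.const_mul L).mul hθ.sin).const_add (z 1)).add (hY.mul hθ.cos)).congr_of_eventuallyEq
      (Filter.Eventually.of_forall fun y => by simp [twist])
  have eA := (hc 0).unique hA
  have eB := (hc 1).unique hB
  refine ⟨?_, ?_, ?_, ?_⟩
  · have := congrArg (fun f => f e1) eA
    simp only [ContinuousLinearMap.comp_apply, ContinuousLinearMap.proj_apply] at this
    rw [this]
    simp [e1, X, Y, c, s, b]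
    field_simp
    ring
  · have := congrArg (fun f => f e1) eB
    simp only [ContinuousLinearMap.comp_apply, ContinuousLinearMap.proj_apply] at this
    rw [this]
    simp [e1, X, Y, c, s, b]
    field_simp
    ring
  · have := congrArg (fun f => f e2) eA
    simp only [ContinuousLinearMap.comp_apply, ContinuousLinearMap.proj_apply] at this
    rw [this]
    simp [e2, X, Y, c, s, b]
    field_simp
    ring
  · have := congrArg (fun f => f e2) eB
    simp only [ContinuousLinearMap.comp_apply, ContinuousLinearMap.proj_apply] at this
    rw [this]
    simp [e2, X, Y, c, s, b]
    field_simp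
    ring

lemma twist_gadget : ∃ K0 : ℝ, 1 ≤ K0 ∧ ∀ (z : Fin 2 → ℝ) (r L t : ℝ), 0 < r → 1 ≤ L → 0 < t → t ≤ 1 →
    ContDiff ℝ 1 (twist z r L t) ∧
    (∀ x, x ∉ boxx z r L → twist z r L t x = x) ∧
    (∀ x ∈ boxx z r L, |twist z r L t x 0 - z 0| ≤ 2 * r ∧ |twist z r L t x 1 - z 1| ≤ 2 * (L * r)) ∧
    (∀ x, fderiv ℝ (twist z r L t) x e1 0 * fderiv ℝ (twist z r L t) x e2 1
        - fderiv ℝ (twist z r L t) x e1 1 * fderiv ℝ (twist z r L t) x e2 0 = 1) ∧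
    (∀ x, |fderiv ℝ (twist z r L t) x e1 0 - 1| ≤ K0 * t ∧ |fderiv ℝ (twist z r L t) x e1 1| ≤ K0 * (L * t) ∧
      |fderiv ℝ (twist z r L t) x e2 0| ≤ K0 * (t / L) ∧ |fderiv ℝ (twist z r L t) x e2 1 - 1| ≤ K0 * t) ∧
    (∀ x ∈ boxx z (r / 2) L, L * t / 2 ≤ fderiv ℝ (twist z r L t) x e1 1) := by
  obtain ⟨M, hM0, hM⟩ := smoothTransition_deriv_bound
  refine ⟨1 + 12 * M, by linarith, fun z r L t hr hL ht ht1 => ?_⟩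
  have hL0 : 0 < L := by linarith
  have hq0 : ∀ x : Fin 2 → ℝ, r ^ 2 < (x 0 - z 0) ^ 2 + ((x 1 - z 1) / L) ^ 2 →
      twAngle z r L t x = 0 ∧ twB z r L x = 0 := by
    intro x hx
    have : 3 - 3 * ((x 0 - z 0) ^ 2 + ((x 1 - z 1) / L) ^ 2) / r ^ 2 < 0 := by
      rw [sub_neg, lt_div_iff₀ (by positivity)]; linarith
    exact ⟨by unfold twAngle; rw [Real.smoothTransition.zero_of_nonpos this.le]; simp,
      deriv_smoothTransition_zero_of_neg this⟩
  have hang : ∀ x, 0 ≤ twAngle z r L t x ∧ twAngle z r L t x ≤ t := by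
    intro x
    unfold twAngle
    have h1 := Real.smoothTransition.nonneg (3 - 3 * ((x 0 - z 0) ^ 2 + ((x 1 - z 1) / L) ^ 2) / r ^ 2)
    have h2 := Real.smoothTransition.le_one (3 - 3 * ((x 0 - z 0) ^ 2 + ((x 1 - z 1) / L) ^ 2) / r ^ 2)
    exact ⟨by positivity, by nlinarith⟩
  refine ⟨twist_contDiff z r L t, ?_, ?_, ?_, ?_, ?_⟩
  · intro x hx
    have : r ^ 2 < (x 0 - z 0) ^ 2 + ((x 1 - z 1) / L) ^ 2 := by
      by_contra hcon
      push Not at hcon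
      apply hx
      have h1 : (x 0 - z 0) ^ 2 ≤ r ^ 2 := by nlinarith [sq_nonneg ((x 1 - z 1) / L)]
      have h2 : ((x 1 - z 1) / L) ^ 2 ≤ r ^ 2 := by nlinarith [sq_nonneg (x 0 - z 0)]
      refine ⟨abs_le_of_sq_le_sq h1 hr.le, ?_⟩
      have h3 := abs_le_of_sq_le_sq h2 hr.le
      rw [abs_div, abs_of_pos hL0, div_le_iff₀ hL0] at h3
      linarith
    have h := (hq0 x this).1
    ext i
    fin_cases i <;> simp [twist, h]
  · intro x hx
    have hc := Real.abs_cos_le_one (twAngle z r L t x)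
    have hs := Real.abs_sin_le_one (twAngle z r L t x)
    have hY : |(x 1 - z 1) / L| ≤ r := by
      rw [abs_div, abs_of_pos hL0, div_le_iff₀ hL0]; linarith [hx.2]
    constructor
    · have e : twist z r L t x 0 - z 0 = (x 0 - z 0) * Real.cos (twAngle z r L t x)
        - (x 1 - z 1) / L * Real.sin (twAngle z r L t x) := by simp [twist]; ring
      rw [e]
      calc _ ≤ |(x 0 - z 0) * Real.cos (twAngle z r L t x)| + |(x 1 - z 1) / L * Real.sin (twAngle z r L t x)| := abs_sub _ _
        _ ≤ r * 1 + r * 1 := by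
          rw [abs_mul, abs_mul]
          gcongr
          exact hx.1
        _ = _ := by ring
    · have e : twist z r L t x 1 - z 1 = L * (x 0 - z 0) * Real.sin (twAngle z r L t x)
        + (x 1 - z 1) * Real.cos (twAngle z r L t x) := by simp [twist]; ring
      rw [e]
      calc _ ≤ |L * (x 0 - z 0) * Real.sin (twAngle z r L t x)| + |(x 1 - z 1) * Real.cos (twAngle z r L t x)| := abs_add_le _ _
        _ ≤ (L * r) * 1 + (L * r) * 1 := by
          rw [abs_mul, abs_mul, abs_mul, abs_of_pos hL0]
          gcongr
          exact hx.1
          exact hx.2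
        _ = _ := by ring
  · intro x
    obtain ⟨h1, h2, h3, h4⟩ := twist_fderiv z r L t hL0.ne' x
    rw [h1, h2, h3, h4]
    have := Real.sin_sq_add_cos_sq (twAngle z r L t x)
    generalize Real.cos (twAngle z r L t x) = c at *
    generalize Real.sin (twAngle z r L t x) = s at *
    generalize x 0 - z 0 = X at *
    generalize x 1 - z 1 = Y at *
    generalize t * twB z r L x * (-6 / r ^ 2) = b
    have e : s ^ 2 = 1 - c ^ 2 := by linarith
    field_simp
    ring_nf
    have e3 : s ^ 3 = s * (1 - c ^ 2) := by rw [← e]; ring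
    simp only [e]
    ring
  · intro x
    obtain ⟨h1, h2, h3, h4⟩ := twist_fderiv z r L t hL0.ne' x
    rw [h1, h2, h3, h4]
    by_cases hq : r ^ 2 < (x 0 - z 0) ^ 2 + ((x 1 - z 1) / L) ^ 2
    · obtain ⟨ha, hb⟩ := hq0 x hq
      rw [ha, hb]
      simp
      exact ⟨by positivity, by positivity, by positivity, by positivity⟩
    · push Not at hq
      have hX : |x 0 - z 0| ≤ r := abs_le_of_sq_le_sq (by nlinarith [sq_nonneg ((x 1 - z 1) / L)]) hr.le
      have hY : |(x 1 - z 1) / L| ≤ r := abs_le_of_sq_le_sq (by nlinarith [sq_nonneg (x 0 - z 0)]) hr.le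
      obtain ⟨θ0, θ1⟩ := hang x
      have hs1 := Real.abs_sin_le_one (twAngle z r L t x)
      have hc1 := Real.abs_cos_le_one (twAngle z r L t x)
      have hs : |Real.sin (twAngle z r L t x)| ≤ t := by
        refine (Real.abs_sin_le_abs).trans ?_
        rw [abs_of_nonneg θ0]; exact θ1
      have hc : |Real.cos (twAngle z r L t x) - 1| ≤ t := by
        have := Real.one_sub_sq_div_two_le_cos (x := twAngle z r L t x)
        rw [abs_sub_comm, abs_of_nonneg (by linarith [Real.cos_le_one (twAngle z r L t x)])]
        nlinarith
      have hb : |t * twB z r L x * (-6 / r ^ 2)| ≤ 6 * t * M / r ^ 2 := by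
        rw [abs_mul, abs_mul, abs_of_pos ht, abs_div, abs_of_nonneg (a := r ^ 2) (by positivity)]
        norm_num
        have := hM (3 - 3 * ((x 0 - z 0) ^ 2 + ((x 1 - z 1) / L) ^ 2) / r ^ 2)
        change |twB z r L x| ≤ M at this
        calc t * |twB z r L x| * (6 / r ^ 2) ≤ t * M * (6 / r ^ 2) := by gcongr
          _ = _ := by ring
      have eY : x 1 - z 1 = L * ((x 1 - z 1) / L) := by field_simp
      generalize (x 1 - z 1) / L = Y at *
      rw [eY]
      generalize Real.cos (twAngle z r L t x) = c at *
      generalize Real.sin (twAngle z r L t x) = s at *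
      generalize x 0 - z 0 = X at *
      generalize t * twB z r L x * (-6 / r ^ 2) = b at *
      have k1 : |X * s + Y * c| ≤ 2 * r := by
        calc _ ≤ |X * s| + |Y * c| := abs_add_le _ _
          _ ≤ r * 1 + r * 1 := by rw [abs_mul, abs_mul]; gcongr
          _ = _ := by ring
      have k2 : |X * c - Y * s| ≤ 2 * r := by
        calc _ ≤ |X * c| + |Y * s| := abs_sub _ _
          _ ≤ r * 1 + r * 1 := by rw [abs_mul, abs_mul]; gcongr
          _ = _ := by ring
      have kX : |b * X| ≤ 6 * t * M / r := by
        calc _ ≤ 6 * t * M / r ^ 2 * r := by rw [abs_mul]; gcongr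
          _ = _ := by field_simp
      have kY : |b * Y| ≤ 6 * t * M / r := by
        calc _ ≤ 6 * t * M / r ^ 2 * r := by rw [abs_mul]; gcongr
          _ = _ := by field_simp
      have g : ∀ p q : ℝ, |p| ≤ 2 * r → |q| ≤ 6 * t * M / r → |p * q| ≤ 12 * M * t := by
        intro p q hp hq
        calc _ ≤ (2 * r) * (6 * t * M / r) := by rw [abs_mul]; gcongr
          _ = _ := by field_simp; ring
      have g1 := g _ _ k1 kX
      have g2 := g _ _ k2 kX
      have g3 := g _ _ k1 kY
      have g4 := g _ _ k2 kY
      refine ⟨?_, ?_, ?_, ?_⟩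
      · have : c - (X * s + Y * c) * (b * X) - 1 = (c - 1) - (X * s + Y * c) * (b * X) := by ring
        rw [this]
        refine (abs_sub _ _).trans ?_
        linarith
      · have : L * s + (L * X * c - L * Y * s) * (b * X) = L * (s + (X * c - Y * s) * (b * X)) := by ring
        rw [this, abs_mul, abs_of_pos hL0]
        have := abs_add_le s ((X * c - Y * s) * (b * X))
        calc _ ≤ L * ((1 + 12 * M) * t) := by gcongr; linarith
          _ = _ := by ring
      · have : -s / L - (X * s + Y * c) * (b * (L * Y) / L ^ 2) = (-s - (X * s + Y * c) * (b * Y)) / L := by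
          field_simp
        rw [this, abs_div, abs_of_pos hL0, ← mul_div_assoc]
        gcongr
        refine (abs_sub _ _).trans ?_
        rw [abs_neg]; linarith
      · have : c + (L * X * c - L * Y * s) * (b * (L * Y) / L ^ 2) - 1 = (c - 1) + (X * c - Y * s) * (b * Y) := by
          field_simp; ring
        rw [this]
        refine (abs_add_le _ _).trans ?_
        linarith
  · intro x hx
    have hX : |x 0 - z 0| ≤ r / 2 := hx.1
    have hY : |(x 1 - z 1) / L| ≤ r / 2 := by
      rw [abs_div, abs_of_pos hL0, div_le_iff₀ hL0]; linarith [hx.2]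
    have hq : 1 < 3 - 3 * ((x 0 - z 0) ^ 2 + ((x 1 - z 1) / L) ^ 2) / r ^ 2 := by
      have a1 := sq_le_sq' (abs_le.1 hX).1 (abs_le.1 hX).2
      have a2 := sq_le_sq' (abs_le.1 hY).1 (abs_le.1 hY).2
      have : 3 * ((x 0 - z 0) ^ 2 + ((x 1 - z 1) / L) ^ 2) / r ^ 2 ≤ 3 / 2 := by
        rw [div_le_iff₀ (by positivity)]; nlinarith
      linarith
    have ha : twAngle z r L t x = t := by
      unfold twAngle; rw [Real.smoothTransition.one_of_one_le hq.le, mul_one]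
    have hb : twB z r L x = 0 := deriv_smoothTransition_zero_of_one_lt hq
    obtain ⟨h1, h2, h3, h4⟩ := twist_fderiv z r L t hL0.ne' x
    rw [h2, ha, hb]
    have := Real.sin_gt_sub_cube ht
    simp only [mul_zero, zero_mul, add_zero]
    have : t / 2 ≤ Real.sin t := by
      have := this
      nlinarith [mul_pos ht ht, mul_le_mul ht1 ht1 ht.le (by norm_num)]
    calc L * t / 2 = L * (t / 2) := by ring
      _ ≤ _ := by gcongr

/-- squared euclidean norm -/
def nsq (p : Fin 2 → ℝ) : ℝ := p 0 ^ 2 + p 1 ^ 2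

/-- two-dimensional cross product -/
def crs (p q : Fin 2 → ℝ) : ℝ := p 0 * q 1 - p 1 * q 0

lemma nsq_nonneg (p : Fin 2 → ℝ) : 0 ≤ nsq p := by unfold nsq; positivity

lemma enorm2_sq (p : Fin 2 → ℝ) : enorm2 p ^ 2 = nsq p := by
  unfold enorm2 nsq; rw [Real.sq_sqrt]; positivity

lemma enorm2_nonneg (p : Fin 2 → ℝ) : 0 ≤ enorm2 p := Real.sqrt_nonneg _

lemma enorm2_eq_norm (p : Fin 2 → ℝ) : enorm2 p = ‖WithLp.toLp 2 p‖ := by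
  rw [EuclideanSpace.norm_eq]; simp [enorm2, Fin.sum_univ_two]

lemma enorm2_add_le (p q : Fin 2 → ℝ) : enorm2 (p + q) ≤ enorm2 p + enorm2 q := by
  simp only [enorm2_eq_norm, WithLp.toLp_add]; exact norm_add_le _ _

lemma enorm2_smul (c : ℝ) (p : Fin 2 → ℝ) : enorm2 (c • p) = |c| * enorm2 p := by
  simp only [enorm2_eq_norm, WithLp.toLp_smul]; exact norm_smul _ _

lemma abs_le_enorm2 (p : Fin 2 → ℝ) (i : Fin 2) : |p i| ≤ enorm2 p := by
  apply Real.abs_le_sqrt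
  fin_cases i <;> simp <;> positivity

lemma enorm2_le_add (p : Fin 2 → ℝ) : enorm2 p ≤ |p 0| + |p 1| := by
  apply Real.sqrt_le_iff.2
  refine ⟨by positivity, ?_⟩
  have h0 := sq_abs (p 0)
  have h1 := sq_abs (p 1)
  nlinarith [mul_nonneg (abs_nonneg (p 0)) (abs_nonneg (p 1))]

lemma continuous_enorm2 : Continuous enorm2 := by unfold enorm2; fun_prop

lemma continuous_nsq : Continuous nsq := by unfold nsq; fun_prop

lemma vec_decomp (v : Fin 2 → ℝ) : v = v 0 • e1 + v 1 • e2 := by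
  ext i; fin_cases i <;> simp [e1, e2]

lemma lin_decomp (A : (Fin 2 → ℝ) →L[ℝ] (Fin 2 → ℝ)) (v : Fin 2 → ℝ) :
    A v = v 0 • A e1 + v 1 • A e2 := by
  conv_lhs => rw [vec_decomp v]
  simp

lemma nsq_diff (p q : Fin 2 → ℝ) (m : ℝ) (hp : enorm2 p ≤ m) (hq : enorm2 q ≤ m) :
    |nsq p - nsq q| ≤ 2 * m * enorm2 (p - q) := by
  rw [← enorm2_sq, ← enorm2_sq]
  have h1 : enorm2 p ≤ enorm2 q + enorm2 (p - q) := by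
    have := enorm2_add_le q (p - q); simpa using this
  have h2 : enorm2 q ≤ enorm2 p + enorm2 (p - q) := by
    have := enorm2_add_le p (-(p - q))
    have e : enorm2 (-(p - q)) = enorm2 (p - q) := by
      have := enorm2_smul (-1) (p - q); simpa using this
    rw [e] at this; simpa using this
  have h3 : |enorm2 p - enorm2 q| ≤ enorm2 (p - q) := abs_le.2 ⟨by linarith, by linarith⟩
  have : enorm2 p ^ 2 - enorm2 q ^ 2 = (enorm2 p + enorm2 q) * (enorm2 p - enorm2 q) := by ring
  rw [this, abs_mul, abs_of_nonneg (by linarith [enorm2_nonneg p, enorm2_nonneg q])]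
  gcongr
  · linarith [enorm2_nonneg p, enorm2_nonneg q]
  · linarith

lemma nsq_lower (a b ξ : Fin 2 → ℝ) (C : ℝ) (hd : crs a b = 1) (ha : nsq a ≤ 1) (hb : enorm2 b ≤ C) :
    nsq ξ / (1 + C ^ 2) ≤ nsq (ξ 0 • a + ξ 1 • b) := by
  have hb2 : nsq b ≤ C ^ 2 := by
    rw [← enorm2_sq]; exact pow_le_pow_left₀ (enorm2_nonneg b) hb 2
  rw [div_le_iff₀ (by positivity)]
  have h1 : nsq ξ ≤ nsq (ξ 0 • a + ξ 1 • b) * (nsq a + nsq b) := by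
    unfold crs at hd
    have i0 : ξ 0 = b 1 * (ξ 0 * a 0 + ξ 1 * b 0) - b 0 * (ξ 0 * a 1 + ξ 1 * b 1) := by
      linear_combination (-ξ 0) * hd
    have i1 : ξ 1 = - a 1 * (ξ 0 * a 0 + ξ 1 * b 0) + a 0 * (ξ 0 * a 1 + ξ 1 * b 1) := by
      linear_combination (-ξ 1) * hd
    simp only [nsq, Pi.add_apply, Pi.smul_apply, smul_eq_mul]
    generalize ξ 0 * a 0 + ξ 1 * b 0 = p at *
    generalize ξ 0 * a 1 + ξ 1 * b 1 = q at *
    rw [i0, i1]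
    nlinarith [sq_nonneg (b 0 * p + b 1 * q), sq_nonneg (a 0 * p + a 1 * q)]
  refine h1.trans ?_
  have := nsq_nonneg (ξ 0 • a + ξ 1 • b)
  gcongr

/-- The class of strict subsolutions. -/
structure Cls (C : ℝ) (Ω : Set (Fin 2 → ℝ)) (F : M2) (u : (Fin 2 → ℝ) → Fin 2 → ℝ) : Prop where
  cd : ContDiff ℝ 1 u
  off : ∀ x, x ∉ Ω → u x = F.mulVec x
  det : ∀ x, crs (fderiv ℝ u x e1) (fderiv ℝ u x e2) = 1
  lt : ∀ x, nsq (fderiv ℝ u x e1) < 1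
  le : ∀ x, enorm2 (fderiv ℝ u x e2) ≤ C

lemma boxx_eq_Icc (z : Fin 2 → ℝ) (r L : ℝ) :
    boxx z r L = Set.Icc ![z 0 - r, z 1 - L * r] ![z 0 + r, z 1 + L * r] := by
  ext x
  simp only [boxx, Set.mem_ofPred_eq, Set.mem_Icc, Pi.le_def, Fin.forall_fin_two, abs_le]
  simp
  constructor
  · rintro ⟨⟨a, b⟩, c, d⟩; exact ⟨⟨by linarith, by linarith⟩, by linarith, by linarith⟩
  · rintro ⟨⟨a, b⟩, c, d⟩; exact ⟨⟨by linarith, by linarith⟩, by linarith, by linarith⟩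

lemma volume_boxx (z : Fin 2 → ℝ) (r L : ℝ) (hr : 0 ≤ r) (hL : 0 ≤ L) :
    volume.real (boxx z r L) = 4 * L * r ^ 2 := by
  rw [boxx_eq_Icc, Measure.real, Real.volume_Icc_pi_toReal]
  · simp [Fin.prod_univ_two]; ring
  · intro i; fin_cases i <;> simp <;> nlinarith

lemma boxx_compact (z : Fin 2 → ℝ) (r L : ℝ) : IsCompact (boxx z r L) := by
  rw [boxx_eq_Icc]; exact isCompact_Icc

lemma boxx_meas (z : Fin 2 → ℝ) (r L : ℝ) : MeasurableSet (boxx z r L) :=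
  (boxx_compact z r L).isClosed.measurableSet

/-- Integral of a directional derivative of a compactly supported `C¹` function. -/
lemma integral_fderiv_box_zero (w : (Fin 2 → ℝ) → ℝ) (hw : ContDiff ℝ 1 w) (B : Set (Fin 2 → ℝ))
    (hB : IsCompact B) (h0 : ∀ x, x ∉ B → w x = 0) (v : Fin 2 → ℝ) :
    ∫ x in B, fderiv ℝ w x v = 0 := by
  have hcs : HasCompactSupport w := HasCompactSupport.intro hB h0
  have hcont : Continuous fun x => fderiv ℝ w x v := (hw.continuous_fderiv (by norm_num)).clm_apply continuous_const
  have hz : ∀ x, x ∉ B → fderiv ℝ w x v = 0 := by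
    intro x hx
    have : w =ᶠ[nhds x] fun _ => (0:ℝ) := by
      filter_upwards [hB.isClosed.isOpen_compl.mem_nhds hx] with y hy using h0 y hy
    rw [this.fderiv_eq]; simp
  have e : ∫ x in B, fderiv ℝ w x v = ∫ x, fderiv ℝ w x v := by
    rw [setIntegral_eq_integral_of_forall_compl_eq_zero]
    exact hz
  rw [e]
  have hintg : Integrable (fun x => fderiv ℝ w x v) :=
    hcont.integrable_of_hasCompactSupport (HasCompactSupport.intro hB hz)
  have hw1 : Integrable w := hw.continuous.integrable_of_hasCompactSupport hcs
  have := integral_mul_fderiv_eq_neg_fderiv_mul_of_integrable (μ := (volume : Measure (Fin 2 → ℝ)))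
    (f := fun _ => (1:ℝ)) (g := w) (v := v) (by simp) (by simpa using hintg) (by simpa using hw1)
    (fun x _ => by fun_prop) (fun x _ => hw.differentiable (by norm_num) x)
  simpa using this

lemma le_of_sq_le' {a b : ℝ} (h : a ^ 2 ≤ b ^ 2) (hb : 0 ≤ b) : a ≤ b :=
  (le_abs_self a).trans (abs_le_of_sq_le_sq h hb)

set_option maxHeartbeats 4000000 in
lemma local_step (Cm : ℝ) (hCm : 0 ≤ Cm) : ∃ c : ℝ, 0 < c ∧ c ≤ 1 ∧ ∀ C C' : ℝ, C < C' → C' ≤ Cm →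
    ∃ L : ℝ, 1 ≤ L ∧ ∀ (Ω : Set (Fin 2 → ℝ)) (F : M2) (u : (Fin 2 → ℝ) → Fin 2 → ℝ),
      IsOpen Ω → Cls C Ω F u → ∀ x0 ∈ Ω, ∀ δ : ℝ, 0 < δ → ∃ r0 : ℝ, 0 < r0 ∧ ∀ r : ℝ, 0 < r → r ≤ r0 →
        boxx x0 r L ⊆ Ω ∧ ∃ u' : (Fin 2 → ℝ) → Fin 2 → ℝ, Cls C' Ω F u' ∧
          (∀ x, x ∉ boxx x0 r L → u' x = u x) ∧ (∀ x i, |u' x i - u x i| ≤ δ) ∧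
          (∫ x in boxx x0 r L, nsq (fderiv ℝ u x e1)) + c * ∫ x in boxx x0 r L, (1 - nsq (fderiv ℝ u x e1)) ^ 2
            ≤ ∫ x in boxx x0 r L, nsq (fderiv ℝ u' x e1) := by
  obtain ⟨K0, hK0, hG⟩ := twist_gadget
  have hK0p : 0 < K0 := by linarith
  set κ : ℝ := 1 / (8 * K0 * (1 + Cm)) with hκ
  have hκ0 : 0 < κ := by positivity
  have hκK : K0 * κ * (1 + Cm) = 1 / 8 := by rw [hκ]; field_simp
  have hκK' : K0 * κ ≤ 1 / 8 := by
    have : 0 ≤ K0 * κ * Cm := by positivity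
    linarith
  have hκ1 : κ ≤ 1 / 8 := by
    have : 0 ≤ (K0 - 1) * κ := mul_nonneg (by linarith) hκ0.le
    linarith
  set c : ℝ := κ ^ 2 / (32 * (1 + Cm ^ 2)) with hc
  have hc0 : 0 < c := by positivity
  have hc1 : c ≤ 1 := by
    rw [hc, div_le_one (by positivity)]
    have : κ ^ 2 ≤ 1 := pow_le_one₀ hκ0.le (by linarith)
    linarith [sq_nonneg Cm]
  refine ⟨c, hc0, hc1, fun C C' hCC hC' => ?_⟩
  set L : ℝ := max 1 (K0 * (1 + Cm) / (C' - C)) with hLdef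
  have hL : 1 ≤ L := le_max_left _ _
  have hL0 : 0 < L := by linarith
  have hL2 : K0 * (1 + Cm) ≤ L * (C' - C) := by
    rw [← div_le_iff₀ (by linarith)]; exact le_max_right _ _
  refine ⟨L, hL, fun Ω F u hΩ hu x0 hx0 δ hδ => ?_⟩
  have hC0 : 0 ≤ C := (enorm2_nonneg _).trans (hu.le x0)
  have hCle : C ≤ Cm := by linarith
  set A := fderiv ℝ u x0 with hA
  set d : ℝ := 1 - nsq (A e1) with hd
  have hd0 : 0 < d := by have := hu.lt x0; rw [hd]; linarith
  have hd1 : d ≤ 1 := by have := nsq_nonneg (A e1); rw [hd]; linarith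
  set τ : ℝ := κ * d with hτ
  have hτ0 : 0 < τ := by positivity
  have hKτ : K0 * τ * (1 + Cm) = d / 8 := by
    rw [hτ]; linear_combination d * hκK
  have hKτ' : K0 * τ ≤ 1 / 8 := by
    have : 0 ≤ K0 * τ * Cm := by positivity
    linarith
  have hτ1 : τ ≤ 1 / 8 := by
    have : 0 ≤ (K0 - 1) * τ := mul_nonneg (by linarith) hτ0.le
    linarith
  set t : ℝ := τ / L with ht
  have ht0 : 0 < t := by positivity
  have htτ : t ≤ τ := by rw [ht]; exact div_le_self hτ0.le hL
  have hLt : L * t = τ := by rw [ht]; field_simp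
  set ε : ℝ := min (d / 8) (c * d ^ 2 / 18) with hε
  have hε0 : 0 < ε := by positivity
  have hε1 : ε ≤ d / 8 := min_le_left _ _
  have hε2 : 18 * ε ≤ c * d ^ 2 := by
    have : ε ≤ c * d ^ 2 / 18 := min_le_right _ _
    linarith
  have hcont : Continuous (fderiv ℝ u) := hu.cd.continuous_fderiv (by norm_num)
  have hcontv : ∀ v, Continuous fun y => fderiv ℝ u y v := fun v => hcont.clm_apply continuous_const
  -- neighbourhood
  have hev : ∀ᶠ y in nhds x0, y ∈ Ω ∧ enorm2 (fderiv ℝ u y e1 - A e1) < ε ∧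
      enorm2 (fderiv ℝ u y e2 - A e2) < ε ∧ enorm2 (u y - u x0) < δ / 2 := by
    have hh : ∀ (f : (Fin 2 → ℝ) → Fin 2 → ℝ), Continuous f → ∀ η : ℝ, 0 < η →
        ∀ᶠ y in nhds x0, enorm2 (f y - f x0) < η := by
      intro f hf η hη
      have h1 : Continuous fun y => enorm2 (f y - f x0) := continuous_enorm2.comp (by fun_prop)
      have h2 : enorm2 (f x0 - f x0) < η := by simpa [enorm2] using hη
      exact h1.continuousAt.eventually (Iio_mem_nhds h2)
    filter_upwards [hΩ.mem_nhds hx0, hh _ (hcontv e1) ε hε0, hh _ (hcontv e2) ε hε0,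
      hh u hu.cd.continuous (δ / 2) (by positivity)] with y a1 a2 a3 a4 using ⟨a1, a2, a3, a4⟩
  obtain ⟨ρ, hρ, hball⟩ := Metric.eventually_nhds_iff.1 hev
  refine ⟨ρ / (4 * L), by positivity, fun r hr hrr => ?_⟩
  have hrL : 4 * (L * r) ≤ ρ := by
    rw [le_div_iff₀ (by positivity)] at hrr; linarith
  have hrLr : r ≤ L * r := le_mul_of_one_le_left hr.le hL
  obtain ⟨gCD, gOff, gIn, gDet, gB, gCore⟩ := hG x0 r L t hr hL ht0 (by linarith)
  set Ψ := twist x0 r L t with hΨ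
  set B := boxx x0 r L with hBdef
  have hLrp : 0 < L * r := by positivity
  have hdist : ∀ y : Fin 2 → ℝ, |y 0 - x0 0| ≤ 2 * r → |y 1 - x0 1| ≤ 2 * (L * r) → dist y x0 < ρ := by
    intro y h0 h1
    rw [dist_pi_lt_iff hρ]
    intro i
    fin_cases i <;> simp [Real.dist_eq] <;> linarith
  have hBnear : ∀ x ∈ B, dist x x0 < ρ := fun x hx =>
    hdist x (by linarith [hx.1]) (by linarith [hx.2])
  have hBnear' : ∀ x ∈ B, dist (Ψ x) x0 < ρ := fun x hx => hdist _ (gIn x hx).1 (gIn x hx).2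
  have hBO : B ⊆ Ω := fun x hx => (hball (hBnear x hx)).1
  have hBcl : IsClosed B := (boxx_compact x0 r L).isClosed
  refine ⟨hBO, u ∘ Ψ, ?_⟩
  have hud : ∀ y, DifferentiableAt ℝ u y := fun y => hu.cd.differentiable (by norm_num) y
  have hΨd : ∀ y, DifferentiableAt ℝ Ψ y := fun y => gCD.differentiable (by norm_num) y
  have hfd : ∀ x v, fderiv ℝ (u ∘ Ψ) x v =
      (fderiv ℝ Ψ x v 0) • fderiv ℝ u (Ψ x) e1 + (fderiv ℝ Ψ x v 1) • fderiv ℝ u (Ψ x) e2 := by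
    intro x v
    rw [fderiv_comp x (hud _) (hΨd x), ContinuousLinearMap.comp_apply, lin_decomp]
  have hoff : ∀ x, x ∉ B → fderiv ℝ (u ∘ Ψ) x = fderiv ℝ u x := by
    intro x hx
    apply Filter.EventuallyEq.fderiv_eq
    filter_upwards [hBcl.isOpen_compl.mem_nhds hx] with y hy
    simp only [Function.comp, gOff y hy]
  have he1 : ∀ y, enorm2 (fderiv ℝ u y e1) ≤ 1 := by
    intro y
    have h := (hu.lt y).le
    rw [← enorm2_sq] at h
    exact le_of_sq_le' (by linarith) zero_le_one
  have ha : enorm2 (A e1) ≤ 1 - d / 2 := by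
    have h : enorm2 (A e1) ^ 2 = 1 - d := by rw [enorm2_sq]; ring
    refine le_of_sq_le' ?_ (by linarith)
    rw [h]
    linarith [sq_nonneg d, (by ring : (1 - d / 2) ^ 2 = 1 - d + d ^ 2 / 4)]
  have hξ0 : ∀ x, |fderiv ℝ Ψ x e1 0 - 1| ≤ K0 * τ := fun x =>
    (gB x).1.trans (by gcongr)
  have hξ1 : ∀ x, |fderiv ℝ Ψ x e1 1| ≤ K0 * τ := fun x => by
    have := (gB x).2.1; rwa [hLt] at this
  -- bound on combos
  have hcombo : ∀ (p q : Fin 2 → ℝ) (α β P Q : ℝ), |α| ≤ P → |β| ≤ Q → ∀ m n : ℝ, enorm2 p ≤ m → enorm2 q ≤ n →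
      enorm2 (α • p + β • q) ≤ P * m + Q * n := by
    intro p q α β P Q hα hβ m n hm hn
    refine (enorm2_add_le _ _).trans ?_
    rw [enorm2_smul, enorm2_smul]
    have := enorm2_nonneg p
    have := enorm2_nonneg q
    have := abs_nonneg α
    have := abs_nonneg β
    gcongr <;> linarith
  have hP : ∀ x ∈ B, enorm2 (fderiv ℝ (u ∘ Ψ) x e1) ≤ 1 - d / 4 := by
    intro x hx
    have e : fderiv ℝ (u ∘ Ψ) x e1 = A e1 + ((1:ℝ) • (fderiv ℝ u (Ψ x) e1 - A e1) +
       (1:ℝ) • ((fderiv ℝ Ψ x e1 0 - 1) • fderiv ℝ u (Ψ x) e1 + (fderiv ℝ Ψ x e1 1) • fderiv ℝ u (Ψ x) e2)) := by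
      rw [hfd]; module
    rw [e]
    refine (enorm2_add_le _ _).trans ?_
    have h1 := hcombo _ _ (1:ℝ) (1:ℝ) 1 1 (by simp) (by simp) ε (K0 * τ * 1 + K0 * τ * C)
      (hball (hBnear' x hx)).2.1.le
      (hcombo _ _ _ _ _ _ (hξ0 x) (hξ1 x) 1 C (he1 (Ψ x)) (hu.le (Ψ x)))
    have h2 : K0 * τ * C ≤ K0 * τ * Cm := by gcongr
    linarith
  refine ⟨⟨hu.cd.comp gCD, ?_, ?_, ?_, ?_⟩, ?_, ?_, ?_⟩
  · intro x hx
    simp only [Function.comp, gOff x (fun h => hx (hBO h)), hu.off x hx]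
  · intro x
    rw [hfd, hfd]
    have h1 := gDet x
    have h2 := hu.det (Ψ x)
    simp only [crs, Pi.add_apply, Pi.smul_apply, smul_eq_mul] at h2 ⊢
    linear_combination h1 + (fderiv ℝ Ψ x e1 0 * fderiv ℝ Ψ x e2 1 - fderiv ℝ Ψ x e1 1 * fderiv ℝ Ψ x e2 0) * h2
  · intro x
    by_cases hx : x ∈ B
    · rw [← enorm2_sq]
      have := hP x hx
      have h2 := pow_le_pow_left₀ (enorm2_nonneg (fderiv ℝ (u ∘ Ψ) x e1)) this 2
      have h3 : (1 - d / 4) ^ 2 < 1 := pow_lt_one₀ (by linarith) (by linarith) (by norm_num)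
      linarith
    · rw [hoff x hx]; exact hu.lt x
  · intro x
    have e : fderiv ℝ (u ∘ Ψ) x e2 = fderiv ℝ u (Ψ x) e2 +
       ((fderiv ℝ Ψ x e2 0) • fderiv ℝ u (Ψ x) e1 + (fderiv ℝ Ψ x e2 1 - 1) • fderiv ℝ u (Ψ x) e2) := by
      rw [hfd]; module
    rw [e]
    refine (enorm2_add_le _ _).trans ?_
    have htL : K0 * (t / L) ≤ K0 * t := by
      gcongr; exact div_le_self ht0.le hL
    have h1 := hcombo _ _ _ _ _ _ ((gB x).2.2.1.trans htL) (gB x).2.2.2 1 C (he1 (Ψ x)) (hu.le (Ψ x))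
    have h2 := hu.le (Ψ x)
    have h3 : K0 * t * (1 + C) ≤ C' - C := by
      have : K0 * t * (1 + C) ≤ K0 * t * (1 + Cm) := by gcongr
      have h4 : t * (L * (C' - C)) ≤ C' - C := by
        have : t * (L * (C' - C)) = τ * (C' - C) := by rw [← hLt]; ring
        rw [this]; exact mul_le_of_le_one_left (by linarith) (by linarith)
      have h5 : t * (K0 * (1 + Cm)) ≤ t * (L * (C' - C)) := by gcongr
      linarith
    linarith
  · intro x hx
    simp only [Function.comp, gOff x hx]
  · intro x i
    by_cases hx : x ∈ B
    · have h1 := (hball (hBnear x hx)).2.2.2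
      have h2 := (hball (hBnear' x hx)).2.2.2
      have h3 := (abs_le_enorm2 _ i).trans h1.le
      have h4 := (abs_le_enorm2 _ i).trans h2.le
      simp only [Pi.sub_apply] at h3 h4
      have : (u ∘ Ψ) x i - u x i = (u (Ψ x) i - u x0 i) - (u x i - u x0 i) := by simp
      rw [this]
      refine (abs_sub _ _).trans ?_
      linarith
    · simp only [Function.comp, gOff x hx]; simpa using hδ.le
  · -- energy
    have hBm := boxx_meas x0 r L
    have hBc := boxx_compact x0 r L
    have hCdd : ContDiff ℝ 1 (u ∘ Ψ) := hu.cd.comp gCD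
    have hI : ∀ f : (Fin 2 → ℝ) → ℝ, Continuous f → IntegrableOn f B := fun f hf =>
      hf.continuousOn.integrableOn_compact hBc
    have hcu' : Continuous fun y => fderiv ℝ (u ∘ Ψ) y e1 :=
      (hCdd.continuous_fderiv (by norm_num)).clm_apply continuous_const
    have hcΨ : Continuous fun y => fderiv ℝ Ψ y e1 :=
      (gCD.continuous_fderiv (by norm_num)).clm_apply continuous_const
    set V : ℝ := volume.real B with hV
    have hV0 : 0 ≤ V := measureReal_nonneg
    have hVfin : volume B ≠ ⊤ := hBc.measure_ne_top
    set D := boxx x0 (r / 2) L with hD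
    have hDB : D ⊆ B := by
      intro x hx
      exact ⟨hx.1.trans (by linarith), hx.2.trans (by linarith)⟩
    have hDm : MeasurableSet D := boxx_meas _ _ _
    have hVD : volume.real D = V / 4 := by
      rw [hV, hBdef, hD, volume_boxx _ _ _ hr.le hL0.le, volume_boxx _ _ _ (by positivity) hL0.le]; ring
    -- upper bounds for u
    have hdiff : ∀ x ∈ B, |nsq (fderiv ℝ u x e1) - nsq (A e1)| ≤ 2 * ε := by
      intro x hx
      refine (nsq_diff _ _ 1 (he1 _) (he1 _)).trans ?_
      have := (hball (hBnear x hx)).2.1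
      linarith
    have hup1 : (∫ x in B, nsq (fderiv ℝ u x e1)) ≤ V * (nsq (A e1) + 2 * ε) := by
      have : (∫ x in B, nsq (fderiv ℝ u x e1)) ≤ ∫ x in B, (nsq (A e1) + 2 * ε) := by
        refine setIntegral_mono_on (hI _ (continuous_nsq.comp (hcontv e1))) (hI _ continuous_const) hBm ?_
        intro x hx
        have := (abs_le.1 (hdiff x hx)).2
        linarith
      simpa using this
    have hup2 : (∫ x in B, (1 - nsq (fderiv ℝ u x e1)) ^ 2) ≤ V * (d ^ 2 + 4 * ε) := by
      have : (∫ x in B, (1 - nsq (fderiv ℝ u x e1)) ^ 2) ≤ ∫ x in B, (d ^ 2 + 4 * ε) := by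
        refine setIntegral_mono_on (hI _ ?_) (hI _ continuous_const) hBm ?_
        · exact (continuous_const.sub (continuous_nsq.comp (hcontv e1))).pow 2
        intro x hx
        have h1 := abs_le.1 (hdiff x hx)
        have h2 := nsq_nonneg (fderiv ℝ u x e1)
        have h3 := hu.lt x
        have h4 := nsq_nonneg (A e1)
        have h5 : (1 - nsq (fderiv ℝ u x e1)) ^ 2 - d ^ 2 =
          (nsq (A e1) - nsq (fderiv ℝ u x e1)) * ((1 - nsq (fderiv ℝ u x e1)) + d) := by rw [hd]; ring
        have h6 : (nsq (A e1) - nsq (fderiv ℝ u x e1)) * ((1 - nsq (fderiv ℝ u x e1)) + d) ≤ 2 * ε * 2 :=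
          mul_le_mul (by linarith) (by linarith) (by linarith) (by linarith)
        linarith
      simpa using this
    -- lower bound for u'
    set ξ : (Fin 2 → ℝ) → Fin 2 → ℝ := fun x => fderiv ℝ Ψ x e1 - e1 with hξ
    set l0 : ℝ := 2 * (A e1 0 * A e1 0 + A e1 1 * A e1 1) with hl0
    set l1 : ℝ := 2 * (A e1 0 * A e2 0 + A e1 1 * A e2 1) with hl1
    set g1 : (Fin 2 → ℝ) → ℝ := fun x => nsq (A e1) - 12 * ε with hg1
    set g2 : (Fin 2 → ℝ) → ℝ := fun x => l0 * ξ x 0 + l1 * ξ x 1 with hg2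
    set g3 : (Fin 2 → ℝ) → ℝ := D.indicator fun _ => τ ^ 2 / 4 / (1 + Cm ^ 2) with hg3
    have hξcont : Continuous ξ := hcΨ.sub continuous_const
    have hξc : ∀ i, Continuous fun x => ξ x i := fun i => (continuous_apply i).comp hξcont
    have hlow : ∀ x ∈ B, g1 x + g2 x + g3 x ≤ nsq (fderiv ℝ (u ∘ Ψ) x e1) := by
      intro x hx
      have hx0' : ξ x 0 = fderiv ℝ Ψ x e1 0 - 1 := by simp only [hξ, Pi.sub_apply]; congr 1
      have hx1' : ξ x 1 = fderiv ℝ Ψ x e1 1 := by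
        simp only [hξ, Pi.sub_apply]; rw [show e1 1 = 0 from rfl, sub_zero]
      have hb0 : |ξ x 0| ≤ K0 * τ := by rw [hx0']; exact hξ0 x
      have hb1 : |ξ x 1| ≤ K0 * τ := by rw [hx1']; exact hξ1 x
      set q : Fin 2 → ℝ := A e1 + (ξ x 0 • A e1 + ξ x 1 • A e2) with hq
      have hqn : enorm2 q ≤ 2 := by
        refine (enorm2_add_le _ _).trans ?_
        have h1 := hcombo _ _ _ _ _ _ hb0 hb1 1 C (he1 x0) (hu.le x0)
        have h2 : K0 * τ * C ≤ K0 * τ * Cm := by gcongr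
        linarith
      have hpq : enorm2 (fderiv ℝ (u ∘ Ψ) x e1 - q) ≤ 3 * ε := by
        have e : fderiv ℝ (u ∘ Ψ) x e1 - q = (1 + ξ x 0) • (fderiv ℝ u (Ψ x) e1 - A e1)
            + ξ x 1 • (fderiv ℝ u (Ψ x) e2 - A e2) := by
          rw [hfd, hq, hx0', hx1']; module
        rw [e]
        have h1 : |1 + ξ x 0| ≤ 2 := by
          have := abs_le.1 hb0
          exact abs_le.2 ⟨by linarith, by linarith⟩
        have := hcombo _ _ _ _ _ _ h1 (hb1.trans (by linarith : K0 * τ ≤ 1)) ε ε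
          (hball (hBnear' x hx)).2.1.le (hball (hBnear' x hx)).2.2.1.le
        linarith
      have hmain := nsq_diff (fderiv ℝ (u ∘ Ψ) x e1) q 2 (by have := hP x hx; linarith) hqn
      have h1 := (abs_le.1 hmain).1
      have hqe : nsq q = nsq (A e1) + g2 x + nsq (ξ x 0 • A e1 + ξ x 1 • A e2) := by
        simp only [hq, hg2, hl0, hl1, nsq, Pi.add_apply, Pi.smul_apply, smul_eq_mul]; ring
      have hlo := nsq_lower (A e1) (A e2) (ξ x) Cm (hu.det x0) (hu.lt x0).le ((hu.le x0).trans hCle)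
      have hg3x : g3 x ≤ nsq (ξ x) / (1 + Cm ^ 2) := by
        by_cases hxD : x ∈ D
        · rw [hg3, Set.indicator_of_mem hxD]
          gcongr
          have := gCore x hxD
          rw [hLt] at this
          rw [nsq, hx1']
          have h7 := pow_le_pow_left₀ (by linarith) this 2
          have h8 : (τ / 2) ^ 2 = τ ^ 2 / 4 := by ring
          linarith [sq_nonneg (ξ x 0)]
        · rw [hg3, Set.indicator_of_notMem hxD]
          have := nsq_nonneg (ξ x)
          positivity
      simp only [hg1]
      linarith
    have hξint : ∀ i, ∫ x in B, ξ x i = 0 := by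
      intro i
      have := integral_fderiv_box_zero (fun x => Ψ x i - x i) ?_ B hBc ?_ e1
      · rw [← this]
        refine setIntegral_congr_fun hBm ?_
        intro x hx
        have h1 : HasFDerivAt (fun y => Ψ y i - y i) ((ContinuousLinearMap.proj (R := ℝ) (φ := fun _ : Fin 2 => ℝ) i).comp (fderiv ℝ Ψ x) - ContinuousLinearMap.proj (R := ℝ) (φ := fun _ : Fin 2 => ℝ) i) x :=
          ((hasFDerivAt_pi'.1 (hΨd x).hasFDerivAt) i).sub
            (ContinuousLinearMap.proj (R := ℝ) (φ := fun _ : Fin 2 => ℝ) i).hasFDerivAt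
        simp only [h1.fderiv]
        simp [hξ]
      · exact (contDiff_pi.1 gCD i).sub (contDiff_apply ℝ ℝ i)
      · intro x hx; rw [gOff x hx]; simp
    have i1 : IntegrableOn g1 B := hI _ continuous_const
    have i2 : IntegrableOn g2 B := hI _ (((hξc 0).const_mul l0).add ((hξc 1).const_mul l1))
    have i3 : IntegrableOn g3 B := (hI _ continuous_const).indicator hDm
    have hsum : (∫ x in B, (g1 x + g2 x + g3 x)) = V * (nsq (A e1) - 12 * ε) + V / 4 * (τ ^ 2 / 4 / (1 + Cm ^ 2)) := by
      have j0 : (∫ x in B, (g1 x + g2 x + g3 x)) = (∫ x in B, (g1 x + g2 x)) + ∫ x in B, g3 x :=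
        integral_add (i1.add i2) i3
      rw [j0, integral_add i1 i2]
      have j2 : ∫ x in B, g2 x = 0 := by
        rw [hg2, integral_add (hI _ ((hξc 0).const_mul l0)) (hI _ ((hξc 1).const_mul l1)),
          integral_const_mul, integral_const_mul, hξint, hξint]; simp
      have j3 : ∫ x in B, g3 x = V / 4 * (τ ^ 2 / 4 / (1 + Cm ^ 2)) := by
        rw [hg3, setIntegral_indicator hDm, Set.inter_eq_right.2 hDB]
        rw [setIntegral_const, hVD]; simp
      rw [j2, j3, hg1]
      simp [← hV]
    have hlower : (∫ x in B, (g1 x + g2 x + g3 x)) ≤ ∫ x in B, nsq (fderiv ℝ (u ∘ Ψ) x e1) :=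
      setIntegral_mono_on ((i1.add i2).add i3) (hI _ (continuous_nsq.comp hcu')) hBm hlow
    rw [hsum] at hlower
    have hcd : τ ^ 2 / 4 / (1 + Cm ^ 2) = 8 * (c * d ^ 2) := by
      rw [hτ, hc]; field_simp; ring
    rw [hcd] at hlower
    have hcc : c * (∫ x in B, (1 - nsq (fderiv ℝ u x e1)) ^ 2) ≤ c * (V * (d ^ 2 + 4 * ε)) := by gcongr
    have h1 : V * (18 * ε) ≤ V * (c * d ^ 2) := by gcongr
    have h2 : c * (V * (4 * ε)) ≤ 1 * (V * (4 * ε)) := by gcongr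
    linarith

lemma cont_integrableOn {Ω : Set (Fin 2 → ℝ)} (hb : Bornology.IsBounded Ω) {f : (Fin 2 → ℝ) → ℝ}
    (hf : Continuous f) : IntegrableOn f Ω :=
  (hf.continuousOn.integrableOn_compact hb.isCompact_closure).mono_set subset_closure

/-- Property of a good box. -/
def GoodBox (c C' L δ : ℝ) (Ω : Set (Fin 2 → ℝ)) (F : M2) (u : (Fin 2 → ℝ) → Fin 2 → ℝ)
    (a : (Fin 2 → ℝ) × ℝ) (u' : (Fin 2 → ℝ) → Fin 2 → ℝ) : Prop :=
  Cls C' Ω F u' ∧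
    (∀ x, x ∉ boxx a.1 a.2 L → u' x = u x) ∧ (∀ x i, |u' x i - u x i| ≤ δ) ∧
    (∫ x in boxx a.1 a.2 L, nsq (fderiv ℝ u x e1)) + c * ∫ x in boxx a.1 a.2 L, (1 - nsq (fderiv ℝ u x e1)) ^ 2
            ≤ ∫ x in boxx a.1 a.2 L, nsq (fderiv ℝ u' x e1)

lemma glue {ι : Type*} (s : Finset ι) (B : ι → Set (Fin 2 → ℝ)) (hcl : ∀ a, IsClosed (B a))
    (hdisj : Pairwise (Function.onFun Disjoint B)) (u : (Fin 2 → ℝ) → Fin 2 → ℝ)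
    (w : ι → (Fin 2 → ℝ) → Fin 2 → ℝ) (hw : ∀ a x, x ∉ B a → w a x = u x) :
    ∃ u' : (Fin 2 → ℝ) → Fin 2 → ℝ, ∀ x, (∃ a ∈ s, x ∈ B a ∧ u' =ᶠ[nhds x] w a) ∨
      ((∀ a ∈ s, x ∉ B a) ∧ u' =ᶠ[nhds x] u) := by
  classical
  refine ⟨fun x => u x + ∑ a ∈ s, (w a x - u x), fun x => ?_⟩
  by_cases h : ∃ a ∈ s, x ∈ B a
  · obtain ⟨a, ha, hx⟩ := h
    refine Or.inl ⟨a, ha, hx, ?_⟩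
    have hev : ∀ᶠ y in nhds x, ∀ b ∈ s.erase a, y ∉ B b := by
      rw [Filter.eventually_all_finset]
      intro b hb
      refine (hcl b).isOpen_compl.mem_nhds ?_
      intro hxb
      exact Set.disjoint_left.1 (hdisj (Finset.ne_of_mem_erase hb)) hxb hx
    filter_upwards [hev] with y hy
    rw [← Finset.add_sum_erase s _ ha, Finset.sum_eq_zero]
    · simp
    · intro b hb; rw [hw b y (hy b hb)]; simp
  · push Not at h
    refine Or.inr ⟨h, ?_⟩
    have hev : ∀ᶠ y in nhds x, ∀ b ∈ s, y ∉ B b := by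
      rw [Filter.eventually_all_finset]
      intro b hb
      exact (hcl b).isOpen_compl.mem_nhds (h b hb)
    filter_upwards [hev] with y hy
    rw [Finset.sum_eq_zero]
    · simp
    · intro b hb; rw [hw b y (hy b hb)]; simp

lemma Cls.cont {C : ℝ} {Ω : Set (Fin 2 → ℝ)} {F : M2} {u : (Fin 2 → ℝ) → Fin 2 → ℝ} (h : Cls C Ω F u)
    (v : Fin 2 → ℝ) : Continuous fun y => fderiv ℝ u y v :=
  (h.cd.continuous_fderiv (by norm_num)).clm_apply continuous_const

set_option maxHeartbeats 1000000 in
lemma global_step (Cm : ℝ) (hCm : 0 ≤ Cm) : ∃ c : ℝ, 0 < c ∧ ∀ C C' : ℝ, C < C' → C' ≤ Cm →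
    ∀ (Ω : Set (Fin 2 → ℝ)) (F : M2) (u : (Fin 2 → ℝ) → Fin 2 → ℝ),
      IsOpen Ω → Bornology.IsBounded Ω → Cls C Ω F u → ∀ δ : ℝ, 0 < δ →
        ∃ u' : (Fin 2 → ℝ) → Fin 2 → ℝ, Cls C' Ω F u' ∧ (∀ x i, |u' x i - u x i| ≤ δ) ∧
          (∫ x in Ω, nsq (fderiv ℝ u x e1)) + c * ∫ x in Ω, (1 - nsq (fderiv ℝ u x e1)) ^ 2
            ≤ ∫ x in Ω, nsq (fderiv ℝ u' x e1) := by
  obtain ⟨c, hc0, -, hloc⟩ := local_step Cm hCm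
  refine ⟨c / 2, by positivity, fun C C' hCC hC' Ω F u hΩ hbd hu δ hδ => ?_⟩
  obtain ⟨L, hL, hloc⟩ := hloc C C' hCC hC'
  have hL0 : 0 < L := by linarith
  set t : Set ((Fin 2 → ℝ) × ℝ) := {a | 0 < a.2 ∧ boxx a.1 a.2 L ⊆ Ω ∧ ∃ u', GoodBox c C' L δ Ω F u a u'} with ht
  set B : (Fin 2 → ℝ) × ℝ → Set (Fin 2 → ℝ) := fun a => boxx a.1 a.2 L with hB
  obtain ⟨U, hUt, hUc, hUd, hUn⟩ := Vitali.exists_disjoint_covering_ae (volume : Measure (Fin 2 → ℝ)) Ω t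
    (9 * L).toNNReal (fun a => L * a.2) (fun a => a.1) B
    (by
      intro a ha x hx
      have h0 : 0 < a.2 := ha.1
      have : a.2 ≤ L * a.2 := le_mul_of_one_le_left h0.le hL
      rw [Metric.mem_closedBall, dist_pi_le_iff (by positivity)]
      intro i
      fin_cases i
      · simpa [Real.dist_eq] using hx.1.trans this
      · simpa [Real.dist_eq] using hx.2)
    (by
      intro a ha
      have h0 : 0 < a.2 := ha.1
      have h1 : volume (B a) = ENNReal.ofReal (4 * L * a.2 ^ 2) := by
        rw [← volume_boxx a.1 a.2 L h0.le hL0.le, ofReal_measureReal (h := (boxx_compact _ _ _).measure_ne_top)]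
      rw [h1, Real.volume_pi_closedBall _ (by positivity)]
      change _ ≤ ENNReal.ofReal (9 * L) * _
      rw [← ENNReal.ofReal_mul (by positivity)]
      apply ENNReal.ofReal_le_ofReal
      simp
      apply le_of_eq; ring)
    (by
      intro a ha
      have h0 : 0 < a.2 := ha.1
      refine ⟨a.1, mem_interior.2 ⟨Metric.ball a.1 a.2, ?_, Metric.isOpen_ball, Metric.mem_ball_self h0⟩⟩
      intro x hx
      have h2 : a.2 ≤ L * a.2 := le_mul_of_one_le_left h0.le hL
      rw [Metric.mem_ball, dist_pi_lt_iff h0] at hx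
      have h3 := hx 0
      have h4 := hx 1
      rw [Real.dist_eq] at h3 h4
      exact ⟨h3.le, h4.le.trans h2⟩)
    (fun a _ => (boxx_compact _ _ _).isClosed)
    (by
      intro x hx ε hε
      obtain ⟨r0, hr0, h⟩ := hloc Ω F u hΩ hu x hx δ hδ
      have hr : 0 < min r0 (ε / L) := by positivity
      obtain ⟨h1, u', h2⟩ := h (min r0 (ε / L)) hr (min_le_left _ _)
      refine ⟨(x, min r0 (ε / L)), ⟨hr, h1, u', h2⟩, ?_, rfl⟩
      have : min r0 (ε / L) ≤ ε / L := min_le_right _ _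
      rw [le_div_iff₀ hL0] at this
      simp only; linarith)
  have : Countable U := hUc.to_subtype
  set BU : U → Set (Fin 2 → ℝ) := fun a => B a.1 with hBU
  have hBUm : ∀ a, MeasurableSet (BU a) := fun a => boxx_meas _ _ _
  have hBUd : Pairwise (Function.onFun Disjoint BU) := by
    intro a b hab
    exact hUd a.2 b.2 (fun h => hab (Subtype.ext h))
  have hBUsub : ∀ a, BU a ⊆ Ω := fun a => (hUt a.2).2.1
  have hsub : (⋃ a, BU a) ⊆ Ω := Set.iUnion_subset hBUsub
  set f : (Fin 2 → ℝ) → ℝ := fun x => (1 - nsq (fderiv ℝ u x e1)) ^ 2 with hf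
  have hfc : Continuous f := (continuous_const.sub (continuous_nsq.comp (hu.cont e1))).pow 2
  have hfi : IntegrableOn f Ω := cont_integrableOn hbd hfc
  have hsum := hasSum_integral_iUnion hBUm hBUd (hfi.mono_set hsub)
  have heq : ∫ x in ⋃ a, BU a, f x = ∫ x in Ω, f x := by
    apply setIntegral_congr_set
    refine Filter.EventuallyLE.antisymm hsub.eventuallyLE ?_
    rw [ae_le_set]
    rw [Set.biUnion_eq_iUnion] at hUn
    exact hUn
  rw [heq] at hsum
  set T := ∫ x in Ω, f x with hT
  have hfin : ∃ s : Finset U, T / 2 ≤ ∑ a ∈ s, ∫ x in BU a, f x := by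
    have hT0 : 0 ≤ T := integral_nonneg fun x => sq_nonneg _
    rcases hT0.eq_or_lt with h | h
    · exact ⟨∅, by simp [← h]⟩
    · have := hsum.eventually (Ioi_mem_nhds (show T / 2 < T by linarith))
      obtain ⟨s, hs⟩ := this.exists
      exact ⟨s, le_of_lt hs⟩
  obtain ⟨s, hs⟩ := hfin
  have hw : ∀ a : U, ∃ u', GoodBox c C' L δ Ω F u a.1 u' := fun a => (hUt a.2).2.2
  choose w hw using hw
  obtain ⟨u', hu'⟩ := glue s BU (fun a => (boxx_compact _ _ _).isClosed) hBUd u w (fun a x hx => (hw a).2.1 x hx)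
  have hcls : Cls C' Ω F u' := by
    refine ⟨?_, ?_, ?_, ?_, ?_⟩
    · rw [contDiff_iff_contDiffAt]
      intro x
      rcases hu' x with ⟨a, -, -, h⟩ | ⟨-, h⟩
      · exact ((hw a).1.cd.contDiffAt).congr_of_eventuallyEq h
      · exact hu.cd.contDiffAt.congr_of_eventuallyEq h
    · intro x hx
      rcases hu' x with ⟨a, -, -, h⟩ | ⟨-, h⟩
      · rw [h.eq_of_nhds]; exact (hw a).1.off x hx
      · rw [h.eq_of_nhds]; exact hu.off x hx
    · intro x
      rcases hu' x with ⟨a, -, -, h⟩ | ⟨-, h⟩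
      · rw [h.fderiv_eq]; exact (hw a).1.det x
      · rw [h.fderiv_eq]; exact hu.det x
    · intro x
      rcases hu' x with ⟨a, -, -, h⟩ | ⟨-, h⟩
      · rw [h.fderiv_eq]; exact (hw a).1.lt x
      · rw [h.fderiv_eq]; exact hu.lt x
    · intro x
      rcases hu' x with ⟨a, -, -, h⟩ | ⟨-, h⟩
      · rw [h.fderiv_eq]; exact (hw a).1.le x
      · rw [h.fderiv_eq]; exact (hu.le x).trans hCC.le
  refine ⟨u', hcls, ?_, ?_⟩
  · intro x i
    rcases hu' x with ⟨a, -, -, h⟩ | ⟨-, h⟩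
    · rw [h.eq_of_nhds]; exact (hw a).2.2.1 x i
    · rw [h.eq_of_nhds]; simpa using hδ.le
  · have ic : ∀ v, Continuous v → ∀ a : U, IntegrableOn v (BU a) := fun v hv a =>
      (cont_integrableOn (f := v) hbd hv).mono_set (hBUsub a)
    set g : (Fin 2 → ℝ) → ℝ := fun x => nsq (fderiv ℝ u' x e1) - nsq (fderiv ℝ u x e1) with hg
    have hgc : Continuous g := (continuous_nsq.comp (hcls.cont e1)).sub (continuous_nsq.comp (hu.cont e1))
    have h1 : ∫ x in Ω, g x = ∑ a ∈ s, ∫ x in BU a, g x := by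
      rw [← integral_biUnion_finset s (fun a _ => hBUm a) (fun a _ b _ hab => hBUd hab) (fun a _ => ic g hgc a)]
      apply setIntegral_eq_of_subset_of_forall_sdiff_eq_zero hΩ.measurableSet
      · exact Set.iUnion₂_subset fun a _ => hBUsub a
      · intro x hx
        rcases hu' x with ⟨a, ha, hxa, h⟩ | ⟨-, h⟩
        · exact absurd (Set.mem_biUnion (Finset.mem_coe.2 ha) hxa) hx.2
        · simp only [hg, h.fderiv_eq, sub_self]
    have h2 : ∀ a ∈ s, c * (∫ x in BU a, f x) ≤ ∫ x in BU a, g x := by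
      intro a ha
      have e1' : ∫ x in BU a, nsq (fderiv ℝ u' x e1) = ∫ x in BU a, nsq (fderiv ℝ (w a) x e1) := by
        refine setIntegral_congr_fun (hBUm a) ?_
        intro x hx
        rcases hu' x with ⟨b, hb, hxb, h⟩ | ⟨h, -⟩
        · have : a = b := by
            by_contra hab
            exact Set.disjoint_left.1 (hBUd hab) hx hxb
          subst this
          simp only [h.fderiv_eq]
        · exact absurd hx (h a ha)
      have h3 := (hw a).2.2.2
      have h4 : ∫ x in BU a, g x = (∫ x in BU a, nsq (fderiv ℝ u' x e1)) - ∫ x in BU a, nsq (fderiv ℝ u x e1) :=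
        integral_sub (ic _ (continuous_nsq.comp (hcls.cont e1)) a) (ic _ (continuous_nsq.comp (hu.cont e1)) a)
      rw [h4, e1']
      change (∫ x in BU a, nsq (fderiv ℝ u x e1)) + c * (∫ x in BU a, f x) ≤ ∫ x in BU a, nsq (fderiv ℝ (w a) x e1) at h3
      linarith
    have h5 : ∫ x in Ω, g x = (∫ x in Ω, nsq (fderiv ℝ u' x e1)) - ∫ x in Ω, nsq (fderiv ℝ u x e1) :=
      integral_sub (cont_integrableOn hbd (continuous_nsq.comp (hcls.cont e1)))
        (cont_integrableOn hbd (continuous_nsq.comp (hu.cont e1)))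
    have h6 := Finset.sum_le_sum h2
    rw [← Finset.mul_sum, ← h1, h5] at h6
    have h7 : c * (T / 2) ≤ c * ∑ a ∈ s, ∫ x in BU a, f x := by gcongr
    linarith

open Filter Topology in
/-- dependent choice -/
lemma dep_seq {α : Type*} (Q : ℕ → α → Prop) (R : ℕ → α → α → Prop) (h0 : ∃ a, Q 0 a)
    (hs : ∀ n a, Q n a → ∃ b, Q (n + 1) b ∧ R n a b) :
    ∃ f : ℕ → α, (∀ n, Q n (f n)) ∧ ∀ n, R n (f n) (f (n + 1)) := by
  classical
  obtain ⟨a0, ha0⟩ := h0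
  choose! g hg using hs
  let f : ℕ → α := fun n => Nat.rec a0 (fun n a => g n a) n
  have hQ : ∀ n, Q n (f n) := by
    intro n
    induction n with
    | zero => exact ha0
    | succ k ih => exact (hg k (f k) ih).1
  exact ⟨f, hQ, fun n => (hg n (f n) (hQ n)).2⟩

/-- bounded measurable functions -/
def BM (f : (Fin 2 → ℝ) → ℝ) : Prop := Measurable f ∧ ∃ C, ∀ x, |f x| ≤ C

lemma BM.const (c : ℝ) : BM fun _ => c := ⟨measurable_const, |c|, fun _ => le_rfl⟩

lemma BM.add {f g : (Fin 2 → ℝ) → ℝ} (hf : BM f) (hg : BM g) : BM fun x => f x + g x := by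
  obtain ⟨C, hC⟩ := hf.2
  obtain ⟨D, hD⟩ := hg.2
  exact ⟨hf.1.add hg.1, C + D, fun x => (abs_add_le _ _).trans (add_le_add (hC x) (hD x))⟩

lemma BM.mul {f g : (Fin 2 → ℝ) → ℝ} (hf : BM f) (hg : BM g) : BM fun x => f x * g x := by
  obtain ⟨C, hC⟩ := hf.2
  obtain ⟨D, hD⟩ := hg.2
  refine ⟨hf.1.mul hg.1, C * D, fun x => ?_⟩
  rw [abs_mul]
  exact mul_le_mul (hC x) (hD x) (abs_nonneg _) ((abs_nonneg _).trans (hC x))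

lemma BM.sub {f g : (Fin 2 → ℝ) → ℝ} (hf : BM f) (hg : BM g) : BM fun x => f x - g x := by
  have := hf.add ((BM.const (-1)).mul hg)
  simpa [sub_eq_add_neg] using this

lemma BM.sq {f : (Fin 2 → ℝ) → ℝ} (hf : BM f) : BM fun x => f x ^ 2 := by
  simpa [pow_two] using hf.mul hf

lemma BM.int {f : (Fin 2 → ℝ) → ℝ} (hf : BM f) {Ω : Set (Fin 2 → ℝ)} (hb : Bornology.IsBounded Ω) :
    IntegrableOn f Ω := by
  obtain ⟨C, hC⟩ := hf.2
  exact Measure.integrableOn_of_bounded hb.measure_lt_top.ne hf.1.aestronglyMeasurable (M := C)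
    (ae_of_all _ hC)

/-- vector of directional derivatives -/
def dl (v : (Fin 2 → ℝ) → Fin 2 → ℝ) (w x : Fin 2 → ℝ) : Fin 2 → ℝ :=
  fun i => lineDeriv ℝ (fun y => v y i) x w

lemma lip_comp {K : NNReal} {v : (Fin 2 → ℝ) → Fin 2 → ℝ} (hv : LipschitzWith K v) (i : Fin 2) :
    LipschitzWith K (fun y => v y i) := by
  have := (LipschitzWith.eval (α := fun _ : Fin 2 => ℝ) i).comp hv
  rw [one_mul] at this; exact this

lemma dl_eq {v : (Fin 2 → ℝ) → Fin 2 → ℝ} {x : Fin 2 → ℝ} (h : DifferentiableAt ℝ v x) (w : Fin 2 → ℝ) :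
    dl v w x = fderiv ℝ v x w := by
  ext i
  have h1 : HasFDerivAt (fun y => v y i) ((ContinuousLinearMap.proj i).comp (fderiv ℝ v x)) x :=
    (hasFDerivAt_pi'.1 h.hasFDerivAt) i
  exact (h1.hasLineDerivAt w).lineDeriv

lemma dl_bound {K : NNReal} {v : (Fin 2 → ℝ) → Fin 2 → ℝ} (hv : LipschitzWith K v) (w x : Fin 2 → ℝ)
    (i : Fin 2) : |dl v w x i| ≤ K * ‖w‖ :=
  norm_lineDeriv_le_of_lipschitz ℝ (lip_comp hv i)

lemma dl_BM {K : NNReal} {v : (Fin 2 → ℝ) → Fin 2 → ℝ} (hv : LipschitzWith K v) (w : Fin 2 → ℝ)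
    (i : Fin 2) : BM fun x => dl v w x i :=
  ⟨measurable_lineDeriv (lip_comp hv i).continuous, _, fun x => dl_bound hv w x i⟩

lemma BM_nsq {p : (Fin 2 → ℝ) → Fin 2 → ℝ} (h : ∀ i, BM fun x => p x i) : BM fun x => nsq (p x) :=
  (h 0).sq.add (h 1).sq

lemma BM_crs {p q : (Fin 2 → ℝ) → Fin 2 → ℝ} (h : ∀ i, BM fun x => p x i) (h' : ∀ i, BM fun x => q x i) :
    BM fun x => crs (p x) (q x) :=
  ((h 0).mul (h' 1)).sub ((h 1).mul (h' 0))

open Filter Topology in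
lemma weak_conv_on {K : NNReal} (v : ℕ → (Fin 2 → ℝ) → Fin 2 → ℝ) (v0 : (Fin 2 → ℝ) → Fin 2 → ℝ)
    (hv : ∀ n, LipschitzWith K (v n)) (hv0 : LipschitzWith K v0) (δ : ℕ → ℝ)
    (hδ : Tendsto δ atTop (𝓝 0)) (hlim : ∀ n x i, |v n x i - v0 x i| ≤ δ n)
    {Ω : Set (Fin 2 → ℝ)} (hΩ : MeasurableSet Ω) (hb : Bornology.IsBounded Ω)
    (g : (Fin 2 → ℝ) → ℝ) (hg : BM g) (w : Fin 2 → ℝ) (i : Fin 2) :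
    Tendsto (fun n => ∫ x in Ω, dl (v n) w x i * g x) atTop
      (𝓝 (∫ x in Ω, dl v0 w x i * g x)) := by
  have hu : TendstoUniformly (fun n y => v n y i) (fun y => v0 y i) atTop := by
    rw [Metric.tendstoUniformly_iff]
    intro ε hε
    filter_upwards [hδ.eventually_lt_const hε] with n hn x
    rw [dist_comm, Real.dist_eq]
    exact (hlim n x i).trans_lt hn
  have := weak_conv (fun n y => v n y i) (fun y => v0 y i) (fun n => lip_comp (hv n) i) (lip_comp hv0 i) hu
    (Ω.indicator g) ((hg.int hb).integrable_indicator hΩ) w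
  have e : ∀ f : (Fin 2 → ℝ) → ℝ, ∫ x, lineDeriv ℝ f x w * Ω.indicator g x =
      ∫ x in Ω, lineDeriv ℝ f x w * g x := by
    intro f
    rw [← integral_indicator hΩ]
    congr 1; ext x
    by_cases hx : x ∈ Ω <;> simp [hx]
  simp only [e] at this
  exact this

/-- directional energy -/
def En (Ω : Set (Fin 2 → ℝ)) (v : (Fin 2 → ℝ) → Fin 2 → ℝ) : ℝ := ∫ x in Ω, nsq (dl v e1 x)

/-- mixed energy -/
def Mx (Ω : Set (Fin 2 → ℝ)) (v u : (Fin 2 → ℝ) → Fin 2 → ℝ) : ℝ :=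
  ∑ i, ∫ x in Ω, dl v e1 x i * dl u e1 x i

lemma En_sub {K : NNReal} {u v : (Fin 2 → ℝ) → Fin 2 → ℝ} (hv : LipschitzWith K v) (hu : LipschitzWith K u)
    {Ω : Set (Fin 2 → ℝ)} (hb : Bornology.IsBounded Ω) :
    ∫ x in Ω, nsq (dl v e1 x - dl u e1 x) = En Ω v - 2 * Mx Ω v u + En Ω u := by
  have bv := dl_BM hv e1
  have bu := dl_BM hu e1
  have i1 := (BM_nsq bv).int hb
  have i2 := (BM_nsq bu).int hb
  have m0 := ((bv 0).mul (bu 0)).int hb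
  have m1 := ((bv 1).mul (bu 1)).int hb
  unfold En Mx
  have m2 := ((BM.const 2).mul (((bv 0).mul (bu 0)).add ((bv 1).mul (bu 1)))).int hb
  have m3 := ((BM_nsq bv).sub ((BM.const 2).mul (((bv 0).mul (bu 0)).add ((bv 1).mul (bu 1))))).int hb
  rw [Fin.sum_univ_two, ← integral_add m0 m1, ← integral_const_mul, ← integral_sub i1 m2,
    ← integral_add m3 i2]
  congr 1; ext x; simp [nsq]; ring

lemma En_ge {K : NNReal} {u v : (Fin 2 → ℝ) → Fin 2 → ℝ} (hv : LipschitzWith K v) (hu : LipschitzWith K u)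
    {Ω : Set (Fin 2 → ℝ)} (hb : Bornology.IsBounded Ω) :
    2 * Mx Ω v u - En Ω u ≤ En Ω v := by
  have h := En_sub hv hu hb
  have : 0 ≤ ∫ x in Ω, nsq (dl v e1 x - dl u e1 x) := integral_nonneg fun x => nsq_nonneg _
  linarith

lemma Mx_self (Ω : Set (Fin 2 → ℝ)) {K : NNReal} {u : (Fin 2 → ℝ) → Fin 2 → ℝ} (hu : LipschitzWith K u)
    (hb : Bornology.IsBounded Ω) : Mx Ω u u = En Ω u := by
  have h := En_sub hu hu hb
  simp [nsq] at h
  linarith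

open Filter Topology in
lemma Mx_tendsto {K : NNReal} (v : ℕ → (Fin 2 → ℝ) → Fin 2 → ℝ) (v0 : (Fin 2 → ℝ) → Fin 2 → ℝ)
    (hv : ∀ n, LipschitzWith K (v n)) (hv0 : LipschitzWith K v0) (δ : ℕ → ℝ)
    (hδ : Tendsto δ atTop (𝓝 0)) (hlim : ∀ n x i, |v n x i - v0 x i| ≤ δ n)
    {Ω : Set (Fin 2 → ℝ)} (hΩ : MeasurableSet Ω) (hb : Bornology.IsBounded Ω) :
    Tendsto (fun n => Mx Ω (v n) v0) atTop (𝓝 (En Ω v0)) := by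
  rw [← Mx_self Ω hv0 hb]
  exact tendsto_finsetSum _ fun i _ => weak_conv_on v v0 hv hv0 δ hδ hlim hΩ hb _ (dl_BM hv0 e1 i) e1 i

open Filter Topology in
lemma choose_delta {K : NNReal} (u : (Fin 2 → ℝ) → Fin 2 → ℝ) (hu : LipschitzWith K u)
    {Ω : Set (Fin 2 → ℝ)} (hΩ : MeasurableSet Ω) (hb : Bornology.IsBounded Ω) (ε : ℝ) (hε : 0 < ε) :
    ∃ δ : ℝ, 0 < δ ∧ ∀ v : (Fin 2 → ℝ) → Fin 2 → ℝ, LipschitzWith K v → (∀ x i, |v x i - u x i| ≤ δ) → En Ω u - ε ≤ En Ω v := by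
  by_contra hcon
  push Not at hcon
  have := fun n : ℕ => hcon (1 / ((n : ℝ) + 1)) (by positivity)
  choose v hv1 hv2 hv3 using this
  have h := Mx_tendsto v u hv1 hu _ tendsto_one_div_add_atTop_nhds_zero_nat hv2 hΩ hb
  obtain ⟨n, hn⟩ := (h.eventually_const_lt (show En Ω u - ε / 2 < En Ω u by linarith)).exists
  have := En_ge (hv1 n) hu hb
  have := hv3 n
  linarith

lemma Cls.lip {C Cm : ℝ} {Ω : Set (Fin 2 → ℝ)} {F : M2} {u : (Fin 2 → ℝ) → Fin 2 → ℝ} (h : Cls C Ω F u)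
    (hC : C ≤ Cm) (hCm : 0 ≤ Cm) : LipschitzWith (Real.toNNReal (1 + Cm)) u := by
  refine lipschitzWith_of_nnnorm_fderiv_le (h.cd.differentiable (by norm_num)) fun x => ?_
  rw [← NNReal.coe_le_coe, Real.coe_toNNReal _ (by linarith), coe_nnnorm]
  refine ContinuousLinearMap.opNorm_le_bound _ (by linarith) fun v => ?_
  rw [pi_norm_le_iff_of_nonneg (by positivity)]
  intro i
  rw [lin_decomp]
  have h1 : |fderiv ℝ u x e1 i| ≤ 1 := by
    refine (abs_le_enorm2 _ _).trans ?_
    have := h.lt x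
    rw [← enorm2_sq] at this
    have h0 := enorm2_nonneg (fderiv ℝ u x e1)
    nlinarith
  have h2 : |fderiv ℝ u x e2 i| ≤ Cm := (abs_le_enorm2 _ _).trans ((h.le x).trans hC)
  have h3 : |v 0| ≤ ‖v‖ := norm_le_pi_norm v 0
  have h4 : |v 1| ≤ ‖v‖ := norm_le_pi_norm v 1
  simp only [Pi.add_apply, Pi.smul_apply, smul_eq_mul, Real.norm_eq_abs]
  calc _ ≤ |v 0| * |fderiv ℝ u x e1 i| + |v 1| * |fderiv ℝ u x e2 i| := by
        rw [← abs_mul, ← abs_mul]; exact abs_add_le _ _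
    _ ≤ ‖v‖ * 1 + ‖v‖ * Cm := by gcongr
    _ = _ := by ring

lemma BM_const_fun {f : (Fin 2 → ℝ) → ℝ} (c : ℝ) (h : ∀ x, f x = c) : BM f := by
  have : f = fun _ => c := funext h
  rw [this]; exact BM.const c

lemma nsq_one_ineq (p q : Fin 2 → ℝ) (B : ℝ) (hp : ∀ i, |p i| ≤ B) (hq : ∀ i, |q i| ≤ B) :
    (1 - nsq q) ^ 2 ≤ 2 * (1 - nsq p) ^ 2 + (16 * B ^ 2) * nsq (p - q) := by
  have h1 : ∀ i, (p i + q i) ^ 2 ≤ 4 * B ^ 2 := by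
    intro i
    have := abs_add_le (p i) (q i)
    have h2 : |p i + q i| ≤ 2 * B := by linarith [hp i, hq i]
    have := sq_le_sq' (by linarith [abs_nonneg (p i + q i)]) h2
    rw [sq_abs] at this; linarith
  have h2 : (nsq p - nsq q) ^ 2 ≤ nsq (p - q) * (8 * B ^ 2) := by
    have a : (nsq p - nsq q) ^ 2 ≤ nsq (p - q) * ((p 0 + q 0) ^ 2 + (p 1 + q 1) ^ 2) := by
      simp only [nsq, Pi.sub_apply]
      nlinarith [sq_nonneg ((p 0 - q 0) * (p 1 + q 1) - (p 1 - q 1) * (p 0 + q 0))]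
    refine a.trans (mul_le_mul_of_nonneg_left ?_ (nsq_nonneg _))
    linarith [h1 0, h1 1]
  nlinarith [sq_nonneg ((1 - nsq p) - (nsq p - nsq q))]

lemma crs_ineq (a b : Fin 2 → ℝ) (g B G ε : ℝ) (hε : 0 < ε) (hb : ∀ i, |b i| ≤ B) (hg : |g| ≤ G) :
    g * crs a b ≤ ε + (2 * B ^ 2 * G ^ 2 / ε) * nsq a := by
  have h0 : (crs a b) ^ 2 ≤ nsq a * (2 * B ^ 2) := by
    have h : (crs a b) ^ 2 ≤ nsq a * nsq b := by
      simp only [nsq, crs]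
      nlinarith [sq_nonneg (a 0 * b 0 + a 1 * b 1)]
    refine h.trans (mul_le_mul_of_nonneg_left ?_ (nsq_nonneg _))
    have h1 := sq_le_sq' (by linarith [abs_nonneg (b 0), hb 0]) (hb 0)
    have h2 := sq_le_sq' (by linarith [abs_nonneg (b 1), hb 1]) (hb 1)
    rw [sq_abs] at h1 h2
    unfold nsq; linarith
  have h1 : g ^ 2 ≤ G ^ 2 := by
    have h1 := sq_le_sq' (by linarith [abs_nonneg g]) hg
    rwa [sq_abs] at h1
  have h2 : (g * crs a b) ^ 2 ≤ 2 * B ^ 2 * G ^ 2 * nsq a := by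
    rw [mul_pow]
    calc g ^ 2 * crs a b ^ 2 ≤ G ^ 2 * (nsq a * (2 * B ^ 2)) := by gcongr
      _ = _ := by ring
  have h3 : g * crs a b ≤ ε + (g * crs a b) ^ 2 / ε := by
    have : 0 ≤ (2 * ε - g * crs a b) ^ 2 / ε := by positivity
    have e : (2 * ε - g * crs a b) ^ 2 / ε = 4 * ε - 4 * (g * crs a b) + (g * crs a b) ^ 2 / ε := by
      field_simp; ring
    rw [e] at this
    have : 0 ≤ (g * crs a b) ^ 2 / ε := by positivity
    linarith
  refine h3.trans ?_
  rw [div_mul_eq_mul_div]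
  gcongr

open Filter Topology in
lemma limit_id {K : NNReal} (v : ℕ → (Fin 2 → ℝ) → Fin 2 → ℝ) (v0 : (Fin 2 → ℝ) → Fin 2 → ℝ)
    (hv : ∀ n, LipschitzWith K (v n)) (hv0 : LipschitzWith K v0) (δ : ℕ → ℝ)
    (hδ : Tendsto δ atTop (𝓝 0)) (hlim : ∀ n x i, |v n x i - v0 x i| ≤ δ n)
    {Ω : Set (Fin 2 → ℝ)} (hΩ : MeasurableSet Ω) (hb : Bornology.IsBounded Ω)
    (hcrs : ∀ n x, crs (dl (v n) e1 x) (dl (v n) e2 x) = 1)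
    (hE : Tendsto (fun n => En Ω (v n)) atTop (𝓝 (En Ω v0)))
    (hG : Tendsto (fun n => ∫ x in Ω, (1 - nsq (dl (v n) e1 x)) ^ 2) atTop (𝓝 0)) :
    ∀ᵐ x ∂(volume.restrict Ω), nsq (dl v0 e1 x) = 1 ∧ crs (dl v0 e1 x) (dl v0 e2 x) = 1 := by
  have b1 := fun n => dl_BM (hv n) e1
  have b2 := fun n => dl_BM (hv n) e2
  have c1 := dl_BM hv0 e1
  have c2 := dl_BM hv0 e2
  have bd : ∀ n, BM fun x => nsq (dl (v n) e1 x - dl v0 e1 x) := fun n =>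
    BM_nsq (p := fun x => dl (v n) e1 x - dl v0 e1 x) fun i => (b1 n i).sub (c1 i)
  have hstrong : Tendsto (fun n => ∫ x in Ω, nsq (dl (v n) e1 x - dl v0 e1 x)) atTop (𝓝 0) := by
    have h := (hE.sub ((Mx_tendsto v v0 hv hv0 δ hδ hlim hΩ hb).const_mul 2)).add
      (tendsto_const_nhds (x := En Ω v0))
    have e : En Ω v0 - 2 * En Ω v0 + En Ω v0 = 0 := by ring
    rw [e] at h
    refine h.congr fun n => (En_sub (hv n) hv0 hb).symm
  set B : ℝ := K * ‖e1‖ with hB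
  set B2 : ℝ := K * ‖e2‖ with hB2
  have key1 : ∀ᵐ x ∂(volume.restrict Ω), nsq (dl v0 e1 x) = 1 := by
    have hbm : BM fun x => (1 - nsq (dl v0 e1 x)) ^ 2 := ((BM.const 1).sub (BM_nsq c1)).sq
    have hle : ∀ n, ∫ x in Ω, (1 - nsq (dl v0 e1 x)) ^ 2 ≤
        2 * (∫ x in Ω, (1 - nsq (dl (v n) e1 x)) ^ 2)
          + (16 * B ^ 2) * ∫ x in Ω, nsq (dl (v n) e1 x - dl v0 e1 x) := by
      intro n
      have d1 : BM fun x => 2 * (1 - nsq (dl (v n) e1 x)) ^ 2 :=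
        (BM.const 2).mul ((BM.const 1).sub (BM_nsq (b1 n))).sq
      have d2 : BM fun x => (16 * B ^ 2) * nsq (dl (v n) e1 x - dl v0 e1 x) := (BM.const _).mul (bd n)
      rw [← integral_const_mul, ← integral_const_mul, ← integral_add (d1.int hb) (d2.int hb)]
      exact integral_mono (hbm.int hb) ((d1.add d2).int hb) fun x =>
        nsq_one_ineq _ _ B (dl_bound (hv n) e1 x) (dl_bound hv0 e1 x)
    have h0 : ∫ x in Ω, (1 - nsq (dl v0 e1 x)) ^ 2 ≤ 0 := by
      have := ge_of_tendsto' ((hG.const_mul 2).add (hstrong.const_mul (16 * B ^ 2))) hle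
      simpa using this
    have h1 : ∫ x in Ω, (1 - nsq (dl v0 e1 x)) ^ 2 = 0 :=
      le_antisymm h0 (integral_nonneg fun x => sq_nonneg _)
    rw [integral_eq_zero_iff_of_nonneg (fun x => sq_nonneg _) (hbm.int hb)] at h1
    filter_upwards [h1] with x hx
    have : (1 - nsq (dl v0 e1 x)) = 0 := by simpa using hx
    linarith
  have key2 : ∀ᵐ x ∂(volume.restrict Ω), crs (dl v0 e1 x) (dl v0 e2 x) = 1 := by
    set g : (Fin 2 → ℝ) → ℝ := fun x => 1 - crs (dl v0 e1 x) (dl v0 e2 x) with hg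
    have bg : BM g := (BM.const 1).sub (BM_crs c1 c2)
    obtain ⟨G, hGb⟩ := bg.2
    -- weak limit
    have w0 := weak_conv_on v v0 hv hv0 δ hδ hlim hΩ hb _ (bg.mul (c1 1)) e2 0
    have w1 := weak_conv_on v v0 hv hv0 δ hδ hlim hΩ hb _ (bg.mul (c1 0)) e2 1
    have hw := (tendsto_const_nhds (x := ∫ x in Ω, g x)).sub (w1.sub w0)
    have ev : ∀ u : (Fin 2 → ℝ) → Fin 2 → ℝ, LipschitzWith K u →
        (∫ x in Ω, g x) - ((∫ x in Ω, dl u e2 x 1 * (g x * dl v0 e1 x 0))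
          - ∫ x in Ω, dl u e2 x 0 * (g x * dl v0 e1 x 1))
        = ∫ x in Ω, g x * (1 - crs (dl v0 e1 x) (dl u e2 x)) := by
      intro u hu
      have k := dl_BM hu e2
      have m1 := (k 1).mul (bg.mul (c1 0))
      have m0 := (k 0).mul (bg.mul (c1 1))
      rw [← integral_sub (m1.int hb) (m0.int hb), ← integral_sub (bg.int hb) ((m1.sub m0).int hb)]
      congr 1; ext x; simp only [crs]; ring
    rw [ev v0 hv0] at hw
    have hw' : Tendsto (fun n => ∫ x in Ω, g x * (1 - crs (dl v0 e1 x) (dl (v n) e2 x))) atTop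
      (𝓝 (∫ x in Ω, g x * (1 - crs (dl v0 e1 x) (dl v0 e2 x)))) := hw.congr fun n => ev (v n) (hv n)
    have hle : ∀ ε : ℝ, 0 < ε → ∫ x in Ω, g x ^ 2 ≤ ε * volume.real Ω := by
      intro ε hε
      have hl := ((hstrong.const_mul (2 * B2 ^ 2 * G ^ 2 / ε)).const_add (ε * volume.real Ω))
      have e : ∫ x in Ω, g x ^ 2 = ∫ x in Ω, g x * (1 - crs (dl v0 e1 x) (dl v0 e2 x)) := by
        congr 1; ext x; simp only [hg]; ring
      rw [e]
      have := le_of_tendsto_of_tendsto' hw' hl fun n => by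
        have f1 : ε * volume.real Ω = ∫ x in Ω, ε := by simp [mul_comm]
        have d1 : BM fun x => (2 * B2 ^ 2 * G ^ 2 / ε) * nsq (dl (v n) e1 x - dl v0 e1 x) :=
          (BM.const _).mul (bd n)
        rw [f1, ← integral_const_mul, ← integral_add ((BM.const ε).int hb) (d1.int hb)]
        refine integral_mono ((bg.mul ((BM.const 1).sub (BM_crs c1 (b2 n)))).int hb)
          (((BM.const ε).add d1).int hb) fun x => ?_
        have h := crs_ineq (dl (v n) e1 x - dl v0 e1 x) (dl (v n) e2 x) (g x) B2 G ε hε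
          (dl_bound (hv n) e2 x) (hGb x)
        have h2 : crs (dl (v n) e1 x - dl v0 e1 x) (dl (v n) e2 x)
            = 1 - crs (dl v0 e1 x) (dl (v n) e2 x) := by
          rw [← hcrs n x]; simp only [crs, Pi.sub_apply]; ring
        rw [h2] at h
        exact h
      simpa using this
    have h0 : ∫ x in Ω, g x ^ 2 ≤ 0 := by
      by_contra hcon
      push Not at hcon
      have hm : 0 ≤ volume.real Ω := measureReal_nonneg
      set I := ∫ x in Ω, g x ^ 2 with hI
      have := hle (I / (2 * (volume.real Ω + 1))) (by positivity)
      rw [div_mul_eq_mul_div, le_div_iff₀ (by positivity)] at this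
      nlinarith
    have h1 : ∫ x in Ω, g x ^ 2 = 0 := le_antisymm h0 (integral_nonneg fun x => sq_nonneg _)
    rw [integral_eq_zero_iff_of_nonneg (fun x => sq_nonneg _) (bg.sq.int hb)] at h1
    filter_upwards [h1] with x hx
    have : g x = 0 := by simpa using hx
    simp only [hg] at this
    linarith
  filter_upwards [key1, key2] with x h1 h2 using ⟨h1, h2⟩

lemma Cls.dl {C : ℝ} {Ω : Set (Fin 2 → ℝ)} {F : M2} {u : (Fin 2 → ℝ) → Fin 2 → ℝ} (h : Cls C Ω F u)
    (w x : Fin 2 → ℝ) : dl u w x = fderiv ℝ u x w :=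
  dl_eq (h.cd.differentiable (by norm_num) x) w

lemma Cls_lin (Ω : Set (Fin 2 → ℝ)) (F : M2) (hdet : crs (F.mulVec e1) (F.mulVec e2) = 1)
    (hlt : nsq (F.mulVec e1) < 1) : Cls (enorm2 (F.mulVec e2)) Ω F (fun x => F.mulVec x) := by
  let A : (Fin 2 → ℝ) →L[ℝ] (Fin 2 → ℝ) := LinearMap.toContinuousLinearMap F.mulVecLin
  have hA : (fun x => F.mulVec x) = A := rfl
  have hd : ∀ x w, fderiv ℝ (fun x => F.mulVec x) x w = F.mulVec w := by
    intro x w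
    rw [hA, ContinuousLinearMap.fderiv]; rfl
  refine ⟨by rw [hA]; exact A.contDiff, fun x _ => rfl, ?_, ?_, ?_⟩
  · intro x; rw [hd, hd]; exact hdet
  · intro x; rw [hd]; exact hlt
  · intro x; rw [hd]

open Filter Topology in
lemma limT (Ω : Set (Fin 2 → ℝ)) (hΩ : IsOpen Ω) (hb : Bornology.IsBounded Ω) (F : M2)
    (hdet : crs (F.mulVec e1) (F.mulVec e2) = 1) (hlt : nsq (F.mulVec e1) < 1) :
    ∃ (u : (Fin 2 → ℝ) → Fin 2 → ℝ) (K : NNReal), LipschitzWith K u ∧ (∀ x, x ∉ Ω → u x = F.mulVec x) ∧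
      ∀ᵐ x ∂(volume.restrict Ω), nsq (dl u e1 x) = 1 ∧ crs (dl u e1 x) (dl u e2 x) = 1 := by
  set C0 := enorm2 (F.mulVec e2) with hC0
  have hC00 : 0 ≤ C0 := enorm2_nonneg _
  obtain ⟨c, hc, hstep⟩ := global_step (C0 + 1) (by linarith)
  set K := Real.toNNReal (1 + (C0 + 1)) with hK
  set Cn : ℕ → ℝ := fun n => C0 + 1 - (1 / 2) ^ n with hCn
  have hCle : ∀ n, Cn n ≤ C0 + 1 := fun n => by
    simp only [hCn]; have : (0:ℝ) < (1 / 2) ^ n := by positivity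
    linarith
  have hClt : ∀ n, Cn n < Cn (n + 1) := fun n => by
    simp only [hCn, pow_succ]; have : (0:ℝ) < (1 / 2) ^ n := by positivity
    linarith
  have hC0' : Cn 0 = C0 := by simp [hCn]
  let Q : ℕ → ((Fin 2 → ℝ) → Fin 2 → ℝ) × ℝ → Prop := fun n p =>
    Cls (Cn n) Ω F p.1 ∧ 0 < p.2 ∧ p.2 ≤ (1 / 2) ^ n ∧
      ∀ v : (Fin 2 → ℝ) → Fin 2 → ℝ, LipschitzWith K v → (∀ x i, |v x i - p.1 x i| ≤ 2 * p.2) →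
        En Ω p.1 - (1 / 2) ^ n ≤ En Ω v
  let R : ℕ → ((Fin 2 → ℝ) → Fin 2 → ℝ) × ℝ → ((Fin 2 → ℝ) → Fin 2 → ℝ) × ℝ → Prop := fun n p q =>
    (∀ x i, |q.1 x i - p.1 x i| ≤ p.2) ∧ q.2 ≤ p.2 / 2 ∧
      En Ω p.1 + c * ∫ x in Ω, (1 - nsq (dl p.1 e1 x)) ^ 2 ≤ En Ω q.1
  have hchoose : ∀ n u, Cls (Cn n) Ω F u → ∀ η : ℝ, 0 < η → ∃ δ, δ ≤ η ∧ Q n (u, δ) := by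
    intro n u hu η hη
    obtain ⟨δ, hδ, h⟩ := choose_delta (K := K) u (hu.lip (hCle n) (by linarith)) hΩ.measurableSet hb
      ((1 / 2) ^ n) (by positivity)
    refine ⟨min η (min (δ / 2) ((1 / 2) ^ n)), min_le_left _ _, hu, by positivity,
      (min_le_right _ _).trans (min_le_right _ _), fun v hv hvu => h v hv fun x i => (hvu x i).trans ?_⟩
    have : min η (min (δ / 2) ((1 / 2) ^ n)) ≤ δ / 2 := (min_le_right _ _).trans (min_le_left _ _)
    simp only
    linarith
  obtain ⟨f, hQ, hR⟩ := dep_seq Q R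
    (by
      obtain ⟨δ, -, h⟩ := hchoose 0 (fun x => F.mulVec x) (hC0' ▸ Cls_lin Ω F hdet hlt) 1 one_pos
      exact ⟨_, h⟩)
    (by
      rintro n ⟨u, δ⟩ ⟨hu, hδ, hδn, hv⟩
      obtain ⟨u', hu', hd, hE⟩ := hstep _ _ (hClt n) (hCle _) Ω F u hΩ hb hu δ hδ
      obtain ⟨δ', hδ', hQ'⟩ := hchoose (n + 1) u' hu' (δ / 2) (half_pos hδ)
      refine ⟨(u', δ'), hQ', hd, hδ', ?_⟩
      simp only [En, hu.dl, hu'.dl]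
      exact hE)
  have hL : ∀ n, LipschitzWith K (f n).1 := fun n => (hQ n).1.lip (hCle n) (by linarith)
  have hclose : ∀ k n x i, |(f (n + k)).1 x i - (f n).1 x i| ≤ 2 * (f n).2 := by
    intro k
    induction k with
    | zero => intro n x i; simpa using (hQ n).2.1.le
    | succ k ih =>
      intro n x i
      have h1 := ih (n + 1) x i
      have h2 := (hR n).1 x i
      have h3 := (hR n).2.1
      have e : n + (k + 1) = n + 1 + k := by ring
      rw [e]
      have := abs_sub_le ((f (n + 1 + k)).1 x i) ((f (n + 1)).1 x i) ((f n).1 x i)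
      linarith
  have hδ0 : Tendsto (fun n => 2 * (f n).2) atTop (𝓝 0) := by
    have h1 : Tendsto (fun n : ℕ => ((1:ℝ) / 2) ^ n) atTop (𝓝 0) :=
      tendsto_pow_atTop_nhds_zero_of_lt_one (by norm_num) (by norm_num)
    have := squeeze_zero (fun n => (hQ n).2.1.le) (fun n => (hQ n).2.2.1) h1
    simpa using this.const_mul 2
  have hcau : ∀ x i, ∃ l, Tendsto (fun n => (f n).1 x i) atTop (𝓝 l) := by
    intro x i
    apply cauchySeq_tendsto_of_complete
    refine cauchySeq_of_le_tendsto_0' (fun n => 2 * (f n).2) (fun n m hnm => ?_) hδ0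
    obtain ⟨k, rfl⟩ := Nat.exists_eq_add_of_le hnm
    rw [dist_comm, Real.dist_eq]
    exact hclose k n x i
  choose u hu using hcau
  have hun : ∀ n x i, |u x i - (f n).1 x i| ≤ 2 * (f n).2 := by
    intro n x i
    refine le_of_tendsto ((hu x i).sub_const ((f n).1 x i)).abs ?_
    filter_upwards [eventually_ge_atTop n] with m hm
    obtain ⟨k, rfl⟩ := Nat.exists_eq_add_of_le hm
    exact hclose k n x i
  have hux : ∀ x, Tendsto (fun n => (f n).1 x) atTop (𝓝 (u x)) := fun x => tendsto_pi_nhds.2 (hu x)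
  have huL : LipschitzWith K u := by
    refine LipschitzWith.of_dist_le_mul fun x y => ?_
    exact le_of_tendsto' ((hux x).dist (hux y)) fun n => (hL n).dist_le_mul x y
  refine ⟨u, K, huL, ?_, ?_⟩
  · intro x hx
    exact tendsto_nhds_unique (hux x) (tendsto_const_nhds.congr fun n => ((hQ n).1.off x hx).symm)
  · have hlim : ∀ n x i, |(f n).1 x i - u x i| ≤ 2 * (f n).2 := fun n x i => by
      rw [abs_sub_comm]; exact hun n x i
    have hup : ∀ n, En Ω (f n).1 ≤ En Ω u + (1 / 2) ^ n := fun n => by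
      have := (hQ n).2.2.2 u huL (hun n); linarith
    have hE : Tendsto (fun n => En Ω (f n).1) atTop (𝓝 (En Ω u)) := by
      have h1 : Tendsto (fun n : ℕ => ((1:ℝ) / 2) ^ n) atTop (𝓝 0) :=
        tendsto_pow_atTop_nhds_zero_of_lt_one (by norm_num) (by norm_num)
      have h2 := h1.const_add (En Ω u)
      rw [add_zero] at h2
      have h3 := ((Mx_tendsto (fun n => (f n).1) u hL huL _ hδ0 hlim hΩ.measurableSet hb).const_mul 2).sub_const (En Ω u)
      have e : 2 * En Ω u - En Ω u = En Ω u := by ring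
      rw [e] at h3
      exact tendsto_of_tendsto_of_tendsto_of_le_of_le h3 h2 (fun n => En_ge (hL n) huL hb) hup
    refine limit_id (fun n => (f n).1) u hL huL _ hδ0 hlim hΩ.measurableSet hb ?_ hE ?_
    · intro n x
      rw [(hQ n).1.dl, (hQ n).1.dl]; exact (hQ n).1.det x
    · have h1 := ((hE.comp (tendsto_add_atTop_nat 1)).sub hE).const_mul (1 / c)
      rw [sub_self, mul_zero] at h1
      refine squeeze_zero (fun n => integral_nonneg fun x => sq_nonneg _) (fun n => ?_) h1
      have := (hR n).2.2
      simp only [Function.comp]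
      rw [div_mul_eq_mul_div, one_mul, le_div_iff₀ hc]
      linarith

lemma gm_mulVec (u : (Fin 2 → ℝ) → Fin 2 → ℝ) (x w : Fin 2 → ℝ) :
    (gradMatrix u x).mulVec w = fderiv ℝ u x w := by
  unfold gradMatrix
  rw [← Matrix.toLin'_apply, Matrix.toLin'_toMatrix']; rfl

lemma det_crs (A : M2) : A.det = crs (A.mulVec e1) (A.mulVec e2) := by
  rw [Matrix.det_fin_two]
  simp [crs, e1, e2, Matrix.mulVec, dotProduct, Fin.sum_univ_two]
  ring

lemma gm_congr {u v : (Fin 2 → ℝ) → Fin 2 → ℝ} {x : Fin 2 → ℝ} (h : u =ᶠ[nhds x] v) :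
    gradMatrix u x = gradMatrix v x := by
  unfold gradMatrix; rw [h.fderiv_eq]

lemma enorm2_one_iff (p : Fin 2 → ℝ) : enorm2 p = 1 ↔ nsq p = 1 := by
  rw [← enorm2_sq]
  constructor
  · intro h; rw [h]; norm_num
  · intro h; have := enorm2_nonneg p; nlinarith

/-- matrix as CLM -/
def mclm (F : M2) : (Fin 2 → ℝ) →L[ℝ] (Fin 2 → ℝ) := LinearMap.toContinuousLinearMap F.mulVecLin

lemma mclm_apply (F : M2) (x : Fin 2 → ℝ) : mclm F x = F.mulVec x := rfl

lemma gm_lin (F : M2) (x : Fin 2 → ℝ) : gradMatrix (fun x => F.mulVec x) x = F := by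
  apply Matrix.ext_of_mulVec_single
  intro i
  rw [gm_mulVec]
  have : (fun x => F.mulVec x) = mclm F := rfl
  rw [this, ContinuousLinearMap.fderiv]; rfl

lemma ae_comp_rot (T : M2) (hT : T.det = 1) (P : (Fin 2 → ℝ) → Prop) (h : ∀ᵐ x, P x) :
    ∀ᵐ x, P (T.mulVec x) := by
  have h1 := Real.map_matrix_volume_pi_eq_smul_volume_pi (M := T) (by rw [hT]; norm_num)
  rw [hT] at h1
  simp only [inv_one, abs_one, ENNReal.ofReal_one, one_smul] at h1
  rw [← h1] at h
  have hm : AEMeasurable (fun x => (Matrix.toLin' T) x) (volume : Measure (Fin 2 → ℝ)) := by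
    have : Continuous fun x => (Matrix.toLin' T) x := (mclm T).continuous
    exact this.measurable.aemeasurable
  exact ae_of_ae_map hm h

lemma genT (s : Fin 2 → ℝ) (hs : enorm2 s = 1) (Ω : Set (Fin 2 → ℝ)) (hΩ : IsOpen Ω)
    (hb : Bornology.IsBounded Ω) (F : M2) (hF : F ∈ calN s) :
    ∃ (u : (Fin 2 → ℝ) → Fin 2 → ℝ) (K : NNReal), LipschitzWith K u ∧ (∀ x, x ∉ Ω → u x = F.mulVec x) ∧
      ∀ᵐ x, x ∈ Ω → gradMatrix u x ∈ calM s := by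
  obtain ⟨hdet, hle⟩ := hF
  by_cases heq : enorm2 (F.mulVec s) = 1
  · refine ⟨fun x => F.mulVec x, _, (mclm F).lipschitz, fun _ _ => rfl, ae_of_all _ fun x _ => ?_⟩
    rw [gm_lin]; exact ⟨hdet, heq⟩
  have hlt : enorm2 (F.mulVec s) < 1 := lt_of_le_of_ne hle heq
  have hs1 : s 0 ^ 2 + s 1 ^ 2 = 1 := (enorm2_one_iff s).1 hs
  let R : M2 := !![s 0, -s 1; s 1, s 0]
  let T : M2 := !![s 0, s 1; -s 1, s 0]
  have hRd : R.det = 1 := by simp [R, Matrix.det_fin_two]; linarith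
  have hTd : T.det = 1 := by simp [T, Matrix.det_fin_two]; linarith
  have hRT : R * T = 1 := by
    ext i j; fin_cases i <;> fin_cases j <;> simp [R, T, Matrix.mul_apply, Fin.sum_univ_two] <;> linarith
  have hTR : T * R = 1 := by
    ext i j; fin_cases i <;> fin_cases j <;> simp [R, T, Matrix.mul_apply, Fin.sum_univ_two] <;> linarith
  have hRe : R.mulVec e1 = s := by
    ext i; fin_cases i <;> simp [R, e1]
  have hTs : T.mulVec s = e1 := by
    rw [← hRe, Matrix.mulVec_mulVec, hTR, Matrix.one_mulVec]
  set Ω' : Set (Fin 2 → ℝ) := {y | R.mulVec y ∈ Ω} with hΩ'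
  have hΩo : IsOpen Ω' := hΩ.preimage (mclm R).continuous
  have hΩb : Bornology.IsBounded Ω' := by
    refine ((mclm T).lipschitz.isBounded_image hb).subset ?_
    intro y hy
    refine ⟨R.mulVec y, hy, ?_⟩
    rw [mclm_apply, Matrix.mulVec_mulVec, hTR, Matrix.one_mulVec]
  obtain ⟨u', K, hL, hoff, hae⟩ := limT Ω' hΩo hΩb (F * R)
    (by rw [← det_crs, Matrix.det_mul, hdet, hRd, one_mul])
    (by
      rw [← Matrix.mulVec_mulVec, hRe, ← enorm2_sq]
      have := enorm2_nonneg (F.mulVec s)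
      nlinarith)
  refine ⟨fun x => u' (mclm T x), _, hL.comp (mclm T).lipschitz, ?_, ?_⟩
  · intro x hx
    have : mclm T x ∉ Ω' := by
      simp only [hΩ', Set.mem_ofPred_eq, mclm_apply, Matrix.mulVec_mulVec, hRT, Matrix.one_mulVec]
      exact hx
    beta_reduce
    rw [hoff _ this, mclm_apply, Matrix.mulVec_mulVec, mul_assoc, hRT, mul_one]
  · rw [ae_restrict_iff' hΩo.measurableSet] at hae
    have h2 := ae_comp_rot T hTd _ (hae.and hL.ae_differentiableAt)
    filter_upwards [h2] with x hx hxΩ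
    have hm : T.mulVec x ∈ Ω' := by
      simp only [hΩ', Set.mem_ofPred_eq, Matrix.mulVec_mulVec, hRT, Matrix.one_mulVec]
      exact hxΩ
    obtain ⟨hx1, hd⟩ := hx
    obtain ⟨ha, hc⟩ := hx1 hm
    rw [dl_eq hd] at ha
    rw [dl_eq hd, dl_eq hd] at hc
    have hgm : gradMatrix (fun x => u' (mclm T x)) x = gradMatrix u' (T.mulVec x) * T := by
      apply Matrix.ext_of_mulVec_single
      intro i
      rw [gm_mulVec, ← Matrix.mulVec_mulVec, gm_mulVec]
      have hh : HasFDerivAt (fun x => u' (mclm T x)) ((fderiv ℝ u' (T.mulVec x)).comp (mclm T)) x :=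
        HasFDerivAt.comp x (g := u') (f := mclm T) hd.hasFDerivAt (mclm T).hasFDerivAt
      rw [hh.fderiv]; rfl
    rw [hgm]
    constructor
    · rw [Matrix.det_mul, hTd, mul_one, det_crs, gm_mulVec, gm_mulVec]; exact hc
    · rw [← Matrix.mulVec_mulVec, hTs, gm_mulVec, enorm2_one_iff]; exact ha

lemma disc_bounded : Bornology.IsBounded {x : Fin 2 → ℝ | enorm2 x < 1} := by
  refine (Metric.isBounded_closedBall (x := (0 : Fin 2 → ℝ)) (r := 1)).subset ?_
  intro x hx
  rw [Metric.mem_closedBall, dist_zero_right, pi_norm_le_iff_of_nonneg (by norm_num)]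
  intro i
  exact (abs_le_enorm2 x i).trans (le_of_lt hx)

lemma backward (s s' : Fin 2 → ℝ) (hs : enorm2 s = 1) (hs' : enorm2 s' = 1) (F : M2)
    (hF : F ∈ calN s ∩ calN s') :
    ∃ (u : (Fin 2 → ℝ) → Fin 2 → ℝ) (K : NNReal), LipschitzWith K u ∧
      (∀ x, enorm2 x = 1 → u x = F.mulVec x) ∧
      (∀ᵐ x, (enorm2 x < 1 ∧ 0 < x 1) → gradMatrix u x ∈ calM s) ∧
      (∀ᵐ x, (enorm2 x < 1 ∧ x 1 < 0) → gradMatrix u x ∈ calM s') := by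
  set Ω1 : Set (Fin 2 → ℝ) := {x | enorm2 x < 1 ∧ 0 < x 1} with h1
  set Ω2 : Set (Fin 2 → ℝ) := {x | enorm2 x < 1 ∧ x 1 < 0} with h2
  have o1 : IsOpen Ω1 := (isOpen_lt continuous_enorm2 continuous_const).inter
    (isOpen_lt continuous_const (continuous_apply 1))
  have o2 : IsOpen Ω2 := (isOpen_lt continuous_enorm2 continuous_const).inter
    (isOpen_lt (continuous_apply 1) continuous_const)
  obtain ⟨u1, K1, L1, off1, ae1⟩ := genT s hs Ω1 o1 (disc_bounded.subset fun x hx => hx.1) F hF.1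
  obtain ⟨u2, K2, L2, off2, ae2⟩ := genT s' hs' Ω2 o2 (disc_bounded.subset fun x hx => hx.1) F hF.2
  refine ⟨fun x => u1 x + u2 x - mclm F x, _, (L1.add L2).sub (mclm F).lipschitz, ?_, ?_, ?_⟩
  · intro x hx
    have n1 : x ∉ Ω1 := fun h => by have := h.1; linarith
    have n2 : x ∉ Ω2 := fun h => by have := h.1; linarith
    simp only [off1 x n1, off2 x n2, mclm_apply]; simp
  · filter_upwards [ae1] with x hx hxΩ
    rw [gm_congr (v := u1)]
    · exact hx hxΩ
    · filter_upwards [o1.mem_nhds hxΩ] with y hy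
      have n2 : y ∉ Ω2 := fun h => by have := h.2; have := hy.2; linarith
      rw [off2 y n2, mclm_apply, add_sub_cancel_right]
  · filter_upwards [ae2] with x hx hxΩ
    rw [gm_congr (v := u2)]
    · exact hx hxΩ
    · filter_upwards [o2.mem_nhds hxΩ] with y hy
      have n2 : y ∉ Ω1 := fun h => by have := h.2; have := hy.2; linarith
      rw [off1 y n2, mclm_apply, add_sub_cancel_left]

lemma lip_trans {K : NNReal} {f : (Fin 2 → ℝ) → ℝ} (hf : LipschitzWith K f) (c : Fin 2 → ℝ) :
    LipschitzWith K (fun x => f (x + c)) := by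
  refine LipschitzWith.of_dist_le_mul fun x y => ?_
  have := hf.dist_le_mul (x + c) (y + c)
  rwa [dist_add_right] at this

open Filter Topology in
/-- one-sided mean value inequality for Lipschitz functions, a.e. bound on derivative -/
lemma mv_ineq {K : NNReal} (f : (Fin 2 → ℝ) → ℝ) (hf : LipschitzWith K f) (O : Set (Fin 2 → ℝ))
    (s z : Fin 2 → ℝ) (M l r0 : ℝ) (hl : 0 ≤ l) (hr0 : 0 < r0)
    (hae : ∀ᵐ x, x ∈ O → lineDeriv ℝ f x s ≤ M)
    (hO : ∀ t, 0 ≤ t → t ≤ l → ∀ x ∈ Metric.closedBall z r0, x + t • s ∈ O) :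
    f (z + l • s) - f z ≤ M * l := by
  have key : ∀ r, 0 < r → r ≤ r0 → f (z + l • s) - f z ≤ M * l + 2 * K * r := by
    intro r hr hrr
    set B := Metric.closedBall z r with hB
    have hBc : IsCompact B := isCompact_closedBall z r
    have hBm : MeasurableSet B := hBc.isClosed.measurableSet
    have hBf : volume B < ⊤ := hBc.measure_lt_top
    have hBp : 0 < volume.real B := by
      rw [Measure.real, ENNReal.toReal_pos_iff]
      exact ⟨Metric.measure_closedBall_pos _ _ hr, hBf⟩
    set h : ℝ → ℝ := fun t => ∫ x in B, f (x + t • s) with hh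
    have hfc := hf.continuous
    have hi : ∀ t : ℝ, IntegrableOn (fun x => f (x + t • s)) B := fun t =>
      (lip_trans hf (t • s)).continuous.continuousOn.integrableOn_compact hBc
    have hcont : Continuous h := by
      refine continuous_parametric_integral_of_continuous (f := fun (t : ℝ) x => f (x + t • s)) ?_ hBc
      exact hfc.comp (by fun_prop)
    have hslope : ∀ t, 0 ≤ t → t ≤ l → ∀ q, M * volume.real B < q →
        ∃ᶠ y in 𝓝[>] t, slope h t y < q := by
      intro t ht0 htl q hq
      have hft : LipschitzWith K (fun x => f (x + t • s)) := lip_trans hf (t • s)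
      have hT := hft.integral_inv_smul_sub_mul_tendsto_integral_lineDeriv_mul (μ := volume)
        (g := B.indicator fun _ => (1:ℝ)) ((integrable_indicator_iff hBm).2 (by simp [hBf])) s
      have hD : ∫ x, lineDeriv ℝ (fun x => f (x + t • s)) x s * B.indicator (fun _ => (1:ℝ)) x
          ≤ M * volume.real B := by
        have e : ∀ x, lineDeriv ℝ (fun x => f (x + t • s)) x s * B.indicator (fun _ => (1:ℝ)) x =
            B.indicator (fun x => lineDeriv ℝ (fun x => f (x + t • s)) x s) x := by
          intro x; by_cases hx : x ∈ B <;> simp [hx]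
        simp_rw [e]
        rw [integral_indicator hBm]
        have e2 : M * volume.real B = ∫ x in B, M := by simp [mul_comm]
        rw [e2]
        have hm : Measurable fun x => lineDeriv ℝ (fun x => f (x + t • s)) x s :=
          measurable_lineDeriv hft.continuous
        refine setIntegral_mono_ae_restrict ?_ (by simp [hBf]) ?_
        · exact Measure.integrableOn_of_bounded hBf.ne hm.aestronglyMeasurable (M := K * ‖s‖)
            (ae_of_all _ fun x => norm_lineDeriv_le_of_lipschitz ℝ hft)
        · have := (measurePreserving_add_right (volume : Measure (Fin 2 → ℝ)) (t • s)).quasiMeasurePreserving.ae hae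
          refine (ae_restrict_iff' hBm).2 ?_
          filter_upwards [this] with x hx hxB
          have hxO := hx (hO t ht0 htl x (Metric.closedBall_subset_closedBall hrr hxB))
          have e3 : lineDeriv ℝ (fun x => f (x + t • s)) x s = lineDeriv ℝ f (x + t • s) s := by
            simp only [lineDeriv, add_right_comm]
          rw [e3]; exact hxO
      have hev := hT.eventually_lt_const (hD.trans_lt hq)
      have hmap : Tendsto (fun y => y - t) (𝓝[>] t) (𝓝[>] 0) := by
        have : Tendsto (fun y => y - t) (𝓝 t) (𝓝 (t - t)) := tendsto_id.sub_const t
        rw [sub_self] at this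
        refine tendsto_nhdsWithin_of_tendsto_nhds_of_eventually_within _ (this.mono_left nhdsWithin_le_nhds) ?_
        filter_upwards [self_mem_nhdsWithin] with y hy
        exact sub_pos.2 (Set.mem_Ioi.1 hy)
      apply Eventually.frequently
      filter_upwards [hmap.eventually hev] with y hy
      refine lt_of_eq_of_lt ?_ hy
      rw [slope_def_field, div_eq_inv_mul]
      simp only [hh]
      rw [← integral_sub (hi y) (hi t), ← integral_const_mul, ← integral_indicator hBm]
      congr 1; ext x
      by_cases hx : x ∈ B
      · simp only [hx, indicator_of_mem, mul_one, smul_eq_mul]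
        congr 3
        rw [add_assoc, ← add_smul, sub_add_cancel]
      · simp [hx]
    have hfin := image_le_of_liminf_slope_right_le_deriv_boundary (f := h) (a := 0) (b := l)
      hcont.continuousOn (B := fun t => h 0 + M * volume.real B * t) (B' := fun _ => M * volume.real B)
      (by simp) (by fun_prop)
      (fun x _ => by
        have := ((hasDerivAt_id x).const_mul (M * volume.real B)).const_add (h 0)
        simpa using this.hasDerivWithinAt)
      (fun t ht q hq => hslope t ht.1 ht.2.le q hq) (right_mem_Icc.2 hl)
    have hlow : (f (z + l • s) - f z - 2 * K * r) * volume.real B ≤ h l - h 0 := by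
      have e2 : (f (z + l • s) - f z - 2 * K * r) * volume.real B
          = ∫ x in B, (f (z + l • s) - f z - 2 * K * r) := by simp [mul_comm]
      rw [e2]
      simp only [hh]
      rw [← integral_sub (hi l) (hi 0)]
      refine setIntegral_mono_on (by simp [hBf]) ((hi l).sub (hi 0)) hBm fun x hx => ?_
      have hx' : dist x z ≤ r := hx
      have a1 := hf.dist_le_mul (x + l • s) (z + l • s)
      have a2 := hf.dist_le_mul x z
      rw [dist_add_right] at a1
      have a3 : (K:ℝ) * dist x z ≤ K * r := by gcongr
      rw [Real.dist_eq] at a1 a2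
      simp only [zero_smul, add_zero]
      have b1 := (abs_le.1 (a1.trans a3)).1
      have b2 := (abs_le.1 (a2.trans a3)).2
      linarith
    have : (f (z + l • s) - f z - 2 * K * r) * volume.real B ≤ (M * l) * volume.real B := by
      linarith
    have := le_of_mul_le_mul_right this hBp
    linarith
  by_contra hcon
  push Not at hcon
  set d := f (z + l • s) - f z - M * l with hd
  have hd0 : 0 < d := by linarith
  have hK : (0:ℝ) ≤ K := K.2
  have := key (min r0 (d / (2 * (2 * K + 1)))) (by positivity) (min_le_left _ _)
  have h2 : 2 * (K:ℝ) * min r0 (d / (2 * (2 * K + 1))) ≤ 2 * K * (d / (2 * (2 * K + 1))) := by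
    gcongr; exact min_le_right _ _
  have h3 : 2 * (K:ℝ) * (d / (2 * (2 * K + 1))) ≤ d / 2 := by
    rw [mul_div_assoc', div_le_div_iff₀ (by positivity) (by norm_num)]; nlinarith
  linarith

open Filter Topology in
/-- Null Lagrangian property for Lipschitz functions with compact support. -/
lemma null_lagr {K1 K2 : NNReal} (f g : (Fin 2 → ℝ) → ℝ) (hf : LipschitzWith K1 f) (hg : LipschitzWith K2 g)
    (hfc : HasCompactSupport f) (hgc : HasCompactSupport g) (a b : Fin 2 → ℝ)
    (ig : Integrable fun x => lineDeriv ℝ g x b) (if' : Integrable fun x => lineDeriv ℝ f x (-b)) :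
    ∫ x, lineDeriv ℝ f x a * lineDeriv ℝ g x b = ∫ x, lineDeriv ℝ g x (-a) * lineDeriv ℝ f x (-b) := by
  have t1 := hf.integral_inv_smul_sub_mul_tendsto_integral_lineDeriv_mul (μ := volume) ig a
  have t2 := hg.integral_inv_smul_sub_mul_tendsto_integral_lineDeriv_mul (μ := volume) if' (-a)
  refine tendsto_nhds_unique t1 (t2.congr fun t => ?_)
  have hft : LipschitzWith K1 (fun x => f (x + t • a)) := lip_trans hf (t • a)
  have hgt : LipschitzWith K2 (fun x => g (x + t • (-a))) := lip_trans hg (t • (-a))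
  have hgtc : HasCompactSupport (fun x => g (x + t • (-a))) :=
    hgc.comp_homeomorph (Homeomorph.addRight (t • (-a)))
  have hftc : HasCompactSupport (fun x => f (x + t • a)) :=
    hfc.comp_homeomorph (Homeomorph.addRight (t • a))
  -- integration by parts for both parts
  have p1 := hg.integral_lineDeriv_mul_eq (μ := volume) hft hftc b
  have p2 := hg.integral_lineDeriv_mul_eq (μ := volume) hf hfc b
  have e3 : ∀ x, lineDeriv ℝ (fun x => f (x + t • a)) x (-b) = lineDeriv ℝ f (x + t • a) (-b) := by
    intro x; simp only [lineDeriv, add_right_comm]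
  have tr : ∫ x, lineDeriv ℝ (fun x => f (x + t • a)) x (-b) * g x
      = ∫ x, lineDeriv ℝ f x (-b) * g (x + t • (-a)) := by
    rw [← integral_add_right_eq_self (fun x => lineDeriv ℝ f x (-b) * g (x + t • (-a))) (t • a)]
    congr 1; ext x
    rw [e3]; simp
  obtain ⟨Cf, hCf⟩ : ∃ C, ∀ x, ‖f x‖ ≤ C := hf.continuous.bounded_above_of_compact_support hfc
  obtain ⟨Cg, hCg⟩ : ∃ C, ∀ x, ‖g x‖ ≤ C := hg.continuous.bounded_above_of_compact_support hgc
  have i1 : Integrable fun x => lineDeriv ℝ g x b * f (x + t • a) :=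
    ig.mul_bdd (c := Cf) hft.continuous.aestronglyMeasurable (ae_of_all _ fun x => hCf _)
  have i2 : Integrable fun x => lineDeriv ℝ g x b * f x :=
    ig.mul_bdd (c := Cf) hf.continuous.aestronglyMeasurable (ae_of_all _ fun x => hCf _)
  have i3 : Integrable fun x => lineDeriv ℝ f x (-b) * g (x + t • (-a)) :=
    if'.mul_bdd (c := Cg) hgt.continuous.aestronglyMeasurable (ae_of_all _ fun x => hCg _)
  have i4 : Integrable fun x => lineDeriv ℝ f x (-b) * g x :=
    if'.mul_bdd (c := Cg) hg.continuous.aestronglyMeasurable (ae_of_all _ fun x => hCg _)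
  calc ∫ x, (t⁻¹ • (g (x + t • (-a)) - g x)) * lineDeriv ℝ f x (-b)
      = t⁻¹ * ((∫ x, lineDeriv ℝ f x (-b) * g (x + t • (-a))) - ∫ x, lineDeriv ℝ f x (-b) * g x) := by
        rw [← integral_sub i3 i4, ← integral_const_mul]
        congr 1; ext x; simp only [smul_eq_mul]; ring
    _ = t⁻¹ * ((∫ x, lineDeriv ℝ g x b * f (x + t • a)) - ∫ x, lineDeriv ℝ g x b * f x) := by
        rw [p1, p2, tr]
    _ = _ := by
        rw [← integral_sub i1 i2, ← integral_const_mul]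
        congr 1; ext x; simp only [smul_eq_mul]; ring

lemma ext_zero {K : NNReal} (w : (Fin 2 → ℝ) → Fin 2 → ℝ) (hw : LipschitzOnWith K w {x | enorm2 x ≤ 1})
    (h0 : ∀ x, enorm2 x = 1 → w x = 0) :
    ∃ φ : (Fin 2 → ℝ) → Fin 2 → ℝ, LipschitzWith K φ ∧ (∀ x, enorm2 x ≤ 1 → φ x = w x) ∧
      ∀ x, 1 ≤ enorm2 x → φ x = 0 := by
  classical
  let φ : (Fin 2 → ℝ) → Fin 2 → ℝ := fun x => if enorm2 x ≤ 1 then w x else 0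
  have hin : ∀ x, enorm2 x ≤ 1 → φ x = w x := fun x hx => if_pos hx
  have hout : ∀ x, 1 ≤ enorm2 x → φ x = 0 := by
    intro x hx
    by_cases h : enorm2 x ≤ 1
    · rw [hin x h, h0 x (le_antisymm h hx)]
    · exact if_neg h
  have cross : ∀ x y, enorm2 x ≤ 1 → 1 ≤ enorm2 y → dist (φ x) (φ y) ≤ K * dist x y := by
    intro x y hx hy
    have hc : ContinuousOn (fun t : ℝ => enorm2 (AffineMap.lineMap x y t)) (Icc 0 1) :=
      (continuous_enorm2.comp (AffineMap.lineMap_continuous)).continuousOn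
    have := intermediate_value_Icc (zero_le_one) hc
    obtain ⟨t, ht, htz⟩ := this (show (1:ℝ) ∈ Icc _ _ by simpa using ⟨hx, hy⟩)
    set z := AffineMap.lineMap x y t with hz
    have hd : dist x z ≤ dist x y := by
      rw [hz, dist_left_lineMap, Real.norm_eq_abs, abs_of_nonneg ht.1]
      exact mul_le_of_le_one_left dist_nonneg ht.2
    have htz' : enorm2 z = 1 := htz
    rw [hout y hy, ← hout z htz'.ge, hin x hx, hin z htz'.le]
    exact (hw.dist_le_mul x hx z htz'.le).trans (by gcongr)
  refine ⟨φ, LipschitzWith.of_dist_le_mul fun x y => ?_, hin, hout⟩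
  rcases le_total (enorm2 x) 1 with hx | hx <;> rcases le_total (enorm2 y) 1 with hy | hy
  · rw [hin x hx, hin y hy]; exact hw.dist_le_mul x hx y hy
  · exact cross x y hx hy
  · rw [dist_comm (φ x), dist_comm x]; exact cross y x hy hx
  · rw [hout x hx, hout y hy, dist_self]; positivity

lemma sphere_null : ∀ᵐ x : Fin 2 → ℝ, enorm2 x ≠ 1 := by
  have h : (volume : Measure (EuclideanSpace ℝ (Fin 2))) (Metric.sphere 0 1) = 0 :=
    Measure.addHaar_sphere_of_ne_zero _ _ one_ne_zero
  have h2 := (PiLp.volume_preserving_toLp (Fin 2)).quasiMeasurePreserving.ae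
    (p := fun y => y ∉ Metric.sphere (0 : EuclideanSpace ℝ (Fin 2)) 1) (measure_eq_zero_iff_ae_notMem.1 h)
  filter_upwards [h2] with x hx hx1
  apply hx
  rw [mem_sphere_zero_iff_norm, ← enorm2_eq_norm, hx1]

lemma axis_null : ∀ᵐ x : Fin 2 → ℝ, x 1 ≠ 0 :=
  measure_eq_zero_iff_ae_notMem.1 (Measure.pi_hyperplane (fun _ : Fin 2 => (volume : Measure ℝ)) 1 0)

lemma det_one {K : NNReal} (F : M2) (φ : (Fin 2 → ℝ) → Fin 2 → ℝ) (hφ : LipschitzWith K φ)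
    (hout : ∀ x, 1 ≤ enorm2 x → φ x = 0)
    (hdet : ∀ᵐ x, enorm2 x < 1 → crs (F.mulVec e1 + dl φ e1 x) (F.mulVec e2 + dl φ e2 x) = 1) :
    F.det = 1 := by
  set D : Set (Fin 2 → ℝ) := {x | enorm2 x < 1} with hD
  have hDo : IsOpen D := isOpen_lt continuous_enorm2 continuous_const
  have hDm := hDo.measurableSet
  have hDb : Bornology.IsBounded D := disc_bounded
  have hcs : ∀ i, HasCompactSupport fun x => φ x i := fun i => by
    refine HasCompactSupport.intro (K := closure D) hDb.isCompact_closure fun x hx => ?_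
    have : x ∉ D := fun h => hx (subset_closure h)
    rw [hout x (not_lt.1 this)]; rfl
  have hzero : ∀ w x, 1 < enorm2 x → dl φ w x = 0 := by
    intro w x hx
    have : φ =ᶠ[nhds x] fun _ => 0 := by
      filter_upwards [(isOpen_lt continuous_const continuous_enorm2).mem_nhds hx] with y hy
      exact hout y (le_of_lt hy)
    have hd : DifferentiableAt ℝ φ x := (differentiableAt_const (0 : Fin 2 → ℝ)).congr_of_eventuallyEq this
    rw [dl_eq hd, this.fderiv_eq]; simp
  have hz : ∀ᵐ x, x ∉ D → ∀ w, dl φ w x = 0 := by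
    filter_upwards [sphere_null] with x hx hxD w
    exact hzero w x (lt_of_le_of_ne (not_lt.1 hxD) (Ne.symm hx))
  -- integrability
  have int_of : ∀ g : (Fin 2 → ℝ) → ℝ, BM g → (∀ᵐ x, x ∉ D → g x = 0) → Integrable g := by
    intro g hg h
    rw [← integrableOn_iff_integrable_of_support_subset (s := Set.univ) (by simp)]
    have h1 : IntegrableOn g D := hg.int hDb
    have h2 := (integrable_indicator_iff hDm).2 h1
    rw [integrableOn_univ]
    refine h2.congr ?_
    filter_upwards [h] with x hx
    by_cases hxD : x ∈ D
    · simp [hxD]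
    · simp [hxD, hx hxD]
  have idl : ∀ w i, Integrable fun x => dl φ w x i := fun w i => by
    refine int_of _ (dl_BM hφ w i) ?_
    filter_upwards [hz] with x hx hxD
    rw [hx hxD w]; rfl
  have imul : ∀ w i w' j, Integrable fun x => dl φ w x i * dl φ w' x j := fun w i w' j => by
    refine int_of _ ((dl_BM hφ w i).mul (dl_BM hφ w' j)) ?_
    filter_upwards [hz] with x hx hxD
    rw [hx hxD w]; simp
  have dneg : ∀ w x i, dl φ (-w) x i = - dl φ w x i := fun w x i => lineDeriv_neg
  have I1 : ∀ w i, ∫ x, dl φ w x i = 0 := by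
    intro w i
    have := (LipschitzWith.const (1:ℝ) (α := Fin 2 → ℝ)).integral_lineDeriv_mul_eq (μ := volume)
      (lip_comp hφ i) (hcs i) (-w)
    simp only [neg_neg, mul_one] at this
    have e : ∀ x, lineDeriv ℝ (fun _ : Fin 2 → ℝ => (1:ℝ)) x (-w) = 0 := fun x => by
      simp [lineDeriv]
    simp only [e, zero_mul, integral_zero] at this
    exact this.symm
  have I2 : ∫ x, dl φ e1 x 0 * dl φ e2 x 1 = ∫ x, dl φ e1 x 1 * dl φ e2 x 0 := by
    have := null_lagr (fun x => φ x 0) (fun x => φ x 1) (lip_comp hφ 0) (lip_comp hφ 1) (hcs 0) (hcs 1)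
      e1 e2 (idl e2 1) (idl (-e2) 0)
    refine this.trans ?_
    congr 1; ext x
    have a := dneg e1 x 1
    have b := dneg e2 x 0
    unfold dl at a b ⊢
    rw [a, b]; ring
  set a := F.mulVec e1 with ha
  set b := F.mulVec e2 with hb
  have hF : F.det = crs a b := det_crs F
  -- the total integral of crs - det F
  have htot : ∫ x, (crs (a + dl φ e1 x) (b + dl φ e2 x) - F.det) = 0 := by
    have e : ∀ x, crs (a + dl φ e1 x) (b + dl φ e2 x) - F.det =
        ((a 0 * dl φ e2 x 1 - a 1 * dl φ e2 x 0) + (b 1 * dl φ e1 x 0 - b 0 * dl φ e1 x 1))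
        + (dl φ e1 x 0 * dl φ e2 x 1 - dl φ e1 x 1 * dl φ e2 x 0) := by
      intro x; rw [hF]; simp only [crs, Pi.add_apply]; ring
    simp_rw [e]
    have j1 := (idl e2 1).const_mul (a 0)
    have j2 := (idl e2 0).const_mul (a 1)
    have j3 := (idl e1 0).const_mul (b 1)
    have j4 := (idl e1 1).const_mul (b 0)
    have j5 := imul e1 0 e2 1
    have j6 := imul e1 1 e2 0
    have k1 : Integrable fun x => a 0 * dl φ e2 x 1 - a 1 * dl φ e2 x 0 := j1.sub j2
    have k2 : Integrable fun x => b 1 * dl φ e1 x 0 - b 0 * dl φ e1 x 1 := j3.sub j4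
    have k3 : Integrable fun x => dl φ e1 x 0 * dl φ e2 x 1 - dl φ e1 x 1 * dl φ e2 x 0 := j5.sub j6
    have k4 : Integrable fun x => (a 0 * dl φ e2 x 1 - a 1 * dl φ e2 x 0)
      + (b 1 * dl φ e1 x 0 - b 0 * dl φ e1 x 1) := k1.add k2
    rw [integral_add k4 k3, integral_add k1 k2,
      integral_sub j1 j2, integral_sub j3 j4, integral_sub j5 j6, I2]
    simp only [integral_const_mul, I1]
    ring
  have hval : ∫ x, (crs (a + dl φ e1 x) (b + dl φ e2 x) - F.det)
      = ∫ x, D.indicator (fun _ => 1 - F.det) x := by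
    refine integral_congr_ae ?_
    filter_upwards [hdet, hz] with x h1 h2
    by_cases hx : x ∈ D
    · rw [h1 hx]; simp [hx]
    · rw [h2 hx, h2 hx]; simp [hx, hF]
  rw [htot, integral_indicator hDm] at hval
  simp only [integral_const, smul_eq_mul] at hval
  have hpos : 0 < volume.real D := by
    rw [Measure.real, ENNReal.toReal_pos_iff]
    refine ⟨hDo.measure_pos _ ⟨0, ?_⟩, hDb.measure_lt_top⟩
    simp [hD, enorm2]
  have : volume.real D * (1 - F.det) = 0 := by simpa using hval.symm
  rcases mul_eq_zero.1 this with h | h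
  · exact absurd h hpos.ne'
  · linarith

lemma enorm2_le_norm (p : Fin 2 → ℝ) : enorm2 p ≤ 2 * ‖p‖ := by
  have h1 : |p 0| ≤ ‖p‖ := norm_le_pi_norm p 0
  have h2 : |p 1| ≤ ‖p‖ := norm_le_pi_norm p 1
  linarith [enorm2_le_add p]

lemma norm_le_enorm2 (p : Fin 2 → ℝ) : ‖p‖ ≤ enorm2 p := by
  rw [pi_norm_le_iff_of_nonneg (enorm2_nonneg p)]
  exact abs_le_enorm2 p

/-- length estimate in convex open set -/
lemma length_est {K : NNReal} (U : (Fin 2 → ℝ) → Fin 2 → ℝ) (hU : LipschitzWith K U)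
    (O : Set (Fin 2 → ℝ)) (hO : IsOpen O) (hOc : Convex ℝ O) (s z : Fin 2 → ℝ) (l : ℝ) (hl : 0 < l)
    (hz : z ∈ O) (hz' : z + l • s ∈ O) (hae : ∀ᵐ x, x ∈ O → enorm2 (fderiv ℝ U x s) = 1) :
    enorm2 (U (z + l • s) - U z) ≤ l := by
  set w := U (z + l • s) - U z with hw
  obtain ⟨r1, hr1, hb1⟩ := Metric.isOpen_iff.1 hO z hz
  obtain ⟨r2, hr2, hb2⟩ := Metric.isOpen_iff.1 hO _ hz'
  have hfl : LipschitzWith _ (fun x => U x 0 * w 0 + U x 1 * w 1) :=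
    ((LipschitzWith.of_dist_le_mul (K := K * Real.toNNReal |w 0|) (f := fun x => U x 0 * w 0)
      (fun x y => by
        have := (lip_comp hU 0).dist_le_mul x y
        rw [Real.dist_eq, ← sub_mul, abs_mul]
        rw [Real.dist_eq] at this
        rw [NNReal.coe_mul, Real.coe_toNNReal _ (abs_nonneg _)]
        calc _ ≤ (K * dist x y) * |w 0| := by gcongr
          _ = _ := by ring)).add
    (LipschitzWith.of_dist_le_mul (K := K * Real.toNNReal |w 1|) (f := fun x => U x 1 * w 1)
      (fun x y => by
        have := (lip_comp hU 1).dist_le_mul x y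
        rw [Real.dist_eq, ← sub_mul, abs_mul]
        rw [Real.dist_eq] at this
        rw [NNReal.coe_mul, Real.coe_toNNReal _ (abs_nonneg _)]
        calc _ ≤ (K * dist x y) * |w 1| := by gcongr
          _ = _ := by ring)))
  have := mv_ineq _ hfl O s z (enorm2 w) l (min r1 r2 / 2) hl.le (by positivity) ?_ ?_
  · have h2 : enorm2 w ^ 2 ≤ enorm2 w * l := by
      rw [enorm2_sq]
      refine le_trans (le_of_eq ?_) this
      simp only [nsq, hw, Pi.sub_apply]; ring
    by_contra hcon
    push Not at hcon
    nlinarith [enorm2_nonneg w]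
  · filter_upwards [hae, hU.ae_differentiableAt] with x hx hd hxO
    have hx1 := hx hxO
    have h0 : HasFDerivAt (fun y => U y 0) ((ContinuousLinearMap.proj 0).comp (fderiv ℝ U x)) x :=
      (hasFDerivAt_pi'.1 hd.hasFDerivAt) 0
    have h1 : HasFDerivAt (fun y => U y 1) ((ContinuousLinearMap.proj 1).comp (fderiv ℝ U x)) x :=
      (hasFDerivAt_pi'.1 hd.hasFDerivAt) 1
    have h2 := ((h0.mul_const (w 0)).add (h1.mul_const (w 1))).hasLineDerivAt s
    have h3 := h2.lineDeriv
    refine le_trans (le_of_eq h3) ?_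
    simp only [_root_.add_apply, _root_.smul_apply, ContinuousLinearMap.comp_apply,
      ContinuousLinearMap.proj_apply, smul_eq_mul]
    set d := fderiv ℝ U x s with hd'
    have hn : nsq d = 1 := (enorm2_one_iff d).1 hx1
    apply Real.le_sqrt_of_sq_le
    simp only [nsq] at hn
    have : w 0 ^ 2 + w 1 ^ 2 = (w 0 ^ 2 + w 1 ^ 2) * (d 0 ^ 2 + d 1 ^ 2) := by rw [hn, mul_one]
    rw [this]
    nlinarith [sq_nonneg (w 0 * d 1 - w 1 * d 0)]
  · intro t ht0 htl x hx
    have hxr : dist x z ≤ min r1 r2 / 2 := hx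
    have hm : 0 < min r1 r2 := lt_min hr1 hr2
    have m1 : x ∈ O := hb1 (by rw [Metric.mem_ball]; linarith [min_le_left r1 r2])
    have m2 : x + l • s ∈ O := hb2 (by
      rw [Metric.mem_ball, dist_add_right]; linarith [min_le_right r1 r2])
    have hc := hOc m1 m2 (a := 1 - t / l) (b := t / l) (sub_nonneg.2 ((div_le_one hl).2 htl)) (by positivity) (by ring)
    convert hc using 1
    rw [smul_add, ← add_assoc, ← add_smul, smul_smul, div_mul_cancel₀ _ hl.ne']
    simp

lemma enorm2_lt_one {p : Fin 2 → ℝ} (h : nsq p < 1) : enorm2 p < 1 := by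
  rw [← enorm2_sq] at h
  have := enorm2_nonneg p
  nlinarith

lemma half_convex (σ : ℝ) : Convex ℝ {x : Fin 2 → ℝ | enorm2 x < 1 ∧ 0 < σ * x 1} := by
  intro x hx y hy a b ha hb hab
  refine ⟨?_, ?_⟩
  · have h := enorm2_add_le (a • x) (b • y)
    rw [enorm2_smul, enorm2_smul, abs_of_nonneg ha, abs_of_nonneg hb] at h
    have h1 := hx.1
    have h2 := hy.1
    rcases ha.eq_or_lt with rfl | ha'
    · have : b = 1 := by linarith
      subst this; linarith
    · nlinarith
  · have h1 := hx.2
    have h2 := hy.2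
    simp only [Pi.add_apply, Pi.smul_apply, smul_eq_mul]
    rcases ha.eq_or_lt with rfl | ha'
    · have : b = 1 := by linarith
      subst this; linarith
    · nlinarith [mul_pos ha' h1, mul_nonneg hb h2.le]

lemma stretch_aux {K K' : NNReal} (F : M2) (U φ : (Fin 2 → ℝ) → Fin 2 → ℝ) (hUL : LipschitzWith K' U)
    (hφ : LipschitzWith K φ) (hU : ∀ x, U x = F.mulVec x + φ x) (hout : ∀ x, 1 ≤ enorm2 x → φ x = 0)
    (σ : ℝ) (s P : Fin 2 → ℝ) (hs : nsq s = 1) (hP : nsq P = 1) (hsP : s 0 * P 0 + s 1 * P 1 = 0)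
    (h1 : 0 ≤ σ * s 1) (h2 : 0 ≤ σ * P 1) (h3 : 0 < σ * s 1 + σ * P 1)
    (hae : ∀ᵐ x, (enorm2 x < 1 ∧ 0 < σ * x 1) → enorm2 (fderiv ℝ U x s) = 1) :
    enorm2 (F.mulVec s) ≤ 1 := by
  set O : Set (Fin 2 → ℝ) := {x | enorm2 x < 1 ∧ 0 < σ * x 1} with hO
  have hOo : IsOpen O := (isOpen_lt continuous_enorm2 continuous_const).inter
    (isOpen_lt continuous_const (continuous_const.mul (continuous_apply 1)))
  have hs1 : enorm2 s = 1 := (enorm2_one_iff s).2 hs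
  have hP1 : enorm2 P = 1 := (enorm2_one_iff P).2 hP
  have comb : ∀ a b : ℝ, nsq (a • P + b • s) = a ^ 2 + b ^ 2 := by
    intro a b
    simp only [nsq, Pi.add_apply, Pi.smul_apply, smul_eq_mul] at hs hP ⊢
    linear_combination a ^ 2 * hP + b ^ 2 * hs + 2 * a * b * hsP
  have combO : ∀ a b : ℝ, 0 < a → 0 < b → a ^ 2 + b ^ 2 < 1 → a • P + b • s ∈ O := by
    intro a b ha hb hab
    refine ⟨enorm2_lt_one (by rw [comb]; exact hab), ?_⟩
    simp only [Pi.add_apply, Pi.smul_apply, smul_eq_mul]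
    rcases h1.eq_or_lt with h | h
    · have : 0 < σ * P 1 := by linarith
      nlinarith [mul_pos ha this]
    · nlinarith [mul_pos hb h, mul_nonneg ha.le h2]
  have near : ∀ x y c, 1 ≤ enorm2 y → enorm2 (x - y) ≤ c → enorm2 (φ x) ≤ 2 * (K * c) := by
    intro x y c hy hxy
    have a1 := hφ.dist_le_mul x y
    rw [hout y hy, dist_zero_right, dist_eq_norm] at a1
    have a2 := norm_le_enorm2 (x - y)
    have a3 := enorm2_le_norm (φ x)
    have a4 : (K:ℝ) * ‖x - y‖ ≤ K * c := by gcongr; linarith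
    linarith
  have hK : (0:ℝ) ≤ K := K.2
  have main : ∀ k : ℝ, 0 < k → k < 1 / 2 →
      (1 - k) * enorm2 (F.mulVec s) ≤ (1 - k) + 6 * K * k := by
    intro k hk0 hk
    have hk2 : k ^ 2 < k := by nlinarith
    have hk3 : 0 < k ^ 2 := by positivity
    set z : Fin 2 → ℝ := (1 - k ^ 2) • P + (k ^ 2) • s with hz
    have hz2 : z + (k - k ^ 2) • s = (1 - k ^ 2) • P + k • s := by
      rw [hz, add_assoc, ← add_smul]; congr 2; ring
    have m1 : z ∈ O := combO _ _ (by nlinarith) hk3 (by nlinarith)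
    have m2 : z + (k - k ^ 2) • s ∈ O := by
      rw [hz2]; exact combO _ _ (by nlinarith) hk0 (by nlinarith)
    have hle := length_est U hUL O hOo (half_convex σ) s z (k - k ^ 2) (by linarith) m1 m2 hae
    have n1 : enorm2 (φ z) ≤ 2 * (K * (2 * k ^ 2)) := by
      refine near z P _ hP1.ge ?_
      have e : z - P = (-(k ^ 2)) • P + (k ^ 2) • s := by
        rw [hz]; ext i; simp only [Pi.sub_apply, Pi.add_apply, Pi.smul_apply, smul_eq_mul]; ring
      rw [e]
      refine (enorm2_add_le _ _).trans (le_of_eq ?_)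
      rw [enorm2_smul, enorm2_smul, hs1, hP1, abs_neg, abs_of_pos hk3]; ring
    have n2 : enorm2 (φ (z + (k - k ^ 2) • s)) ≤ 2 * (K * k ^ 2) := by
      set q := √(1 - k ^ 2) with hq
      have hq2 : q ^ 2 = 1 - k ^ 2 := Real.sq_sqrt (by nlinarith)
      have hq0 : 0 ≤ q := Real.sqrt_nonneg _
      have hq1 : q ≤ 1 := by nlinarith
      refine near _ (q • P + k • s) _ ?_ ?_
      · refine ((enorm2_one_iff _).2 ?_).ge
        rw [comb, hq2]; ring
      · rw [hz2]
        have e : (1 - k ^ 2) • P + k • s - (q • P + k • s) = (1 - k ^ 2 - q) • P := by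
          rw [add_sub_add_right_eq_sub, ← sub_smul]
        rw [e, enorm2_smul, hP1, mul_one, abs_le]
        constructor <;> nlinarith
    have e : (k - k ^ 2) • F.mulVec s = (U (z + (k - k ^ 2) • s) - U z)
        + (φ z + (-1 : ℝ) • φ (z + (k - k ^ 2) • s)) := by
      rw [hU, hU, Matrix.mulVec_add, Matrix.mulVec_smul]
      ext i; simp only [Pi.sub_apply, Pi.add_apply, Pi.smul_apply, smul_eq_mul]; ring
    have b1 : (k - k ^ 2) * enorm2 (F.mulVec s) ≤ (k - k ^ 2) + (2 * (K * (2 * k ^ 2)) + 2 * (K * k ^ 2)) := by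
      have c1 := enorm2_smul (k - k ^ 2) (F.mulVec s)
      rw [abs_of_pos (by linarith)] at c1
      rw [← c1, e]
      have c2 := enorm2_add_le (U (z + (k - k ^ 2) • s) - U z) (φ z + (-1 : ℝ) • φ (z + (k - k ^ 2) • s))
      have c3 := enorm2_add_le (φ z) ((-1 : ℝ) • φ (z + (k - k ^ 2) • s))
      rw [enorm2_smul, abs_neg, abs_one, one_mul] at c3
      linarith
    have b2 : k * ((1 - k) * enorm2 (F.mulVec s)) ≤ k * ((1 - k) + 6 * K * k) := by nlinarith
    exact le_of_mul_le_mul_left b2 hk0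
  by_contra hcon
  push Not at hcon
  set a := enorm2 (F.mulVec s) - 1 with ha
  have ha0 : 0 < a := by linarith
  set k := min (1 / 4) (a / (16 * (K + 1))) with hk
  have hk0 : 0 < k := by positivity
  have hk4 : k ≤ 1 / 4 := min_le_left _ _
  have hka : k ≤ a / (16 * (K + 1)) := min_le_right _ _
  rw [le_div_iff₀ (by positivity)] at hka
  have := main k hk0 (by linarith)
  have e : enorm2 (F.mulVec s) = 1 + a := by rw [ha]; ring
  rw [e] at this
  nlinarith

lemma stretch {K K' : NNReal} (F : M2) (U φ : (Fin 2 → ℝ) → Fin 2 → ℝ) (hUL : LipschitzWith K' U)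
    (hφ : LipschitzWith K φ) (hU : ∀ x, U x = F.mulVec x + φ x) (hout : ∀ x, 1 ≤ enorm2 x → φ x = 0)
    (σ : ℝ) (hσ : σ ≠ 0) (s : Fin 2 → ℝ) (hs : enorm2 s = 1)
    (hae : ∀ᵐ x, (enorm2 x < 1 ∧ 0 < σ * x 1) → enorm2 (fderiv ℝ U x s) = 1) :
    enorm2 (F.mulVec s) ≤ 1 := by
  have hs1 : nsq s = 1 := (enorm2_one_iff s).1 hs
  -- sign choice for s
  have hneg : ∀ p : Fin 2 → ℝ, enorm2 (-p) = enorm2 p := by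
    intro p; unfold enorm2; simp
  have main : ∀ s : Fin 2 → ℝ, nsq s = 1 → 0 ≤ σ * s 1 →
      (∀ᵐ x, (enorm2 x < 1 ∧ 0 < σ * x 1) → enorm2 (fderiv ℝ U x s) = 1) →
      enorm2 (F.mulVec s) ≤ 1 := by
    intro s hs h1 hae
    have key : ∀ τ : ℝ, τ ^ 2 = 1 → 0 ≤ σ * (τ * s 0) → enorm2 (F.mulVec s) ≤ 1 := by
      intro τ hτ h2
      refine stretch_aux F U φ hUL hφ hU hout σ s ![-(τ * s 1), τ * s 0] hs ?_ ?_ h1 (by simpa using h2) ?_ hae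
      · simp only [nsq] at hs ⊢
        simp only [Matrix.cons_val_zero, Matrix.cons_val_one]
        linear_combination τ ^ 2 * hs + hτ
      · simp only [Matrix.cons_val_zero, Matrix.cons_val_one]; ring
      · simp only [Matrix.cons_val_one]
        refine lt_of_le_of_ne (add_nonneg h1 h2) fun h => ?_
        have h0 : 0 = σ * s 1 + σ * (τ * s 0) := h
        have a1 : σ * s 1 = 0 := le_antisymm (by linarith) h1
        have a2 : σ * (τ * s 0) = 0 := le_antisymm (by linarith) h2
        have b1 : s 1 = 0 := (mul_eq_zero.1 a1).resolve_left hσ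
        have b2 : τ * s 0 = 0 := (mul_eq_zero.1 a2).resolve_left hσ
        have : τ ^ 2 * s 0 ^ 2 = 0 := by rw [← mul_pow, b2]; norm_num
        rw [hτ] at this
        simp only [nsq, b1] at hs
        nlinarith
    rcases le_total 0 (σ * s 0) with h | h
    · exact key 1 (by norm_num) (by linarith)
    · exact key (-1) (by norm_num) (by linarith)
  rcases le_total 0 (σ * s 1) with h | h
  · exact main s hs1 h hae
  · have := main (-s) (by rw [← hs1]; simp [nsq]) (by simp only [Pi.neg_apply]; linarith)
      (by
        filter_upwards [hae] with x hx hx1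
        rw [map_neg, hneg]; exact hx hx1)
    rwa [Matrix.mulVec_neg, hneg] at this

lemma forward (s s' : Fin 2 → ℝ) (hs : enorm2 s = 1) (hs' : enorm2 s' = 1) (F : M2)
    (u : (Fin 2 → ℝ) → Fin 2 → ℝ) (K : NNReal) (hu : LipschitzOnWith K u {x | enorm2 x ≤ 1})
    (hb : ∀ x, enorm2 x = 1 → u x = F.mulVec x)
    (h1 : ∀ᵐ x, (enorm2 x < 1 ∧ 0 < x 1) → gradMatrix u x ∈ calM s)
    (h2 : ∀ᵐ x, (enorm2 x < 1 ∧ x 1 < 0) → gradMatrix u x ∈ calM s') :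
    F ∈ calN s ∩ calN s' := by
  obtain ⟨φ, hφ, hin, hout⟩ := ext_zero (fun x => u x - mclm F x)
    (hu.sub ((mclm F).lipschitz.lipschitzOnWith)) (fun x hx => by simp only [hb x hx, mclm_apply, sub_self])
  let U : (Fin 2 → ℝ) → Fin 2 → ℝ := fun x => mclm F x + φ x
  have hUL : LipschitzWith _ U := (mclm F).lipschitz.add hφ
  have hU : ∀ x, U x = F.mulVec x + φ x := fun x => rfl
  have hUu : ∀ x, enorm2 x < 1 → U =ᶠ[nhds x] u := by
    intro x hx
    filter_upwards [(isOpen_lt continuous_enorm2 continuous_const).mem_nhds hx] with y hy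
    simp only [U, hin y (le_of_lt hy)]; simp only [add_sub_cancel]
  have hgm : ∀ x, enorm2 x < 1 → gradMatrix u x = gradMatrix U x := fun x hx => (gm_congr (hUu x hx)).symm
  have hdet : F.det = 1 := by
    refine det_one F φ hφ hout ?_
    filter_upwards [h1, h2, axis_null, hφ.ae_differentiableAt] with x a1 a2 a3 hd hx
    have hg : (gradMatrix u x).det = 1 := by
      rcases lt_or_gt_of_ne a3 with h | h
      · exact (a2 ⟨hx, h⟩).1
      · exact (a1 ⟨hx, h⟩).1
    rw [hgm x hx, det_crs, gm_mulVec, gm_mulVec] at hg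
    have hf : HasFDerivAt U (mclm F + fderiv ℝ φ x) x := (mclm F).hasFDerivAt.add hd.hasFDerivAt
    rw [hf.fderiv] at hg
    rw [dl_eq hd, dl_eq hd]
    exact hg
  refine ⟨⟨hdet, ?_⟩, ⟨hdet, ?_⟩⟩
  · refine stretch F U φ hUL hφ hU hout 1 one_ne_zero s hs ?_
    filter_upwards [h1] with x hx hx1
    have := (hx ⟨hx1.1, by linarith [hx1.2]⟩).2
    rwa [hgm x hx1.1, gm_mulVec] at this
  · refine stretch F U φ hUL hφ hU hout (-1) (by norm_num) s' hs' ?_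
    filter_upwards [h2] with x hx hx1
    have := (hx ⟨hx1.1, by linarith [hx1.2]⟩).2
    rwa [hgm x hx1.1, gm_mulVec] at this

/-- Characterization of bicrystal macroscopic strains: F ∈ 𝓝_s ∩ 𝓝_{s′} iff the
differential inclusion with targets 𝓜_s (upper half-ball) and 𝓜_{s′} (lower half-ball)
and boundary values F x admits a Lipschitz solution. -/
theorem stmt16 (s s' : Fin 2 → ℝ) (hs : enorm2 s = 1) (hs' : enorm2 s' = 1)
    (h1 : s' ≠ s) (h2 : s' ≠ -s) (F : M2) :
    F ∈ calN s ∩ calN s' ↔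
      ∃ (u : (Fin 2 → ℝ) → Fin 2 → ℝ) (K : NNReal),
        LipschitzOnWith K u {x : Fin 2 → ℝ | enorm2 x ≤ 1} ∧
        (∀ x : Fin 2 → ℝ, enorm2 x = 1 → u x = F.mulVec x) ∧
        (∀ᵐ x ∂(volume : Measure (Fin 2 → ℝ)), enorm2 x < 1 → DifferentiableAt ℝ u x) ∧
        (∀ᵐ x ∂(volume : Measure (Fin 2 → ℝ)),
          (enorm2 x < 1 ∧ 0 < x 1) → gradMatrix u x ∈ calM s) ∧
        (∀ᵐ x ∂(volume : Measure (Fin 2 → ℝ)),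
          (enorm2 x < 1 ∧ x 1 < 0) → gradMatrix u x ∈ calM s') := by
  constructor
  · intro hF
    obtain ⟨u, K, hL, hb, a1, a2⟩ := backward s s' hs hs' F hF
    refine ⟨u, K, hL.lipschitzOnWith, hb, ?_, a1, a2⟩
    filter_upwards [hL.ae_differentiableAt] with x hx _ using hx
  · rintro ⟨u, K, hL, hb, -, a1, a2⟩
    exact forward s s' hs hs' F u K hL hb a1 a2
end
end
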